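/- Let γ, ρ ∈ (0,1), β ∈ [0,1), 1 < r ≤ q < ∞ with β = 1/r − 1/q, and let ω be a weight on ℝ^{n+1}. Then ω ∈ A_{r,q}⁺(γ) if and only if the centered operator 𝓜_β^{ρ+} is bounded from L^r(ℝ^{n+1}, ω^r) to L^q(ℝ^{n+1}, ω^q), i.e., there exists a positive constant C such that ‖𝓜_β^{ρ+}(f)‖_{L^q(ℝ^{n+1},ω^q)} ≤ C ‖f‖_{L^r(ℝ^{n+1},ω^r)} for every f ∈ L^r(ℝ^{n+1}, ω^r). -/

import Mathlib

open MeasureTheory ENNReal NNReal Set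

noncomputable section

/-- The `γ`-upper part `R⁺(γ)` of the parabolic rectangle `R(x,t,L)`. -/
def parUp (n : ℕ) (p : ℝ) (x : Fin n → ℝ) (t L γ : ℝ) : Set ((Fin n → ℝ) × ℝ) :=
  {z : (Fin n → ℝ) × ℝ | ‖z.1 - x‖ ≤ L ∧ z.2 ∈ Set.Ioo (t + γ * L ^ p) (t + L ^ p)}

/-- The `γ`-lower part `R⁻(γ)` of the parabolic rectangle `R(x,t,L)`. -/
def parLow (n : ℕ) (p : ℝ) (x : Fin n → ℝ) (t L γ : ℝ) : Set ((Fin n → ℝ) × ℝ) :=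
  {z : (Fin n → ℝ) × ℝ | ‖z.1 - x‖ ≤ L ∧ z.2 ∈ Set.Ioo (t - L ^ p) (t - γ * L ^ p)}

/-- The integral average `⨍_A f`, valued in `ℝ≥0∞`. -/
def setAvg {n : ℕ} (A : Set ((Fin n → ℝ) × ℝ)) (f : ((Fin n → ℝ) × ℝ) → ℝ≥0∞) : ℝ≥0∞ :=
  (∫⁻ z in A, f z) / volume A

/-- The backward-in-time translate `A − (0, a)`. -/
def timeShift {n : ℕ} (A : Set ((Fin n → ℝ) × ℝ)) (a : ℝ) : Set ((Fin n → ℝ) × ℝ) :=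
  {z : (Fin n → ℝ) × ℝ | (z.1, z.2 + a) ∈ A}

/-- `[u,v]_{TA_{r,q}^+(γ)}` for `1 < r ≤ q`. -/
def TArq (n : ℕ) (p γ r q : ℝ) (u v : ((Fin n → ℝ) × ℝ) → ℝ) : ℝ≥0∞ :=
  ⨆ (x : Fin n → ℝ) (t : ℝ) (L : ℝ) (_ : 0 < L),
    setAvg (parLow n p x t L γ) (fun z => ENNReal.ofReal (u z) ^ q) *
      (setAvg (parUp n p x t L γ)
          (fun z => ENNReal.ofReal (v z) ^ (-(r / (r - 1))))) ^ (q / (r / (r - 1)))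

/-- `[u,v]_{TA_{1,q}^+(γ)}`. -/
def TA1q (n : ℕ) (p γ q : ℝ) (u v : ((Fin n → ℝ) × ℝ) → ℝ) : ℝ≥0∞ :=
  ⨆ (x : Fin n → ℝ) (t : ℝ) (L : ℝ) (_ : 0 < L),
    setAvg (parLow n p x t L γ) (fun z => ENNReal.ofReal (u z) ^ q) *
      (essInf (fun z => ENNReal.ofReal (v z)) (volume.restrict (parUp n p x t L γ))) ^ (-q)

/-- The `TA_{r,q}^+(γ)` constant, for all `1 ≤ r ≤ q`. -/
def TAconst (n : ℕ) (p γ r q : ℝ) (u v : ((Fin n → ℝ) × ℝ) → ℝ) : ℝ≥0∞ :=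
  if r = 1 then TA1q n p γ q u v else TArq n p γ r q u v

/-- `[u,v]_{TA_{r,q}^-(γ)}` (time axis reversed), for `1 < r ≤ q`. -/
def TArqMinus (n : ℕ) (p γ r q : ℝ) (u v : ((Fin n → ℝ) × ℝ) → ℝ) : ℝ≥0∞ :=
  ⨆ (x : Fin n → ℝ) (t : ℝ) (L : ℝ) (_ : 0 < L),
    setAvg (parUp n p x t L γ) (fun z => ENNReal.ofReal (u z) ^ q) *
      (setAvg (parLow n p x t L γ)
          (fun z => ENNReal.ofReal (v z) ^ (-(r / (r - 1))))) ^ (q / (r / (r - 1)))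

/-- The parabolic Muckenhoupt `A_q^+(γ)` constant. -/
def parAq (n : ℕ) (p γ q : ℝ) (w : ((Fin n → ℝ) × ℝ) → ℝ) : ℝ≥0∞ :=
  ⨆ (x : Fin n → ℝ) (t : ℝ) (L : ℝ) (_ : 0 < L),
    setAvg (parLow n p x t L γ) (fun z => ENNReal.ofReal (w z)) *
      (setAvg (parUp n p x t L γ) (fun z => ENNReal.ofReal (w z) ^ (1 / (1 - q)))) ^ (q - 1)

/-- Membership in `A_∞^+(γ) := ⋃_{q ∈ (1,∞)} A_q^+(γ)`. -/
def memAinf (n : ℕ) (p γ : ℝ) (w : ((Fin n → ℝ) × ℝ) → ℝ) : Prop :=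
  ∃ q : ℝ, 1 < q ∧ parAq n p γ q w < ∞

/-- The uncentered forward-in-time parabolic fractional maximal function `M_β^{γ+} f`. -/
def uMax (n : ℕ) (p γ β : ℝ) (f : ((Fin n → ℝ) × ℝ) → ℝ) (z : (Fin n → ℝ) × ℝ) : ℝ≥0∞ :=
  ⨆ (x : Fin n → ℝ) (t : ℝ) (L : ℝ) (_ : 0 < L) (_ : z ∈ parLow n p x t L γ),
    volume (parUp n p x t L γ) ^ β *
      setAvg (parUp n p x t L γ) (fun w => ENNReal.ofReal |f w|)

/-- The uncentered back-in-time parabolic fractional maximal function `M_β^{γ−} f`. -/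
def uMaxBack (n : ℕ) (p γ β : ℝ) (f : ((Fin n → ℝ) × ℝ) → ℝ) (z : (Fin n → ℝ) × ℝ) : ℝ≥0∞ :=
  ⨆ (x : Fin n → ℝ) (t : ℝ) (L : ℝ) (_ : 0 < L) (_ : z ∈ parUp n p x t L γ),
    volume (parLow n p x t L γ) ^ β *
      setAvg (parLow n p x t L γ) (fun w => ENNReal.ofReal |f w|)

/-- The centered forward-in-time parabolic fractional maximal function `𝓜_β^{γ+} f`. -/
def cMax (n : ℕ) (p γ β : ℝ) (f : ((Fin n → ℝ) × ℝ) → ℝ) (z : (Fin n → ℝ) × ℝ) : ℝ≥0∞ :=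
  ⨆ (L : ℝ) (_ : 0 < L),
    volume (parUp n p z.1 z.2 L γ) ^ β *
      setAvg (parUp n p z.1 z.2 L γ) (fun w => ENNReal.ofReal |f w|)

/-- `‖f‖_{L^r(ℝ^{n+1}, w^r)}` as a lintegral. -/
def wLp {n : ℕ} (r : ℝ) (w f : ((Fin n → ℝ) × ℝ) → ℝ) : ℝ≥0∞ :=
  (∫⁻ z, ENNReal.ofReal |f z| ^ r * ENNReal.ofReal (w z) ^ r) ^ (1 / r)

/-- The weighted `L^q(w^q)` norm of an `ℝ≥0∞`-valued function. -/
def wLpE {n : ℕ} (q : ℝ) (w : ((Fin n → ℝ) × ℝ) → ℝ)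
    (g : ((Fin n → ℝ) × ℝ) → ℝ≥0∞) : ℝ≥0∞ :=
  (∫⁻ z, g z ^ q * ENNReal.ofReal (w z) ^ q) ^ (1 / q)

/-- The weighted weak `L^{q,∞}(w^q)` norm of an `ℝ≥0∞`-valued function. -/
def wWeak {n : ℕ} (q : ℝ) (w : ((Fin n → ℝ) × ℝ) → ℝ)
    (g : ((Fin n → ℝ) × ℝ) → ℝ≥0∞) : ℝ≥0∞ :=
  ⨆ (lam : ℝ≥0) (_ : 0 < lam),
    (lam : ℝ≥0∞) * (∫⁻ z in {z | (lam : ℝ≥0∞) < g z}, ENNReal.ofReal (w z) ^ q) ^ (1 / q)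

/-- The parabolic forward-in-time fractional integral `I_β^{γ+} f` (unsigned version). -/
def parI (n : ℕ) (p γ β : ℝ) (f : ((Fin n → ℝ) × ℝ) → ℝ) (z : (Fin n → ℝ) × ℝ) : ℝ≥0∞ :=
  ∫⁻ w in {w : (Fin n → ℝ) × ℝ | γ * ‖w.1‖ ^ p < w.2},
    ENNReal.ofReal (f (z.1 - w.1, z.2 - w.2) *
      (max ‖w.1‖ (|w.2| ^ (1 / p))) ^ (-(((n : ℝ) + p) * (1 - β))))

/-- The parabolic forward-in-time fractional integral `I_β^{γ+} f` (signed version). -/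
def parIR (n : ℕ) (p γ β : ℝ) (f : ((Fin n → ℝ) × ℝ) → ℝ) (z : (Fin n → ℝ) × ℝ) : ℝ :=
  ∫ w in {w : (Fin n → ℝ) × ℝ | γ * ‖w.1‖ ^ p < w.2},
    f (z.1 - w.1, z.2 - w.2) * (max ‖w.1‖ (|w.2| ^ (1 / p))) ^ (-(((n : ℝ) + p) * (1 - β)))



/-! ### Part 1: towers of partitions -/

/-- A cell of a tower of partitions. -/
def tcube {X I : Type*} (idx : ℤ → X → I) (B : ℤ × I) : Set X := {z | idx B.1 z = B.2}

/-- The maximal cells of a family. -/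
def tmax {X I : Type*} (idx : ℤ → X → I) (G : Set (ℤ × I)) : Set (ℤ × I) :=
  {B | B ∈ G ∧ ∀ z ∈ tcube idx B, ∀ k : ℤ, B.1 < k → (k, idx k z) ∉ G}

lemma tower_nest {X I : Type*} {idx : ℤ → X → I}
    (hnest : ∀ k z z', idx k z = idx k z' → idx (k + 1) z = idx (k + 1) z')
    {k k' : ℤ} (h : k ≤ k') {z z' : X} (hz : idx k z = idx k z') : idx k' z = idx k' z' := by
  obtain ⟨d, rfl⟩ := Int.le.dest h
  induction d with
  | zero => simpa using hz
  | succ d ih =>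
    have := hnest _ _ _ (ih (by omega))
    push_cast
    rw [← add_assoc]
    exact this

lemma exists_tmax {X I : Type*} {idx : ℤ → X → I} {G : Set (ℤ × I)} {j : ℤ}
    (hnest : ∀ k z z', idx k z = idx k z' → idx (k + 1) z = idx (k + 1) z')
    (hj : ∀ B ∈ G, B.1 ≤ j) {B : ℤ × I} (hB : B ∈ G) {z : X} (hz : z ∈ tcube idx B) :
    ∃ Q ∈ tmax idx G, z ∈ tcube idx Q := by
  obtain ⟨k, hk, hmax⟩ := Int.exists_greatest_of_bdd (P := fun k => (k, idx k z) ∈ G)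
    ⟨j, fun k hk => hj _ hk⟩ ⟨B.1, by
      have : idx B.1 z = B.2 := hz
      simpa [this] using hB⟩
  refine ⟨(k, idx k z), ⟨hk, ?_⟩, rfl⟩
  intro y hy k' hk' hG
  have hy' : idx k y = idx k z := hy
  have := tower_nest hnest hk'.le hy'
  rw [this] at hG
  exact absurd (hmax k' hG) (not_le.mpr hk')

lemma tmax_unique {X I : Type*} {idx : ℤ → X → I} {G : Set (ℤ × I)} {Q Q' : ℤ × I}
    (hQ : Q ∈ tmax idx G) (hQ' : Q' ∈ tmax idx G) {z : X} (hz : z ∈ tcube idx Q)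
    (hz' : z ∈ tcube idx Q') : Q = Q' := by
  have e : idx Q.1 z = Q.2 := hz
  have e' : idx Q'.1 z = Q'.2 := hz'
  rcases lt_trichotomy Q.1 Q'.1 with h | h | h
  · have := hQ.2 z hz _ h
    rw [e'] at this
    exact absurd hQ'.1 this
  · ext1
    · exact h
    · rw [← e, ← e', h]
  · have := hQ'.2 z hz' _ h
    rw [e] at this
    exact absurd hQ.1 this

lemma tmax_disjoint {X I : Type*} (idx : ℤ → X → I) (G : Set (ℤ × I)) :
    Pairwise (Function.onFun Disjoint (fun B : tmax idx G => tcube idx (B : ℤ × I))) := by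
  intro Q Q' hne
  rw [Function.onFun, Set.disjoint_left]
  intro z hz hz'
  exact hne (Subtype.ext (tmax_unique Q.2 Q'.2 hz hz'))

lemma tower_vitali {X I : Type*} [MeasurableSpace X] [Countable I] {idx : ℤ → X → I}
    {G : Set (ℤ × I)} {j : ℤ}
    (hnest : ∀ k z z', idx k z = idx k z' → idx (k + 1) z = idx (k + 1) z')
    (hmeas : ∀ B : ℤ × I, MeasurableSet (tcube idx B))
    (hj : ∀ B ∈ G, B.1 ≤ j) (μ ν : Measure X)
    (h : ∀ B ∈ G, μ (tcube idx B) ≤ ν (tcube idx B)) :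
    μ (⋃ B ∈ G, tcube idx B) ≤ ν (⋃ B ∈ G, tcube idx B) := by
  have hsub : (⋃ B ∈ G, tcube idx B) ⊆ ⋃ B : tmax idx G, tcube idx (B : ℤ × I) := by
    intro z hz
    simp only [mem_iUnion] at hz
    obtain ⟨B, hB, hz⟩ := hz
    obtain ⟨Q, hQ, hzQ⟩ := exists_tmax hnest hj hB hz
    exact mem_iUnion.mpr ⟨⟨Q, hQ⟩, hzQ⟩
  have hsub' : (⋃ B : tmax idx G, tcube idx (B : ℤ × I)) ⊆ ⋃ B ∈ G, tcube idx B := by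
    intro z hz
    simp only [mem_iUnion] at hz ⊢
    obtain ⟨B, hz⟩ := hz
    exact ⟨B, B.2.1, hz⟩
  calc μ (⋃ B ∈ G, tcube idx B) ≤ μ (⋃ B : tmax idx G, tcube idx (B : ℤ × I)) := measure_mono hsub
    _ ≤ ∑' B : tmax idx G, μ (tcube idx (B : ℤ × I)) := measure_iUnion_le _
    _ ≤ ∑' B : tmax idx G, ν (tcube idx (B : ℤ × I)) := ENNReal.tsum_le_tsum fun B => h _ B.2.1
    _ = ν (⋃ B : tmax idx G, tcube idx (B : ℤ × I)) :=
      (measure_iUnion (tmax_disjoint idx G) fun B => hmeas _).symm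
    _ ≤ _ := measure_mono hsub'

/-- Packing estimate. -/
lemma tower_packing {X I : Type*} [MeasurableSpace X] [Countable I] {idx : ℤ → X → I}
    {G : Set (ℤ × I)}
    (hmeas : ∀ B : ℤ × I, MeasurableSet (tcube idx B))
    (hnest : ∀ k z z', idx k z = idx k z' → idx (k + 1) z = idx (k + 1) z')
    (μ : Measure X) (F : ℤ × I → Set X)
    (hF : ∀ B ∈ G, MeasurableSet (F B))
    (hFd : ∀ B ∈ G, ∀ B' ∈ G, B ≠ B' → Disjoint (F B) (F B'))
    (hFp : ∀ B ∈ G, ∀ y ∈ F B, ∀ z ∈ tcube idx B, idx (B.1 + 1) y = idx (B.1 + 1) z)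
    (C : ℝ≥0∞) (hC : ∀ B ∈ G, μ (tcube idx B) ≤ C * μ (F B)) :
    ∑' B : G, μ (tcube idx (B : ℤ × I)) ≤ (1 + C) * μ (⋃ B ∈ G, tcube idx B) := by
  classical
  have hpt : ∀ B : G, μ (tcube idx (B : ℤ × I)) ≤
      (if (B : ℤ × I) ∈ tmax idx G then μ (tcube idx (B : ℤ × I)) else 0) +
      (if (B : ℤ × I) ∈ tmax idx G then 0 else C * μ (F B)) := by
    intro B
    by_cases h : (B : ℤ × I) ∈ tmax idx G
    · simp [h]
    · simpa [h] using hC B B.2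
  refine (ENNReal.tsum_le_tsum hpt).trans ?_
  rw [ENNReal.tsum_add, add_mul, one_mul]
  refine add_le_add ?_ ?_
  · have : (fun B : G => if (B : ℤ × I) ∈ tmax idx G then μ (tcube idx (B : ℤ × I)) else 0) =
        fun B : G => μ (if (B : ℤ × I) ∈ tmax idx G then tcube idx (B : ℤ × I) else ∅) := by
      ext B; split_ifs <;> simp
    rw [this, ← measure_iUnion]
    · apply measure_mono
      intro z hz
      simp only [mem_iUnion] at hz ⊢
      obtain ⟨B, hz⟩ := hz
      refine ⟨B, B.2, ?_⟩
      split_ifs at hz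
      · exact hz
      · exact absurd hz (Set.notMem_empty _)
    · intro B B' hne
      rw [Function.onFun, Set.disjoint_left]
      intro z hz hz'
      split_ifs at hz with h1
      · split_ifs at hz' with h2
        · exact hne (Subtype.ext (tmax_unique h1 h2 hz hz'))
        · exact hz'
      · exact hz
    · intro B
      split_ifs
      · exact hmeas _
      · exact MeasurableSet.empty
  · have : (fun B : G => if (B : ℤ × I) ∈ tmax idx G then 0 else C * μ (F B)) =
        fun B : G => C * μ (if (B : ℤ × I) ∈ tmax idx G then ∅ else F B) := by
      ext B; split_ifs <;> simp
    rw [this, ENNReal.tsum_mul_left, ← measure_iUnion]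
    · gcongr
      intro z hz
      simp only [mem_iUnion] at hz ⊢
      obtain ⟨B, hz⟩ := hz
      split_ifs at hz with h
      · exact absurd hz (Set.notMem_empty _)
      · have h' : ∃ y ∈ tcube idx (B : ℤ × I), ∃ k : ℤ, (B : ℤ × I).1 < k ∧ (k, idx k y) ∈ G := by
          by_contra hcon
          push Not at hcon
          exact h ⟨B.2, hcon⟩
        obtain ⟨y, hy, k, hk, hG⟩ := h'
        refine ⟨(k, idx k y), hG, ?_⟩
        exact tower_nest hnest (by omega : (B : ℤ × I).1 + 1 ≤ k) (hFp B B.2 z hz y hy)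
    · intro B B' hne
      rw [Function.onFun, Set.disjoint_left]
      intro z hz hz'
      split_ifs at hz with h1
      · exact hz
      · split_ifs at hz' with h2
        · exact hz'
        · exact Set.disjoint_left.mp (hFd B B.2 B' B'.2 (fun h => hne (Subtype.ext h))) hz hz'
    · intro B
      split_ifs
      · exact MeasurableSet.empty
      · exact hF _ B.2

lemma layer_one (x : ℝ≥0∞) (hx : x ≠ ∞) (s : ℝ) (hs : 0 < s) :
    ∫⁻ t in Ioi (0 : ℝ), (if ENNReal.ofReal t < x then 1 else 0) * ENNReal.ofReal (s * t ^ (s - 1))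
      = x ^ s := by
  have h := lintegral_rpow_eq_lintegral_meas_lt_mul (Measure.dirac ())
    (f := fun _ => x.toReal) (by filter_upwards with u using ENNReal.toReal_nonneg)
    (by fun_prop) hs
  simp only [lintegral_dirac] at h
  have e1 : ENNReal.ofReal (x.toReal ^ s) = x ^ s := by
    rw [← ENNReal.ofReal_rpow_of_nonneg ENNReal.toReal_nonneg hs.le, ENNReal.ofReal_toReal hx]
  rw [← e1, h, ← lintegral_const_mul' _ _ ENNReal.ofReal_ne_top]
  refine setLIntegral_congr_fun measurableSet_Ioi ?_
  intro t ht
  have ht' : (0 : ℝ) < t := ht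
  have : (Measure.dirac ()) {a : Unit | t < x.toReal} = if ENNReal.ofReal t < x then 1 else 0 := by
    by_cases h : t < x.toReal
    · have : ENNReal.ofReal t < x := (ENNReal.ofReal_lt_iff_lt_toReal ht'.le hx).mpr h
      simp [h, this]
    · have : ¬ ENNReal.ofReal t < x := fun h' => h ((ENNReal.ofReal_lt_iff_lt_toReal ht'.le hx).mp h')
      simp [h, this]
  simp only [this]
  rw [ENNReal.ofReal_mul hs.le]
  ring

lemma carleson {X I : Type*} [MeasurableSpace X] [Countable I] {idx : ℤ → X → I}
    (hnest : ∀ k z z', idx k z = idx k z' → idx (k + 1) z = idx (k + 1) z')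
    (hmeas : ∀ B : ℤ × I, MeasurableSet (tcube idx B))
    (μ : Measure X) [SFinite μ] (f σ h : X → ℝ≥0∞) (hf : Measurable f) (hσ : Measurable σ)
    (hh : Measurable h) (hhtop : ∀ z, h z ≠ ∞)
    (hfs : ∀ z, ∀ t : ℝ≥0∞, 0 < t → h z ≤ t → f z ≤ t * σ z)
    (r : ℝ) (hr : 1 < r)
    (T : Set (ℤ × I)) (j : ℤ) (hj : ∀ B ∈ T, B.1 ≤ j)
    (hT0 : ∀ B ∈ T, ∫⁻ z in tcube idx B, σ z ∂μ ≠ 0)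
    (hT1 : ∀ B ∈ T, ∫⁻ z in tcube idx B, σ z ∂μ ≠ ∞)
    (hT2 : ∀ B ∈ T, ∫⁻ z in tcube idx B, f z ∂μ ≠ ∞)
    (F : ℤ × I → Set X)
    (hF : ∀ B ∈ T, MeasurableSet (F B))
    (hFd : ∀ B ∈ T, ∀ B' ∈ T, B ≠ B' → Disjoint (F B) (F B'))
    (hFp : ∀ B ∈ T, ∀ y ∈ F B, ∀ z ∈ tcube idx B, idx (B.1 + 1) y = idx (B.1 + 1) z)
    (C : ℝ≥0∞)
    (hC : ∀ B ∈ T, ∫⁻ z in tcube idx B, σ z ∂μ ≤ C * ∫⁻ z in F B, σ z ∂μ) :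
    ∑' B : T, (∫⁻ z in tcube idx (B : ℤ × I), σ z ∂μ) ^ (1 - r) *
        (∫⁻ z in tcube idx (B : ℤ × I), f z ∂μ) ^ r ≤
      (1 + C) * ENNReal.ofReal (2 * (r / (r - 1)) * 2 ^ (r - 1)) *
        ∫⁻ z, h z ^ (r - 1) * f z ∂μ := by
  classical
  set s : ℤ × I → ℝ≥0∞ := fun B => ∫⁻ z in tcube idx B, σ z ∂μ with hs
  set m : ℤ × I → ℝ≥0∞ := fun B => ∫⁻ z in tcube idx B, f z ∂μ with hm
  have hr0 : 0 < r := by linarith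
  have hr1 : 0 < r - 1 := by linarith
  -- term identity
  have hterm : ∀ B : T, s B ^ (1 - r) * m B ^ r =
      ∫⁻ t in Ioi (0 : ℝ), (if ENNReal.ofReal t < m B / s B then s B else 0) *
        ENNReal.ofReal (r * t ^ (r - 1)) := by
    intro B
    have h0 := hT0 B B.2
    have h1 := hT1 B B.2
    have h2 := hT2 B B.2
    have hg : m B / s B ≠ ∞ := ENNReal.div_ne_top h2 h0
    have e := layer_one (m B / s B) hg r hr0
    have e2 : s B ^ (1 - r) * m B ^ r = s B * (m B / s B) ^ r := by
      rw [ENNReal.div_rpow_of_nonneg _ _ hr0.le, ENNReal.rpow_sub _ _ h0 h1, ENNReal.rpow_one]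
      simp only [div_eq_mul_inv]
      ring
    rw [e2, ← e, ← lintegral_const_mul' _ _ h1]
    congr 1
    ext t
    split_ifs <;> simp [hs]
  have key : ∀ t : ℝ, 0 < t →
      ∑' B : T, (if ENNReal.ofReal t < m B / s B then s B else 0) ≤
      (1 + C) * ∫⁻ z, (ENNReal.ofReal (2 / t)) * (f z * (if ENNReal.ofReal t < 2 * h z then 1 else 0)) ∂μ := by
    intro t ht
    set G : Set (ℤ × I) := {B | B ∈ T ∧ ENNReal.ofReal t < m B / s B} with hG
    have hGT : ∀ B ∈ G, B ∈ T := fun B hB => hB.1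
    set φ : X → ℝ≥0∞ := fun z => (ENNReal.ofReal (2 / t)) *
      (f z * (if ENNReal.ofReal t < 2 * h z then 1 else 0)) with hφ
    have hφm : Measurable φ := by
      refine Measurable.const_mul (hf.mul ?_) _
      refine Measurable.ite ?_ measurable_const measurable_const
      exact measurableSet_lt measurable_const (hh.const_mul _)
    have hsw : ∀ A, MeasurableSet A → (μ.withDensity σ) A = ∫⁻ z in A, σ z ∂μ :=
      fun A hA => withDensity_apply _ hA
    have e1 : ∑' B : T, (if ENNReal.ofReal t < m B / s B then s B else 0) =
        ∑' B : G, (μ.withDensity σ) (tcube idx (B : ℤ × I)) := by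
      have : ∀ B : G, (μ.withDensity σ) (tcube idx (B : ℤ × I)) = s B :=
        fun B => hsw _ (hmeas _)
      simp_rw [this]
      rw [tsum_subtype G s, tsum_subtype T (fun B => if ENNReal.ofReal t < m B / s B then s B else 0)]
      congr 1
      ext B
      by_cases h1 : B ∈ T
      · by_cases h2 : ENNReal.ofReal t < m B / s B
        · have : B ∈ G := ⟨h1, h2⟩
          simp [Set.indicator, h1, h2, this]
        · have : B ∉ G := fun h => h2 h.2
          simp [Set.indicator, h2, this]
      · have : B ∉ G := fun h => h1 h.1
        simp [Set.indicator, h1, this]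
    rw [e1]
    refine (tower_packing hmeas hnest (μ.withDensity σ) F (fun B hB => hF B hB.1)
      (fun B hB B' hB' => hFd B hB.1 B' hB'.1) (fun B hB => hFp B hB.1) C ?_).trans ?_
    · intro B hB
      rw [hsw _ (hmeas _), hsw _ (hF B hB.1)]
      exact hC B hB.1
    · gcongr
      refine (tower_vitali hnest hmeas (fun B hB => hj B hB.1) (μ.withDensity σ)
        (μ.withDensity φ) ?_).trans ?_
      · intro B hB
        rw [hsw _ (hmeas _), withDensity_apply _ (hmeas _)]
        have h0 := hT0 B hB.1
        have h1 := hT1 B hB.1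
        have h2 := hT2 B hB.1
        have hlt : ENNReal.ofReal t * s B ≤ m B :=
          (ENNReal.le_div_iff_mul_le (Or.inl h0) (Or.inl h1)).mp hB.2.le
        -- pointwise
        have hpw : ∀ z, f z ≤ ENNReal.ofReal (t / 2) * σ z + ENNReal.ofReal (t / 2) * φ z := by
          intro z
          by_cases hz : ENNReal.ofReal t < 2 * h z
          · refine le_trans ?_ le_add_self
            simp only [hφ, hz, if_true, mul_one]
            rw [← mul_assoc, ← ENNReal.ofReal_mul (by positivity)]
            rw [show t / 2 * (2 / t) = 1 by field_simp]
            simp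
          · refine le_trans ?_ le_self_add
            apply hfs z _ (by simpa using ht)
            push Not at hz
            have : 2 * h z ≤ 2 * ENNReal.ofReal (t/2) := by
              refine hz.trans_eq ?_
              rw [show (2:ℝ≥0∞) = ENNReal.ofReal 2 by simp, ← ENNReal.ofReal_mul (by norm_num)]
              congr 1; ring
            exact (ENNReal.mul_le_mul_iff_right (by norm_num) (by norm_num)).mp this
        have hIntg : m B ≤ ENNReal.ofReal (t / 2) * s B +
            ENNReal.ofReal (t / 2) * ∫⁻ z in tcube idx B, φ z ∂μ := by
          refine (lintegral_mono hpw).trans_eq ?_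
          rw [lintegral_add_left (hσ.const_mul _), lintegral_const_mul _ hσ,
            lintegral_const_mul _ hφm]
        have e3 : ENNReal.ofReal t * s B = ENNReal.ofReal (t/2) * s B + ENNReal.ofReal (t/2) * s B := by
          rw [← add_mul, ← ENNReal.ofReal_add (by positivity) (by positivity)]
          congr 2; ring
        have h4 := hlt.trans hIntg
        rw [e3] at h4
        have h5 := (ENNReal.add_le_add_iff_left (ENNReal.mul_ne_top ENNReal.ofReal_ne_top h1)).mp h4
        exact (ENNReal.mul_le_mul_iff_right (by simpa using ht) ENNReal.ofReal_ne_top).mp h5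
      · refine (measure_mono (subset_univ _)).trans_eq ?_
        rw [withDensity_apply _ MeasurableSet.univ, Measure.restrict_univ]
  have hcalc : ∑' B : T, s B ^ (1 - r) * m B ^ r ≤
      ∫⁻ t in Ioi (0:ℝ), ((1 + C) * ∫⁻ z, (ENNReal.ofReal (2 / t)) *
        (f z * (if ENNReal.ofReal t < 2 * h z then 1 else 0)) ∂μ) * ENNReal.ofReal (r * t ^ (r - 1)) := by
    simp_rw [hterm]
    rw [← lintegral_tsum]
    · refine setLIntegral_mono' measurableSet_Ioi ?_
      intro t ht
      rw [ENNReal.tsum_mul_right]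
      gcongr
      exact key t ht
    · intro B
      apply Measurable.aemeasurable
      apply Measurable.mul
      · refine Measurable.ite ?_ measurable_const measurable_const
        exact measurableSet_lt (by fun_prop) measurable_const
      · fun_prop
  refine hcalc.trans ?_
  -- Tonelli
  have e4 : ∀ t ∈ Ioi (0:ℝ), ((1 + C) * ∫⁻ z, (ENNReal.ofReal (2 / t)) *
        (f z * (if ENNReal.ofReal t < 2 * h z then 1 else 0)) ∂μ) * ENNReal.ofReal (r * t ^ (r - 1))
      = (1 + C) * ∫⁻ z, ENNReal.ofReal (2 * (r / (r-1))) * f z *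
        ((if ENNReal.ofReal t < 2 * h z then 1 else 0) * ENNReal.ofReal ((r - 1) * t ^ ((r - 1) - 1))) ∂μ := by
    intro t ht
    have ht' : 0 < t := ht
    rw [mul_assoc, ← lintegral_mul_const' _ _ ENNReal.ofReal_ne_top]
    congr 2
    ext z
    have : ENNReal.ofReal (2 / t) * ENNReal.ofReal (r * t ^ (r - 1)) =
      ENNReal.ofReal (2 * (r / (r-1))) * ENNReal.ofReal ((r - 1) * t ^ ((r - 1) - 1)) := by
      rw [← ENNReal.ofReal_mul (by positivity), ← ENNReal.ofReal_mul (by positivity)]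
      congr 1
      rw [Real.rpow_sub_one ht'.ne' (r-1)]
      field_simp
    calc _ = f z * (if ENNReal.ofReal t < 2 * h z then 1 else 0) *
        (ENNReal.ofReal (2 / t) * ENNReal.ofReal (r * t ^ (r - 1))) := by ring
      _ = _ := by rw [this]; ring
  rw [setLIntegral_congr_fun measurableSet_Ioi e4]
  have hjoint : Measurable (Function.uncurry fun (t : ℝ) (z : X) => ENNReal.ofReal (2 * (r / (r-1))) * f z *
        ((if ENNReal.ofReal t < 2 * h z then 1 else 0) * ENNReal.ofReal ((r - 1) * t ^ ((r - 1) - 1)))) := by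
    simp only [Function.uncurry_def]
    apply Measurable.mul
    · exact (hf.comp measurable_snd).const_mul _
    · apply Measurable.mul
      · refine Measurable.ite ?_ measurable_const measurable_const
        exact measurableSet_lt (by fun_prop) ((hh.comp measurable_snd).const_mul _)
      · fun_prop
  rw [lintegral_const_mul _ (Measurable.lintegral_prod_right (f := fun (t : ℝ) (z : X) => _) hjoint), lintegral_lintegral_swap hjoint.aemeasurable]
  rw [mul_assoc]
  gcongr
  rw [← lintegral_const_mul _ (by fun_prop)]
  refine lintegral_mono fun z => ?_
  rw [lintegral_const_mul]
  · rw [layer_one _ (ENNReal.mul_ne_top (by norm_num) (hhtop z)) _ hr1]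
    rw [ENNReal.mul_rpow_of_nonneg _ _ hr1.le]
    apply le_of_eq
    rw [ENNReal.ofReal_mul (p := 2 * (r / (r - 1))) (by positivity),
      ← ENNReal.ofReal_rpow_of_pos (by norm_num)]
    simp only [ENNReal.ofReal_ofNat]
    ring
  · refine Measurable.mul ?_ (by fun_prop)
    refine Measurable.ite ?_ measurable_const measurable_const
    exact measurableSet_lt (by fun_prop) measurable_const

lemma tsum_rpow_le {ι : Type*} (x : ι → ℝ≥0∞) (s : ℝ) (hs : 1 ≤ s) :
    ∑' i, x i ^ s ≤ (∑' i, x i) ^ s := by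
  have h : ∀ i, x i ^ s ≤ x i * (∑' i, x i) ^ (s - 1) := by
    intro i
    calc x i ^ s = x i ^ (1 + (s - 1)) := by ring_nf
      _ = x i ^ (1:ℝ) * x i ^ (s - 1) := ENNReal.rpow_add_of_nonneg _ _ (by norm_num) (by linarith)
      _ ≤ _ := by
        rw [ENNReal.rpow_one]
        gcongr
        exact ENNReal.le_tsum i
  refine (ENNReal.tsum_le_tsum h).trans_eq ?_
  rw [ENNReal.tsum_mul_right]
  nth_rewrite 1 [← ENNReal.rpow_one (∑' i, x i)]
  rw [← ENNReal.rpow_add_of_nonneg _ _ (by norm_num) (by linarith)]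
  congr 1
  ring

/-- Compatibility of the two densities. -/
def WS {X : Type*} (W σ : X → ℝ≥0∞) (θ : ℝ) : Prop :=
  ∀ z, W z * σ z ^ θ = 1 ∨ (W z = 0 ∧ σ z = ∞)

lemma holder_ws {X : Type*} [MeasurableSpace X] (μ : Measure X) {W σ : X → ℝ≥0∞} {θ : ℝ}
    (hθ : 0 < θ) (hW : Measurable W) (hσ : Measurable σ) (hws : WS W σ θ) (F : Set X)
    (hfin : ∫⁻ z in F, σ z ∂μ ≠ ∞) :
    μ F ^ (1 + θ) ≤ (∫⁻ z in F, W z ∂μ) * (∫⁻ z in F, σ z ∂μ) ^ θ := by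
  have hae : ∀ᵐ z ∂(μ.restrict F), σ z < ∞ := ae_lt_top hσ hfin
  have hpq : (1 + θ).HolderConjugate ((1 + θ) / θ) := by
    rw [Real.holderConjugate_iff]
    constructor
    · linarith
    · field_simp
      try ring
  have h := ENNReal.lintegral_mul_le_Lp_mul_Lq (μ.restrict F) hpq
    (f := fun z => W z ^ (1 / (1 + θ))) (g := fun z => σ z ^ (θ / (1 + θ)))
    (by fun_prop) (by fun_prop)
  have e1 : ∫⁻ z in F, ((fun z => W z ^ (1 / (1 + θ))) * (fun z => σ z ^ (θ / (1 + θ)))) z ∂μ = μ F := by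
    rw [← setLIntegral_one]
    refine lintegral_congr_ae ?_
    filter_upwards [hae] with z hz
    rcases hws z with h | h
    · simp only [Pi.mul_apply]
      rw [show θ / (1 + θ) = θ * (1 / (1 + θ)) by ring, ENNReal.rpow_mul,
        ← ENNReal.mul_rpow_of_nonneg _ _ (by positivity), h, ENNReal.one_rpow]
    · exact absurd h.2 hz.ne
  rw [e1] at h
  have h2 := ENNReal.rpow_le_rpow h (by positivity : 0 ≤ 1 + θ)
  refine h2.trans_eq ?_
  have h1 : 1 + θ ≠ 0 := by positivity
  rw [ENNReal.mul_rpow_of_nonneg _ _ (by positivity), ← ENNReal.rpow_mul, ← ENNReal.rpow_mul]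
  simp only [← ENNReal.rpow_mul]
  rw [show 1 / (1 + θ) * (1 + θ) = 1 by field_simp, show θ / (1 + θ) * ((1 + θ) / θ) = 1 by field_simp,
    show 1 / ((1 + θ) / θ) * (1 + θ) = θ by field_simp]
  simp

lemma hol {X : Type*} [MeasurableSpace X] (μ : Measure X) {W σ : X → ℝ≥0∞} {θ : ℝ}
    (hθ : 0 < θ) (hW : Measurable W) (hσ : Measurable σ) (hws : WS W σ θ) (F : Set X)
    (hF0 : μ F ≠ 0) (hF1 : μ F ≠ ∞) (K : ℝ≥0∞) (hK0 : K ≠ 0) (hK : K ≠ ∞) (x : ℝ≥0∞)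
    (h : (∫⁻ z in F, W z ∂μ) * x ^ θ ≤ K * μ F ^ (1 + θ)) :
    x ^ θ ≤ K * (∫⁻ z in F, σ z ∂μ) ^ θ := by
  by_cases hfin : ∫⁻ z in F, σ z ∂μ = ∞
  · rw [hfin, ENNReal.top_rpow_of_pos hθ, ENNReal.mul_top hK0]
    exact le_top
  have h1 := holder_ws μ hθ hW hσ hws F hfin
  have h2 : (∫⁻ z in F, W z ∂μ) ≠ 0 := by
    intro h0
    rw [h0, zero_mul] at h1
    have := (ENNReal.rpow_eq_zero_iff_of_pos (by positivity : 0 < 1 + θ)).mp (le_antisymm h1 (zero_le))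
    exact hF0 this
  by_cases h3 : (∫⁻ z in F, W z ∂μ) = ∞
  · have h4 : K * μ F ^ (1 + θ) < ∞ :=
      ENNReal.mul_lt_top hK.lt_top (ENNReal.rpow_lt_top_of_nonneg (by positivity) hF1)
    have : x ^ θ = 0 := by
      by_contra hx
      rw [h3, ENNReal.top_mul hx] at h
      exact absurd h4 (not_lt.mpr h)
    rw [this]; exact zero_le
  · have h4 : (∫⁻ z in F, W z ∂μ) * x ^ θ ≤ (∫⁻ z in F, W z ∂μ) * (K * (∫⁻ z in F, σ z ∂μ) ^ θ) := by
      refine h.trans ((mul_le_mul_right h1 K).trans_eq ?_)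
      ring
    exact (ENNReal.mul_le_mul_iff_right h2 h3).mp h4

/-- The fractional average over a cell. -/
def fav {X I : Type*} [MeasurableSpace X] (idx : ℤ → X → I) (μ : Measure X) (vol : ℤ → ℝ≥0∞)
    (β : ℝ) (f : X → ℝ≥0∞) (B : ℤ × I) : ℝ≥0∞ :=
  vol B.1 ^ (β - 1) * ∫⁻ z in tcube idx B, f z ∂μ

/-- constant of the dyadic theorem -/
def dyC (r q θ : ℝ) (Λ K : ℝ≥0∞) : ℝ≥0∞ :=
  Λ ^ q * (K * ((1 + (K * 2 ^ (1 + θ)) ^ (1 / θ)) *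
    ENNReal.ofReal (2 * (r / (r - 1)) * 2 ^ (r - 1))) ^ (q / r))

lemma term_bound (r q β θ : ℝ) (hr : 1 < r) (hrq : r ≤ q) (hβ : β = 1 / r - 1 / q)
    (hθ : θ = q / (r / (r - 1))) (v w s m K : ℝ≥0∞) (hv0 : v ≠ 0) (hv : v ≠ ∞) (hs0 : s ≠ 0)
    (hs : s ≠ ∞) (h : w * s ^ θ ≤ K * v ^ (1 + θ)) :
    (v ^ (β - 1) * m) ^ q * w ≤ K * (s ^ (1 - r) * m ^ r) ^ (q / r) := by
  have hr0 : 0 < r := by linarith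
  have hr1 : 0 < r - 1 := by linarith
  have hq0 : 0 < q := by linarith
  have hst0 : s ^ θ ≠ 0 := by simp [ENNReal.rpow_eq_zero_iff, hs0, hs]
  have hst : s ^ θ ≠ ∞ := by simp [ENNReal.rpow_eq_top_iff, hs0, hs]
  have e1 : (β - 1) * q + (1 + θ) = 0 := by
    rw [hβ, hθ]; field_simp; ring
  have e2 : (s ^ (1 - r) * m ^ r) ^ (q / r) = s ^ (-θ) * m ^ q := by
    rw [ENNReal.mul_rpow_of_nonneg _ _ (by positivity), ← ENNReal.rpow_mul, ← ENNReal.rpow_mul]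
    congr 2
    · rw [hθ]; field_simp; ring
    · field_simp
  have hw : w ≤ K * v ^ (1 + θ) * s ^ (-θ) := by
    rw [ENNReal.rpow_neg, ← div_eq_mul_inv]
    exact (ENNReal.le_div_iff_mul_le (Or.inl hst0) (Or.inl hst)).mpr h
  rw [e2, ENNReal.mul_rpow_of_nonneg _ _ hq0.le, ← ENNReal.rpow_mul]
  calc v ^ ((β - 1) * q) * m ^ q * w ≤ v ^ ((β - 1) * q) * m ^ q * (K * v ^ (1 + θ) * s ^ (-θ)) := by
        gcongr
    _ = (v ^ ((β - 1) * q) * v ^ (1 + θ)) * (K * (s ^ (-θ) * m ^ q)) := by ring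
    _ = _ := by rw [← ENNReal.rpow_add _ _ hv0 hv, e1]; simp

theorem dyadic_class {X I : Type*} [MeasurableSpace X] [Countable I] {idx : ℤ → X → I}
    (hnest : ∀ k z z', idx k z = idx k z' → idx (k + 1) z = idx (k + 1) z')
    (hmeas : ∀ B : ℤ × I, MeasurableSet (tcube idx B))
    (μ : Measure X) [SFinite μ] (W σ f h : X → ℝ≥0∞) (r q β θ : ℝ) (hr : 1 < r) (hrq : r ≤ q)
    (hβ : β = 1 / r - 1 / q) (hθ : θ = q / (r / (r - 1)))
    (hW : Measurable W) (hσ : Measurable σ) (hws : WS W σ θ) (hf : Measurable f)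
    (hh : Measurable h) (hhtop : ∀ z, h z ≠ ∞)
    (hfs : ∀ z, ∀ t : ℝ≥0∞, 0 < t → h z ≤ t → f z ≤ t * σ z)
    (hσ0 : ∀ z, σ z ≠ 0)
    (vol : ℤ → ℝ≥0∞) (hvol : ∀ B : ℤ × I, μ (tcube idx B) = vol B.1)
    (hvol0 : ∀ k, vol k ≠ 0) (hvol1 : ∀ k, vol k ≠ ∞) (hvm : Monotone vol)
    (Cb C4 K : ℝ≥0∞) (hvb : ∀ k, vol (k + 1) ≤ Cb * vol k)
    (hCb0 : Cb ≠ 0) (hCb : Cb ≠ ∞) (hC40 : C4 ≠ 0) (hC4 : C4 ≠ ∞) (hK0 : K ≠ 0) (hK : K ≠ ∞)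
    (A : ℤ × I → ℤ × I) (hA1 : ∀ B, (A B).1 = B.1) (hAinj : Function.Injective A)
    (sh1 sh2 : ℤ × I → Set X) (hsh2 : ∀ B, MeasurableSet (sh2 B))
    (hsh : ∀ B, (∫⁻ z in sh2 B, W z ∂μ) * (∫⁻ z in tcube idx B, σ z ∂μ) ^ θ ≤ K * vol B.1 ^ (1 + θ))
    (hAsh : ∀ B, tcube idx (A B) ⊆ sh2 B) (hsh12 : ∀ B, sh1 B ⊆ sh2 B)
    (hfB : ∀ B, ∫⁻ z in tcube idx B, f z ∂μ ≠ ∞)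
    (S : Set (ℤ × I)) (j : ℤ) (hSj : ∀ B ∈ S, B.1 ≤ j)
    (hgood : ∀ B ∈ S, ∀ y ∈ tcube idx (A B), ∀ z ∈ tcube idx B, idx (B.1 + 1) y = idx (B.1 + 1) z)
    (hS4 : ∀ B ∈ S, ∫⁻ z in tcube idx (A B), f z ∂μ ≤ C4 * ∫⁻ z in tcube idx B, f z ∂μ)
    (hS0 : ∀ B ∈ S, ∫⁻ z in tcube idx B, f z ∂μ ≠ 0)
    (hS2 : ∀ B ∈ S, ∀ B' ∈ S, B'.1 < B.1 → (tcube idx (A B) ∩ tcube idx (A B')).Nonempty →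
      sh1 B' ⊆ sh2 B)
    (lam : ℤ × I → ℤ)
    (hl1 : ∀ B ∈ S, ∀ B' ∈ S, lam B ≤ lam B' →
      fav idx μ vol β f B ≤ (2 * Cb * C4) * fav idx μ vol β f B')
    (hl2 : ∀ B ∈ S, ∀ B' ∈ S, lam B < lam B' →
      (2 * Cb * C4) * fav idx μ vol β f B ≤ fav idx μ vol β f B') :
    ∃ R : X → ℝ≥0∞, Measurable R ∧ (∀ B ∈ S, ∀ z ∈ sh1 B, fav idx μ vol β f B ^ q ≤ R z) ∧
      ∫⁻ z, R z * W z ∂μ ≤ dyC r q θ (2 * Cb * C4) K * (∫⁻ z, h z ^ (r - 1) * f z ∂μ) ^ (q / r) := by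
  classical
  have hr0 : 0 < r := by linarith
  have hr1 : 0 < r - 1 := by linarith
  have hq0 : 0 < q := by linarith
  have hθ0 : 0 < θ := by rw [hθ]; positivity
  set Λ : ℝ≥0∞ := 2 * Cb * C4 with hΛ
  have hΛtop : Λ ≠ ∞ := ENNReal.mul_ne_top (ENNReal.mul_ne_top (by norm_num) hCb) hC4
  have hΛ0 : Λ ≠ 0 := mul_ne_zero (mul_ne_zero (by norm_num) hCb0) hC40
  set m : ℤ × I → ℝ≥0∞ := fun B => ∫⁻ z in tcube idx B, f z ∂μ with hm
  set s : ℤ × I → ℝ≥0∞ := fun B => ∫⁻ z in tcube idx B, σ z ∂μ with hs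
  have hs0 : ∀ B, s B ≠ 0 := by
    intro B h0
    have h0' := (lintegral_eq_zero_iff hσ).mp h0
    have : ∀ᵐ z ∂(μ.restrict (tcube idx B)), False := by
      filter_upwards [h0'] with z hz using hσ0 z hz
    have h2 := MeasureTheory.ae_iff.mp this
    simp only [not_false_eq_true, Set.ofPred_true, Measure.restrict_apply_univ] at h2
    exact hvol0 B.1 (by rw [← hvol B, h2])
  -- nesting of cells
  have hsubA : ∀ B B' : ℤ × I, B'.1 ≤ B.1 → (tcube idx B ∩ tcube idx B').Nonempty →
      tcube idx B' ⊆ tcube idx B := by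
    rintro B B' hle ⟨y, hy, hy'⟩ z hz
    have e1 : idx B.1 y = B.2 := hy
    have e2 : idx B'.1 y = B'.2 := hy'
    have e3 : idx B'.1 z = B'.2 := hz
    show idx B.1 z = B.2
    rw [← e1]
    exact tower_nest hnest hle (e3.trans e2.symm)
  have hne : ∀ B : ℤ × I, (tcube idx B).Nonempty := by
    intro B
    rw [Set.nonempty_iff_ne_empty]
    intro h0
    apply hvol0 B.1
    rw [← hvol B, h0, measure_empty]
  set T : Set (ℤ × I) := {B | B ∈ S ∧ ∀ B' ∈ S, B.1 < B'.1 →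
    (tcube idx (A B') ∩ tcube idx (A B)).Nonempty → lam B' < lam B} with hT
  -- covering
  have hcov : ∀ B ∈ S, ∀ z ∈ sh1 B, ∃ B' ∈ T, z ∈ sh2 B' ∧
      fav idx μ vol β f B ≤ Λ * fav idx μ vol β f B' := by
    intro B hB z hz
    by_cases hBT : B ∈ T
    · exact ⟨B, hBT, hsh12 B hz, hl1 B hB B hB le_rfl⟩
    have hex : ∃ B' ∈ S, B.1 < B'.1 ∧ (tcube idx (A B') ∩ tcube idx (A B)).Nonempty ∧
        lam B ≤ lam B' := by
      by_contra hcon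
      push Not at hcon
      exact hBT ⟨hB, fun B' h1 h2 h3 => hcon B' h1 h2 h3⟩
    obtain ⟨k, ⟨B', hB', hk, hlt, hmeet, hlam⟩, hmax⟩ := Int.exists_greatest_of_bdd
      (P := fun k => ∃ B' ∈ S, B'.1 = k ∧ B.1 < B'.1 ∧
        (tcube idx (A B') ∩ tcube idx (A B)).Nonempty ∧ lam B ≤ lam B')
      ⟨j, fun k hk => by obtain ⟨B', h1, h2, -⟩ := hk; rw [← h2]; exact hSj _ h1⟩
      (by obtain ⟨B', h1, h2, h3, h4⟩ := hex; exact ⟨B'.1, B', h1, rfl, h2, h3, h4⟩)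
    refine ⟨B', ⟨hB', ?_⟩, hS2 B' hB' B hB hlt hmeet hz, hl1 B hB B' hB' hlam⟩
    intro B'' hB'' hlt2 hmeet2
    by_contra hcon
    push Not at hcon
    have hs1 : tcube idx (A B) ⊆ tcube idx (A B') :=
      hsubA _ _ (by rw [hA1, hA1]; exact hlt.le) hmeet
    have hs2 : tcube idx (A B') ⊆ tcube idx (A B'') :=
      hsubA _ _ (by rw [hA1, hA1]; exact hlt2.le) hmeet2
    obtain ⟨y, hy⟩ := hne (A B)
    have := hmax B''.1 ⟨B'', hB'', rfl, hlt.trans hlt2, ⟨y, hs2 (hs1 hy), hy⟩, hlam.trans hcon⟩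
    omega
  -- the sets F
  set F : ℤ × I → Set X := fun B => tcube idx (A B) \
    ⋃ B' ∈ {B' | B' ∈ T ∧ B'.1 < B.1}, tcube idx (A B') with hF
  have hFm : ∀ B, MeasurableSet (F B) := fun B =>
    (hmeas _).diff (MeasurableSet.biUnion (Set.to_countable _) fun B' _ => hmeas _)
  have hFsub : ∀ B, F B ⊆ tcube idx (A B) := fun B => sdiff_subset
  have hFd' : ∀ B ∈ T, ∀ B' ∈ T, B'.1 < B.1 → Disjoint (F B) (F B') := by
    intro B _ B' hB' hlt
    rw [Set.disjoint_left]
    intro z hz hz'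
    exact hz.2 (mem_biUnion (show B' ∈ {B' | B' ∈ T ∧ B'.1 < B.1} from ⟨hB', hlt⟩) (hFsub _ hz'))
  have hFd : ∀ B ∈ T, ∀ B' ∈ T, B ≠ B' → Disjoint (F B) (F B') := by
    intro B hB B' hB' hneq
    rcases lt_trichotomy B.1 B'.1 with h1 | h1 | h1
    · exact (hFd' B' hB' B hB h1).symm
    · rw [Set.disjoint_left]
      intro z hz hz'
      apply hneq
      apply hAinj
      have e1 : idx (A B).1 z = (A B).2 := hFsub _ hz
      have e2 : idx (A B').1 z = (A B').2 := hFsub _ hz'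
      have e0 : (A B).1 = (A B').1 := by rw [hA1, hA1, h1]
      ext1
      · exact e0
      · rw [← e1, ← e2, e0]
    · exact hFd' B hB B' hB' h1
  have hFvol : ∀ B ∈ T, vol B.1 ≤ 2 * μ (F B) := by
    intro B hB
    set G : Set (ℤ × I) := {P | ∃ B' ∈ T, B'.1 < B.1 ∧ ∃ y ∈ tcube idx (A B) ∩ tcube idx (A B'),
      P = (B'.1 + 1, idx (B'.1 + 1) y)} with hG
    set U : Set X := ⋃ P ∈ G, tcube idx P with hU
    have hGj : ∀ P ∈ G, P.1 ≤ B.1 := by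
      rintro P ⟨B', hB', hlt, y, hy, rfl⟩
      simp only; omega
    have hGA : ∀ P ∈ G, tcube idx P ⊆ tcube idx (A B) := by
      intro P hP
      refine hsubA _ _ (by rw [hA1]; exact hGj P hP) ?_
      obtain ⟨B', hB', hlt, y, hy, rfl⟩ := hP
      exact ⟨y, hy.1, rfl⟩
    have hAF : tcube idx (A B) ⊆ F B ∪ U := by
      intro z hz
      by_cases hzF : z ∈ F B
      · exact Or.inl hzF
      · right
        have : z ∈ ⋃ B' ∈ {B' | B' ∈ T ∧ B'.1 < B.1}, tcube idx (A B') := by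
          by_contra hcon
          exact hzF ⟨hz, hcon⟩
        simp only [mem_iUnion] at this
        obtain ⟨B', ⟨hB', hlt⟩, hz'⟩ := this
        exact mem_biUnion (show (B'.1 + 1, idx (B'.1 + 1) z) ∈ G from
          ⟨B', hB', hlt, z, ⟨hz, hz'⟩, rfl⟩) rfl
    have hUA : U ⊆ tcube idx (A B) := iUnion₂_subset hGA
    have hmB0 : m B ≠ 0 := hS0 B hB.1
    have hmB1 : m B ≠ ∞ := hfB B
    -- Vitali
    have hv := tower_vitali hnest hmeas hGj ((Λ * m B) • μ) ((Cb * vol B.1) • (μ.withDensity f)) (by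
      rintro P ⟨B', hB', hlt, y, hy, rfl⟩
      simp only [Measure.smul_apply, smul_eq_mul]
      rw [hvol, withDensity_apply _ (hmeas _)]
      simp only
      have hlam : lam B < lam B' := hB'.2 B hB.1 hlt ⟨y, hy⟩
      have h2 := hl2 B hB.1 B' hB'.1 hlam
      simp only [fav] at h2
      have hsubP : tcube idx B' ⊆ tcube idx (B'.1 + 1, idx (B'.1 + 1) y) := by
        intro z hz
        exact (hgood B' hB'.1 y hy.2 z hz).symm
      have h3 : vol B'.1 * (Λ * m B) ≤ vol B.1 * m B' := by
        have hv0 := hvol0 B.1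
        have hv1 := hvol1 B.1
        have hv0' := hvol0 B'.1
        have hv1' := hvol1 B'.1
        have hβ1 : β - 1 ≤ 0 := by
          rw [hβ]
          have : 1 / r ≤ 1 := by rw [div_le_one hr0]; linarith
          have : 0 < 1 / q := by positivity
          linarith
        have hβ0 : 0 ≤ β := by
          rw [hβ]
          have : 1 / q ≤ 1 / r := one_div_le_one_div_of_le hr0 hrq
          linarith
        calc vol B'.1 * (Λ * m B)
            = (vol B'.1 * vol B.1 ^ (1 - β)) * (Λ * (vol B.1 ^ (β - 1) * m B)) := by
              have : vol B.1 ^ (1 - β) * vol B.1 ^ (β - 1) = 1 := by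
                rw [← ENNReal.rpow_add _ _ hv0 hv1]; simp
              calc vol B'.1 * (Λ * m B) = (vol B.1 ^ (1 - β) * vol B.1 ^ (β - 1)) * (vol B'.1 * (Λ * m B)) := by
                    rw [this, one_mul]
                _ = _ := by ring
          _ ≤ (vol B'.1 * vol B.1 ^ (1 - β)) * (vol B'.1 ^ (β - 1) * m B') := by gcongr
          _ = (vol B'.1 ^ β * vol B.1 ^ (1 - β)) * m B' := by
              have : vol B'.1 * vol B'.1 ^ (β - 1) = vol B'.1 ^ β := by
                nth_rewrite 1 [← ENNReal.rpow_one (vol B'.1)]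
                rw [← ENNReal.rpow_add _ _ hv0' hv1']; congr 1; ring
              rw [← this]; ring
          _ ≤ (vol B.1 ^ β * vol B.1 ^ (1 - β)) * m B' := by
              gcongr
              exact hvm hlt.le
          _ = vol B.1 * m B' := by
              rw [← ENNReal.rpow_add _ _ hv0 hv1]
              congr 1
              rw [show β + (1 - β) = 1 by ring, ENNReal.rpow_one]
      calc Λ * m B * vol (B'.1 + 1) ≤ Λ * m B * (Cb * vol B'.1) := by gcongr; exact hvb _
        _ = Cb * (vol B'.1 * (Λ * m B)) := by ring
        _ ≤ Cb * (vol B.1 * m B') := by gcongr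
        _ = Cb * vol B.1 * m B' := by ring
        _ ≤ _ := by gcongr; exact lintegral_mono_set hsubP)
    simp only [Measure.smul_apply, smul_eq_mul] at hv
    have hUm : MeasurableSet U := MeasurableSet.biUnion (Set.to_countable _) fun P _ => hmeas _
    have h5 : Λ * m B * μ U ≤ (Cb * vol B.1) * (C4 * m B) := by
      refine hv.trans ?_
      gcongr
      rw [withDensity_apply _ hUm]
      exact (lintegral_mono_set hUA).trans (hS4 B hB.1)
    have h6 : 2 * μ U ≤ vol B.1 := by
      have : (Cb * C4 * m B) * (2 * μ U) ≤ (Cb * C4 * m B) * vol B.1 := by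
        calc _ = Λ * m B * μ U := by rw [hΛ]; ring
          _ ≤ _ := h5
          _ = _ := by ring
      exact (ENNReal.mul_le_mul_iff_right (mul_ne_zero (mul_ne_zero hCb0 hC40) hmB0)
        (ENNReal.mul_ne_top (ENNReal.mul_ne_top hCb hC4) hmB1)).mp this
    have h7 : vol B.1 ≤ μ (F B) + μ U := by
      rw [← hA1 B, ← hvol (A B)]
      exact (measure_mono hAF).trans (measure_union_le _ _)
    have h8 : vol B.1 + vol B.1 ≤ vol B.1 + 2 * μ (F B) := by
      calc vol B.1 + vol B.1 ≤ (μ (F B) + μ U) + (μ (F B) + μ U) := add_le_add h7 h7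
        _ = 2 * μ U + 2 * μ (F B) := by ring
        _ ≤ _ := by gcongr
    exact (ENNReal.add_le_add_iff_left (hvol1 _)).mp h8
  set C : ℝ≥0∞ := (K * 2 ^ (1 + θ)) ^ (1 / θ) with hC
  have hFσ : ∀ B ∈ T, s B ≤ C * ∫⁻ z in F B, σ z ∂μ := by
    intro B hB
    have h1 := hFvol B hB
    have hF0 : μ (F B) ≠ 0 := by
      intro h0
      rw [h0, mul_zero] at h1
      exact hvol0 _ (le_antisymm h1 zero_le)
    have hF1 : μ (F B) ≠ ∞ := by
      refine ((measure_mono (hFsub B)).trans_lt ?_).ne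
      rw [hvol]; exact (hvol1 _).lt_top
    have h2p : (2:ℝ≥0∞) ^ (1 + θ) ≠ 0 := by simp [ENNReal.rpow_eq_zero_iff]
    have h2p' : (2:ℝ≥0∞) ^ (1 + θ) ≠ ∞ := by simp [ENNReal.rpow_eq_top_iff]
    have h3 := hol μ hθ0 hW hσ hws (F B) hF0 hF1 (K * 2 ^ (1 + θ)) (mul_ne_zero hK0 h2p)
      (ENNReal.mul_ne_top hK h2p') (s B) (by
        calc (∫⁻ z in F B, W z ∂μ) * s B ^ θ ≤ (∫⁻ z in sh2 B, W z ∂μ) * s B ^ θ := by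
              gcongr
              exact (hFsub B).trans (hAsh B)
          _ ≤ K * vol B.1 ^ (1 + θ) := hsh B
          _ ≤ K * (2 * μ (F B)) ^ (1 + θ) := by gcongr
          _ = _ := by rw [ENNReal.mul_rpow_of_nonneg _ _ (by positivity)]; ring)
    have h4 := ENNReal.rpow_le_rpow h3 (by positivity : 0 ≤ 1 / θ)
    rw [ENNReal.mul_rpow_of_nonneg _ _ (by positivity), ← ENNReal.rpow_mul, ← ENNReal.rpow_mul,
      mul_one_div_cancel hθ0.ne', ENNReal.rpow_one, ENNReal.rpow_one] at h4
    exact h4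
  set T' : Set (ℤ × I) := {B | B ∈ T ∧ s B ≠ ∞} with hT'
  have hcar := carleson hnest hmeas μ f σ h hf hσ hh hhtop hfs r hr T' j (fun B hB => hSj B hB.1.1)
    (fun B _ => hs0 B) (fun B hB => hB.2) (fun B _ => hfB B) F (fun B _ => hFm B)
    (fun B hB B' hB' => hFd B hB.1 B' hB'.1)
    (fun B hB y hy z hz => hgood B hB.1.1 y (hFsub B hy) z hz) C (fun B hB => hFσ B hB.1)
  set a : ℤ × I → ℝ≥0∞ := fun B => fav idx μ vol β f B with ha
  refine ⟨fun z => ∑' B : T, (sh2 (B : ℤ × I)).indicator (fun _ => (Λ * a B) ^ q) z, ?_, ?_, ?_⟩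
  · exact Measurable.tsum fun B => measurable_const.indicator (hsh2 _)
  · intro B hB z hz
    obtain ⟨B', hB', hz', hle⟩ := hcov B hB z hz
    calc fav idx μ vol β f B ^ q ≤ (Λ * a B') ^ q := by gcongr
      _ = (sh2 B').indicator (fun _ => (Λ * a B') ^ q) z := by rw [Set.indicator_of_mem hz']
      _ ≤ _ := ENNReal.le_tsum (f := fun B : T => (sh2 (B : ℤ × I)).indicator (fun _ => (Λ * a B) ^ q) z)
        ⟨B', hB'⟩
  · have e1 : ∫⁻ z, (∑' B : T, (sh2 (B : ℤ × I)).indicator (fun _ => (Λ * a B) ^ q) z) * W z ∂μ =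
        ∑' B : T, (Λ * a B) ^ q * ∫⁻ z in sh2 (B : ℤ × I), W z ∂μ := by
      simp_rw [← ENNReal.tsum_mul_right]
      rw [lintegral_tsum]
      · congr 1
        ext B
        rw [← lintegral_const_mul _ hW, ← lintegral_indicator (hsh2 _)]
        congr 1
        ext z
        by_cases hz : z ∈ sh2 (B : ℤ × I) <;> simp [hz]
      · intro B
        exact ((measurable_const.indicator (hsh2 _)).mul hW).aemeasurable
    rw [e1]
    have e2 : ∑' B : T, (Λ * a B) ^ q * ∫⁻ z in sh2 (B : ℤ × I), W z ∂μ ≤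
        ∑' B : T', Λ ^ q * (K * (s B ^ (1 - r) * m B ^ r) ^ (q / r)) := by
      rw [tsum_subtype T (fun B => (Λ * a B) ^ q * ∫⁻ z in sh2 B, W z ∂μ),
        tsum_subtype T' (fun B => Λ ^ q * (K * (s B ^ (1 - r) * m B ^ r) ^ (q / r)))]
      refine ENNReal.tsum_le_tsum fun B => ?_
      by_cases hB : B ∈ T
      · by_cases hsB : s B = ∞
        · have h1 := hsh B
          have : (∫⁻ z in sh2 B, W z ∂μ) = 0 := by
            by_contra hcon
            rw [show (∫⁻ z in tcube idx B, σ z ∂μ) = ∞ from hsB, ENNReal.top_rpow_of_pos hθ0,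
              ENNReal.mul_top hcon] at h1
            have : K * vol B.1 ^ (1 + θ) < ∞ := ENNReal.mul_lt_top hK.lt_top
              (ENNReal.rpow_lt_top_of_nonneg (by positivity) (hvol1 _))
            exact absurd this (not_lt.mpr h1)
          simp [Set.indicator, this]
        · have hB' : B ∈ T' := ⟨hB, hsB⟩
          rw [Set.indicator_of_mem hB, Set.indicator_of_mem hB', ENNReal.mul_rpow_of_nonneg _ _ hq0.le,
            mul_assoc]
          refine mul_le_mul_right ?_ _
          exact term_bound r q β θ hr hrq hβ hθ _ _ _ _ K (hvol0 B.1) (hvol1 B.1) (hs0 B) hsB (hsh B)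
      · rw [Set.indicator_of_notMem hB]
        exact zero_le
    refine e2.trans ?_
    rw [ENNReal.tsum_mul_left, ENNReal.tsum_mul_left]
    have hqr : 1 ≤ q / r := by rw [le_div_iff₀ hr0]; linarith
    have e3 := (tsum_rpow_le (fun B : T' => s B ^ (1 - r) * m B ^ r) (q / r) hqr).trans
      (ENNReal.rpow_le_rpow hcar (by positivity))
    calc _ ≤ Λ ^ q * (K * ((1 + C) * ENNReal.ofReal (2 * (r / (r - 1)) * 2 ^ (r - 1)) *
        ∫⁻ z, h z ^ (r - 1) * f z ∂μ) ^ (q / r)) := by gcongr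
      _ = _ := by
        rw [ENNReal.mul_rpow_of_nonneg ((1 + C) * _) _ (by positivity), dyC, ← hC]
        ring

theorem dyadic_full {X I : Type*} [MeasurableSpace X] [Countable I] {idx : ℤ → X → I}
    (hnest : ∀ k z z', idx k z = idx k z' → idx (k + 1) z = idx (k + 1) z')
    (hmeas : ∀ B : ℤ × I, MeasurableSet (tcube idx B))
    (μ : Measure X) [SFinite μ] (W σ f h : X → ℝ≥0∞) (r q β θ : ℝ) (hr : 1 < r) (hrq : r ≤ q)
    (hβ : β = 1 / r - 1 / q) (hθ : θ = q / (r / (r - 1)))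
    (hW : Measurable W) (hσ : Measurable σ) (hws : WS W σ θ) (hf : Measurable f)
    (hh : Measurable h) (hhtop : ∀ z, h z ≠ ∞)
    (hfs : ∀ z, ∀ t : ℝ≥0∞, 0 < t → h z ≤ t → f z ≤ t * σ z)
    (hσ0 : ∀ z, σ z ≠ 0)
    (vol : ℤ → ℝ≥0∞) (hvol : ∀ B : ℤ × I, μ (tcube idx B) = vol B.1)
    (hvol0 : ∀ k, vol k ≠ 0) (hvol1 : ∀ k, vol k ≠ ∞) (hvm : Monotone vol)
    (Cb C4 K : ℝ≥0∞) (hvb : ∀ k, vol (k + 1) ≤ Cb * vol k)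
    (hCb0 : 1 ≤ Cb) (hCb : Cb ≠ ∞) (hC40 : 1 ≤ C4) (hC4 : C4 ≠ ∞) (hK0 : K ≠ 0) (hK : K ≠ ∞)
    (A : ℤ × I → ℤ × I) (hA1 : ∀ B, (A B).1 = B.1) (hAinj : Function.Injective A)
    (sh1 sh2 : ℤ × I → Set X) (hsh2 : ∀ B, MeasurableSet (sh2 B))
    (hsh : ∀ B, (∫⁻ z in sh2 B, W z ∂μ) * (∫⁻ z in tcube idx B, σ z ∂μ) ^ θ ≤ K * vol B.1 ^ (1 + θ))
    (hAsh : ∀ B, tcube idx (A B) ⊆ sh2 B) (hsh12 : ∀ B, sh1 B ⊆ sh2 B)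
    (hfB : ∀ B, ∫⁻ z in tcube idx B, f z ∂μ ≠ ∞)
    (S : Set (ℤ × I)) (j : ℤ) (hSj : ∀ B ∈ S, B.1 ≤ j)
    (hgood : ∀ B ∈ S, ∀ y ∈ tcube idx (A B), ∀ z ∈ tcube idx B, idx (B.1 + 1) y = idx (B.1 + 1) z)
    (hS4 : ∀ B ∈ S, ∫⁻ z in tcube idx (A B), f z ∂μ ≤ C4 * ∫⁻ z in tcube idx B, f z ∂μ)
    (hS0 : ∀ B ∈ S, ∫⁻ z in tcube idx B, f z ∂μ ≠ 0)
    (hS2 : ∀ B ∈ S, ∀ B' ∈ S, B'.1 < B.1 → (tcube idx (A B) ∩ tcube idx (A B')).Nonempty →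
      sh1 B' ⊆ sh2 B) :
    ∃ R : X → ℝ≥0∞, Measurable R ∧ (∀ B ∈ S, ∀ z ∈ sh1 B, fav idx μ vol β f B ^ q ≤ R z) ∧
      ∫⁻ z, R z * W z ∂μ ≤ 2 * dyC r q θ (2 * Cb * C4) K *
        (∫⁻ z, h z ^ (r - 1) * f z ∂μ) ^ (q / r) := by
  classical
  set Λ : ℝ≥0∞ := 2 * Cb * C4 with hΛ
  have hΛtop : Λ ≠ ∞ := ENNReal.mul_ne_top (ENNReal.mul_ne_top (by norm_num) hCb) hC4
  have hΛ1 : 1 < Λ := by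
    calc (1:ℝ≥0∞) < 2 * 1 * 1 := by norm_num
      _ ≤ _ := by rw [hΛ]; gcongr
  have hΛ0 : Λ ≠ 0 := (zero_lt_one.trans hΛ1).ne'
  have ha : ∀ B ∈ S, ∃ l : ℤ, fav idx μ vol β f B ∈ Ico (Λ ^ l) (Λ ^ (l + 1)) := by
    intro B hB
    apply ENNReal.exists_mem_Ico_zpow _ _ hΛ1 hΛtop
    · refine mul_ne_zero ?_ (hS0 B hB)
      simp [ENNReal.rpow_eq_zero_iff, hvol0, hvol1]
    · refine ENNReal.mul_ne_top ?_ (hfB B)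
      simp [ENNReal.rpow_eq_top_iff, hvol0, hvol1]
  choose! lam hlam using ha
  have hone : ∀ S' ⊆ S, (∀ B ∈ S', ∀ B' ∈ S', lam B < lam B' → lam B + 2 ≤ lam B') →
    ∃ R : X → ℝ≥0∞, Measurable R ∧ (∀ B ∈ S', ∀ z ∈ sh1 B, fav idx μ vol β f B ^ q ≤ R z) ∧
      ∫⁻ z, R z * W z ∂μ ≤ dyC r q θ (2 * Cb * C4) K * (∫⁻ z, h z ^ (r - 1) * f z ∂μ) ^ (q / r) := by
    intro S' hS' hgap
    refine dyadic_class hnest hmeas μ W σ f h r q β θ hr hrq hβ hθ hW hσ hws hf hh hhtop hfs hσ0 vol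
      hvol hvol0 hvol1 hvm Cb C4 K hvb (zero_lt_one.trans_le hCb0).ne' hCb
      (zero_lt_one.trans_le hC40).ne' hC4 hK0 hK A hA1 hAinj sh1 sh2 hsh2 hsh hAsh hsh12 hfB
      S' j (fun B hB => hSj B (hS' hB)) (fun B hB => hgood B (hS' hB)) (fun B hB => hS4 B (hS' hB))
      (fun B hB => hS0 B (hS' hB)) (fun B hB B' hB' => hS2 B (hS' hB) B' (hS' hB')) lam ?_ ?_
    · intro B hB B' hB' hle
      have h1 := (hlam B (hS' hB)).2.le
      have h2 := (hlam B' (hS' hB')).1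
      calc fav idx μ vol β f B ≤ Λ ^ (lam B + 1) := h1
        _ ≤ Λ ^ (lam B' + 1) := ENNReal.zpow_le_of_le hΛ1.le (by omega)
        _ = Λ * Λ ^ lam B' := by rw [ENNReal.zpow_add hΛ0 hΛtop, zpow_one, mul_comm]
        _ ≤ _ := by gcongr
    · intro B hB B' hB' hlt
      have h1 := (hlam B (hS' hB)).2.le
      have h2 := (hlam B' (hS' hB')).1
      have h3 := hgap B hB B' hB' hlt
      calc Λ * fav idx μ vol β f B ≤ Λ * Λ ^ (lam B + 1) := by gcongr
        _ = Λ ^ (lam B + 2) := by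
          rw [show lam B + 2 = (lam B + 1) + 1 by ring, ENNReal.zpow_add hΛ0 hΛtop (lam B + 1) 1,
            zpow_one, mul_comm]
        _ ≤ Λ ^ lam B' := ENNReal.zpow_le_of_le hΛ1.le h3
        _ ≤ _ := h2
  obtain ⟨R1, hR1, hR1', hR1''⟩ := hone {B | B ∈ S ∧ lam B % 2 = 0} (fun B hB => hB.1) (by
    rintro B ⟨-, h1⟩ B' ⟨-, h2⟩ h3; omega)
  obtain ⟨R2, hR2, hR2', hR2''⟩ := hone {B | B ∈ S ∧ lam B % 2 = 1} (fun B hB => hB.1) (by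
    rintro B ⟨-, h1⟩ B' ⟨-, h2⟩ h3; omega)
  refine ⟨fun z => R1 z + R2 z, hR1.add hR2, ?_, ?_⟩
  · intro B hB z hz
    rcases Int.emod_two_eq_zero_or_one (lam B) with h | h
    · exact (hR1' B ⟨hB, h⟩ z hz).trans le_self_add
    · exact (hR2' B ⟨hB, h⟩ z hz).trans le_add_self
  · simp_rw [add_mul]
    rw [lintegral_add_left (by fun_prop)]
    refine (add_le_add hR1'' hR2'').trans_eq ?_
    ring

/-- closed box -/
def pbox (n : ℕ) (x : Fin n → ℝ) (t d d' : ℝ) : Set ((Fin n → ℝ) × ℝ) :=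
  {z | ‖z.1 - x‖ ≤ d ∧ |z.2 - t| ≤ d'}

lemma pbox_eq (n : ℕ) (x : Fin n → ℝ) (t d d' : ℝ) :
    pbox n x t d d' = Metric.closedBall x d ×ˢ Metric.closedBall t d' := by
  ext z
  simp [pbox, dist_eq_norm]

lemma pbox_meas (n : ℕ) (x : Fin n → ℝ) (t d d' : ℝ) : MeasurableSet (pbox n x t d d') := by
  rw [pbox_eq]
  exact measurableSet_closedBall.prod measurableSet_closedBall

lemma pbox_vol (n : ℕ) (x : Fin n → ℝ) (t d d' : ℝ) (hd : 0 ≤ d) :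
    volume (pbox n x t d d') = ENNReal.ofReal ((2 * d) ^ n * (2 * d')) := by
  rw [pbox_eq, Measure.volume_eq_prod, Measure.prod_prod, Real.volume_pi_closedBall _ hd,
    Real.volume_closedBall, Fintype.card_fin,
    ← ENNReal.ofReal_mul (by positivity)]

/-- Condition H -/
def CondH (n : ℕ) (p θ : ℝ) (W σ : (Fin n → ℝ) × ℝ → ℝ≥0∞) : Prop :=
  ∃ ε : ℝ, 0 < ε ∧ ∀ η : ℝ, 0 < η → ∃ K : ℝ≥0∞, K ≠ 0 ∧ K ≠ ∞ ∧
    ∀ (x x' : Fin n → ℝ) (t l d d' : ℝ), 0 < l → d + ‖x' - x‖ ≤ ε * l → d' ≤ ε * l ^ p →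
      η * l ≤ d → η * l ^ p ≤ d' →
      (∫⁻ z in pbox n x t d d', W z) * (∫⁻ z in pbox n x' (t + l ^ p) d d', σ z) ^ θ ≤
        K * ENNReal.ofReal ((2 * d) ^ n * (2 * d')) ^ (1 + θ)

lemma chainH {n : ℕ} {p θ : ℝ} {W σ : (Fin n → ℝ) × ℝ → ℝ≥0∞} (hp : 1 < p) (hθ : 0 < θ)
    (hW : Measurable W) (hσ : Measurable σ) (hws : WS W σ θ) (H : CondH n p θ W σ)
    (C : ℝ) :
    ∃ ε : ℝ, 0 < ε ∧ ∀ η : ℝ, 0 < η → ∃ K : ℝ≥0∞, K ≠ 0 ∧ K ≠ ∞ ∧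
    ∀ (x x' : Fin n → ℝ) (t l d d' : ℝ), 0 < l → ‖x' - x‖ ≤ C * l → d ≤ ε * l → d' ≤ ε * l ^ p →
      η * l ≤ d → η * l ^ p ≤ d' →
      (∫⁻ z in pbox n x t d d', W z) * (∫⁻ z in pbox n x' (t + l ^ p) d d', σ z) ^ θ ≤
        K * ENNReal.ofReal ((2 * d) ^ n * (2 * d')) ^ (1 + θ) := by
  obtain ⟨ε, hε, H⟩ := H
  -- choice of M
  have htend : Filter.Tendsto (fun M : ℕ => (ε / 2) * (M : ℝ) ^ (1 - 1 / p)) Filter.atTop Filter.atTop := by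
    apply Filter.Tendsto.const_mul_atTop (by positivity)
    have h1 : 0 < 1 - 1 / p := by
      have : 1 / p < 1 := by rw [div_lt_one (by linarith)]; exact hp
      linarith
    exact (_root_.tendsto_rpow_atTop h1).comp tendsto_natCast_atTop_atTop
  obtain ⟨M, hM1, hMC⟩ := ((Filter.eventually_ge_atTop 1).and
    (htend.eventually_ge_atTop C)).exists
  have hp0 : 0 < p := by linarith
  have hM0 : (0:ℝ) < M := by exact_mod_cast hM1
  have hM1' : (1:ℝ) ≤ M := by exact_mod_cast hM1
  set m : ℝ := (M : ℝ) ^ (1 / p) with hm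
  have hm1 : 1 ≤ m := Real.one_le_rpow hM1' (by positivity)
  have hm0 : 0 < m := by linarith
  have hmp : m ^ p = M := by
    rw [hm, ← Real.rpow_mul hM0.le, one_div_mul_cancel hp0.ne', Real.rpow_one]
  have hMC' : C * m ≤ ε / 2 * M := by
    have : (M:ℝ) ^ (1 - 1 / p) * m = M := by
      rw [hm, ← Real.rpow_add hM0]; simp
    calc C * m ≤ (ε / 2 * (M:ℝ) ^ (1 - 1 / p)) * m := by gcongr
      _ = ε / 2 * M := by rw [mul_assoc, this]
  refine ⟨min (ε / (2 * m)) (ε / M), by positivity, ?_⟩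
  intro η hη
  obtain ⟨K, hK0, hK, H⟩ := H η hη
  refine ⟨K ^ M, pow_ne_zero _ hK0, ENNReal.pow_ne_top hK, ?_⟩
  intro x x' t l d d' hl hx hd hd' hηd hηd'
  have hd0 : 0 < d := lt_of_lt_of_le (by positivity) hηd
  have hd0' : 0 < d' := lt_of_lt_of_le (by positivity) hηd'
  set V : ℝ≥0∞ := ENNReal.ofReal ((2 * d) ^ n * (2 * d')) with hV
  set X : ℕ → (Fin n → ℝ) := fun i => x + ((i : ℝ) / M) • (x' - x) with hX
  set T : ℕ → ℝ := fun i => t + i * (l / m) ^ p with hT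
  have hlm : (l / m) ^ p = l ^ p / M := by
    rw [Real.div_rpow hl.le hm0.le, hmp]
  have step : ∀ i : ℕ, (∫⁻ z in pbox n (X i) (T i) d d', W z) *
      (∫⁻ z in pbox n (X (i+1)) (T (i+1)) d d', σ z) ^ θ ≤ K * V ^ (1 + θ) := by
    intro i
    have e : T (i+1) = T i + (l / m) ^ p := by simp only [hT]; push_cast; ring
    rw [e]
    have ex : X (i+1) - X i = (1 / (M:ℝ)) • (x' - x) := by
      simp only [hX]
      rw [add_sub_add_left_eq_sub, ← sub_smul]
      congr 1
      push_cast
      field_simp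
      ring
    apply H
    · positivity
    · rw [ex, norm_smul, Real.norm_of_nonneg (by positivity)]
      have h1 : d ≤ ε / (2 * m) * l := hd.trans (by gcongr; exact min_le_left _ _)
      have h2 : 1 / (M:ℝ) * ‖x' - x‖ ≤ ε / (2 * m) * l := by
        calc 1 / (M:ℝ) * ‖x' - x‖ ≤ 1 / (M:ℝ) * (C * l) := by gcongr
          _ = (C * m) * (l / (M * m)) := by field_simp
          _ ≤ (ε / 2 * M) * (l / (M * m)) := by gcongr
          _ = _ := by field_simp
      calc _ ≤ ε / (2 * m) * l + ε / (2 * m) * l := add_le_add h1 h2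
        _ = _ := by field_simp; ring
    · rw [hlm]
      calc d' ≤ ε / M * l ^ p := hd'.trans (by gcongr; exact min_le_right _ _)
        _ = _ := by ring
    · refine le_trans ?_ hηd
      gcongr
      exact div_le_self hl.le hm1
    · rw [hlm]
      refine le_trans ?_ hηd'
      gcongr
      exact div_le_self (by positivity) hM1'
  have hvol : ∀ i, volume (pbox n (X i) (T i) d d') = V := fun i => pbox_vol n _ _ _ _ hd0.le
  have hV0 : V ≠ 0 := by
    rw [hV]; simp only [ne_eq, ENNReal.ofReal_eq_zero, not_le]; positivity
  have hV1 : V ≠ ∞ := ENNReal.ofReal_ne_top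
  have step2 : ∀ i : ℕ, (∫⁻ z in pbox n (X (i+1)) (T (i+1)) d d', σ z) ^ θ ≤
      K * (∫⁻ z in pbox n (X i) (T i) d d', σ z) ^ θ := by
    intro i
    apply hol volume hθ hW hσ hws _ _ _ K hK0 hK
    · rw [hvol]; exact step i
    · rw [hvol]; exact hV0
    · rw [hvol]; exact hV1
  have key : ∀ i : ℕ, (∫⁻ z in pbox n (X 0) (T 0) d d', W z) *
      (∫⁻ z in pbox n (X (i+1)) (T (i+1)) d d', σ z) ^ θ ≤ K ^ (i+1) * V ^ (1 + θ) := by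
    intro i
    induction i with
    | zero => simpa using step 0
    | succ i ih =>
      calc _ ≤ (∫⁻ z in pbox n (X 0) (T 0) d d', W z) *
          (K * (∫⁻ z in pbox n (X (i+1)) (T (i+1)) d d', σ z) ^ θ) := by gcongr; exact step2 (i+1)
        _ = K * ((∫⁻ z in pbox n (X 0) (T 0) d d', W z) *
          (∫⁻ z in pbox n (X (i+1)) (T (i+1)) d d', σ z) ^ θ) := by ring
        _ ≤ K * (K ^ (i+1) * V ^ (1 + θ)) := by gcongr
        _ = _ := by ring
  have hfin := key (M - 1)
  rw [Nat.sub_add_cancel hM1] at hfin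
  have e1 : X 0 = x := by simp [hX]
  have e2 : X M = x' := by simp [hX, hM0.ne']
  have e3 : T 0 = t := by simp [hT]
  have e4 : T M = t + l ^ p := by simp only [hT]; rw [hlm]; field_simp
  rwa [e1, e2, e3, e4] at hfin

/-- Extended two-set condition. -/
def CondH2 (n : ℕ) (p θ : ℝ) (W σ : (Fin n → ℝ) × ℝ → ℝ≥0∞) : Prop :=
  ∀ G : ℝ, 1 ≤ G → ∃ K : ℝ≥0∞, K ≠ 0 ∧ K ≠ ∞ ∧ ∀ (L : ℝ), 0 < L → ∀ E B : Set ((Fin n → ℝ) × ℝ),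
    (∀ z ∈ E, ∀ w ∈ B, L ^ p / G ≤ w.2 - z.2 ∧ w.2 - z.2 ≤ G * L ^ p ∧ ‖w.1 - z.1‖ ≤ G * L) →
    (∫⁻ z in E, W z) * (∫⁻ z in B, σ z) ^ θ ≤ K * ENNReal.ofReal (L ^ n * L ^ p) ^ (1 + θ)

lemma cover_int {X ι : Type*} [MeasurableSpace X] (μ : Measure X) (U : Finset ι)
    (S : ι → Set X) (E : Set X) (hE : E ⊆ ⋃ u ∈ U, S u) (g : X → ℝ≥0∞) :
    ∫⁻ z in E, g z ∂μ ≤ ∑ u ∈ U, ∫⁻ z in E ∩ S u, g z ∂μ := by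
  have h : E ⊆ ⋃ u : U, E ∩ S (u : ι) := by
    intro z hz
    have := hE hz
    simp only [mem_iUnion] at this ⊢
    obtain ⟨u, hu, hz'⟩ := this
    exact ⟨⟨u, hu⟩, hz, hz'⟩
  refine (lintegral_mono_set h).trans ((lintegral_iUnion_le _ _).trans_eq ?_)
  rw [tsum_fintype]
  exact Finset.sum_coe_sort U (fun u => ∫⁻ z in E ∩ S u, g z ∂μ)

/-- integer box -/
def ibox (n : ℕ) (c : ℤ) : Finset ((Fin n → ℤ) × ℤ) :=
  Finset.Icc (fun _ => -c) (fun _ => c) ×ˢ Finset.Icc (-c) c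

lemma mem_ibox {n : ℕ} {c : ℤ} {u : (Fin n → ℤ) × ℤ} :
    u ∈ ibox n c ↔ (∀ i, -c ≤ u.1 i ∧ u.1 i ≤ c) ∧ -c ≤ u.2 ∧ u.2 ≤ c := by
  simp only [ibox, Finset.mem_product, Finset.mem_Icc, Pi.le_def]
  constructor
  · rintro ⟨⟨h1, h2⟩, h3⟩
    exact ⟨fun i => ⟨h1 i, h2 i⟩, h3⟩
  · rintro ⟨h1, h3⟩
    exact ⟨⟨fun i => (h1 i).1, fun i => (h1 i).2⟩, h3⟩

/-- covering of a bounded set by boxes around a base point -/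
lemma cover_pbox {n : ℕ} (z0 : (Fin n → ℝ) × ℝ) (a b : ℝ) (ha : 0 < a) (hb : 0 < b) (c : ℤ)
    (E : Set ((Fin n → ℝ) × ℝ)) (hE : ∀ z ∈ E, ‖z.1 - z0.1‖ < c * a ∧ |z.2 - z0.2| < c * b) :
    E ⊆ ⋃ u ∈ ibox n c,
      pbox n (z0.1 + fun i => (u.1 i : ℝ) * a) (z0.2 + u.2 * b) a b := by
  have key : ∀ y a : ℝ, 0 < a → |y| < c * a → (-c ≤ ⌊y / a⌋ ∧ ⌊y / a⌋ ≤ c) ∧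
      |y - ⌊y / a⌋ * a| ≤ a := by
    intro y a ha hy
    rw [abs_lt] at hy
    have h1 : (⌊y / a⌋ : ℝ) ≤ y / a := Int.floor_le _
    have h2 : y / a < ⌊y / a⌋ + 1 := Int.lt_floor_add_one _
    rw [le_div_iff₀ ha] at h1
    rw [div_lt_iff₀ ha] at h2
    refine ⟨⟨?_, ?_⟩, ?_⟩
    · rw [Int.le_floor, le_div_iff₀ ha]; push_cast; linarith
    · have : ⌊y / a⌋ < c + 1 := by
        rw [Int.floor_lt, div_lt_iff₀ ha]; push_cast; linarith
      omega
    · rw [abs_le]; constructor <;> linarith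
  intro z hz
  obtain ⟨h1, h2⟩ := hE z hz
  have hpos : 0 < (c:ℝ) * a := lt_of_le_of_lt (norm_nonneg _) h1
  have h1' : ∀ i, |z.1 i - z0.1 i| < c * a := by
    intro i
    exact lt_of_le_of_lt (norm_le_pi_norm (z.1 - z0.1) i) h1
  simp only [mem_iUnion]
  refine ⟨(fun i => ⌊(z.1 i - z0.1 i) / a⌋, ⌊(z.2 - z0.2) / b⌋), ?_, ?_, ?_⟩
  · rw [mem_ibox]
    exact ⟨fun i => (key _ a ha (h1' i)).1, (key _ b hb h2).1⟩
  · rw [pi_norm_le_iff_of_nonneg ha.le]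
    intro i
    have := (key _ a ha (h1' i)).2
    simp only [Pi.sub_apply, Pi.add_apply, Real.norm_eq_abs]
    rwa [← sub_sub]
  · have := (key _ b hb h2).2
    simp only
    rwa [← sub_sub]

set_option maxHeartbeats 1000000 in
lemma condH2 {n : ℕ} {p θ : ℝ} {W σ : (Fin n → ℝ) × ℝ → ℝ≥0∞} (hp : 1 < p) (hθ : 0 < θ)
    (hW : Measurable W) (hσ : Measurable σ) (hws : WS W σ θ) (H : CondH n p θ W σ) :
    CondH2 n p θ W σ := by
  intro G hG
  obtain ⟨ε, hε, H⟩ := chainH hp hθ hW hσ hws H (4 * G ^ 2)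
  have hp0 : 0 < p := by linarith
  set δ : ℝ := min (1 / (4 * G)) (ε / (2 * G)) with hδ
  have hδ0 : 0 < δ := by positivity
  have hδ1 : δ ≤ 1 / (4 * G) := min_le_left _ _
  have hδ2 : δ ≤ ε / (2 * G) := min_le_right _ _
  obtain ⟨K, hK0, hK, H⟩ := H (δ / (2 * G)) (by positivity)
  set c : ℤ := ⌈2 * G / δ⌉ + 1 with hc
  have hc' : 2 * G < c * δ := by
    have : 2 * G / δ ≤ ⌈2 * G / δ⌉ := Int.le_ceil _
    rw [div_le_iff₀ hδ0] at this
    rw [hc]; push_cast; nlinarith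
  have hc0 : 0 ≤ c := by
    have : (0:ℝ) < c := by
      by_contra h
      push Not at h
      nlinarith
    exact_mod_cast this.le
  set U := ibox n c with hU
  have hUne : U.Nonempty := ⟨0, by
    rw [hU, mem_ibox]
    simp [hc0]⟩
  set κ : ℝ≥0∞ := ENNReal.ofReal ((2 * δ) ^ n * (2 * δ)) with hκ
  set N : ℝ≥0∞ := (U.card : ℝ≥0∞) with hN
  have hN0 : N ≠ 0 := by
    rw [hN]; simp [hUne.ne_empty]
  have hN1 : N ≠ ∞ := ENNReal.natCast_ne_top _
  have hκ0 : κ ≠ 0 := by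
    rw [hκ]; simp only [ne_eq, ENNReal.ofReal_eq_zero, not_le]; positivity
  have hκ1 : κ ≠ ∞ := ENNReal.ofReal_ne_top
  refine ⟨N * N ^ θ * (K * κ ^ (1 + θ)), ?_, ?_, ?_⟩
  · simp [ENNReal.rpow_eq_zero_iff, hN0, hN1, hK0, hκ0, hκ1]
  · refine ENNReal.mul_ne_top (ENNReal.mul_ne_top hN1 ?_) (ENNReal.mul_ne_top hK ?_)
    · exact ENNReal.rpow_ne_top_of_nonneg hθ.le hN1
    · exact ENNReal.rpow_ne_top_of_nonneg (by positivity) hκ1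
  intro L hL E B hEB
  set V : ℝ≥0∞ := ENNReal.ofReal (L ^ n * L ^ p) with hV
  rcases E.eq_empty_or_nonempty with rfl | ⟨z0, hz0⟩
  · simp
  rcases B.eq_empty_or_nonempty with rfl | ⟨w0, hw0⟩
  · simp [hθ]
  have hLp : 0 < L ^ p := by positivity
  set PE : (Fin n → ℤ) × ℤ → Set ((Fin n → ℝ) × ℝ) := fun u =>
    pbox n (z0.1 + fun i => (u.1 i : ℝ) * (δ * L)) (z0.2 + u.2 * (δ * L ^ p)) (δ * L) (δ * L ^ p) with hPE
  set PB : (Fin n → ℤ) × ℤ → Set ((Fin n → ℝ) × ℝ) := fun u =>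
    pbox n (w0.1 + fun i => (u.1 i : ℝ) * (δ * L)) (w0.2 + u.2 * (δ * L ^ p)) (δ * L) (δ * L ^ p) with hPB
  have hcL : 2 * G * L < c * (δ * L) := by nlinarith
  have hcLp : 2 * G * L ^ p < c * (δ * L ^ p) := by nlinarith
  have hcovE : E ⊆ ⋃ u ∈ U, PE u := by
    apply cover_pbox z0 (δ * L) (δ * L ^ p) (by positivity) (by positivity) c E
    intro z hz
    obtain ⟨h1, h2, h3⟩ := hEB z hz w0 hw0
    obtain ⟨h1', h2', h3'⟩ := hEB z0 hz0 w0 hw0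
    have hq : 0 < L ^ p / G := by positivity
    constructor
    · have : z.1 - z0.1 = (w0.1 - z0.1) - (w0.1 - z.1) := by abel
      rw [this]
      refine lt_of_le_of_lt (norm_sub_le _ _) ?_
      linarith
    · rw [abs_lt]; constructor <;> linarith
  have hcovB : B ⊆ ⋃ u ∈ U, PB u := by
    apply cover_pbox w0 (δ * L) (δ * L ^ p) (by positivity) (by positivity) c B
    intro w hw
    obtain ⟨h1, h2, h3⟩ := hEB z0 hz0 w hw
    obtain ⟨h1', h2', h3'⟩ := hEB z0 hz0 w0 hw0
    have hq : 0 < L ^ p / G := by positivity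
    constructor
    · have : w.1 - w0.1 = (w.1 - z0.1) - (w0.1 - z0.1) := by abel
      rw [this]
      refine lt_of_le_of_lt (norm_sub_le _ _) ?_
      linarith
    · rw [abs_lt]; constructor <;> linarith
  have hpair : ∀ u v, (∫⁻ z in E ∩ PE u, W z) * (∫⁻ z in B ∩ PB v, σ z) ^ θ ≤
      K * κ ^ (1 + θ) * V ^ (1 + θ) := by
    intro u v
    rcases (E ∩ PE u).eq_empty_or_nonempty with h | ⟨z, hzE, hzu⟩
    · rw [h]; simp
    rcases (B ∩ PB v).eq_empty_or_nonempty with h | ⟨w, hwB, hwv⟩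
    · rw [h]; simp [hθ]
    obtain ⟨h1, h2, h3⟩ := hEB z hzE w hwB
    obtain ⟨hz1, hz2⟩ := hzu
    obtain ⟨hw1, hw2⟩ := hwv
    set x := (z0.1 + fun i => (u.1 i : ℝ) * (δ * L)) with hx
    set x' := (w0.1 + fun i => (v.1 i : ℝ) * (δ * L)) with hx'
    set t := z0.2 + u.2 * (δ * L ^ p) with ht
    set t' := w0.2 + v.2 * (δ * L ^ p) with ht'
    rw [abs_le] at hz2 hw2
    have hδG : δ * G ≤ 1 / 4 := by
      calc δ * G ≤ 1 / (4 * G) * G := by gcongr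
        _ = 1 / 4 := by field_simp
    have hδL : 2 * (δ * L ^ p) ≤ L ^ p / G / 2 := by
      rw [div_div, le_div_iff₀ (by positivity)]
      nlinarith
    have hGp : L ^ p / G ≤ L ^ p := div_le_self hLp.le hG
    have hGp' : L ^ p ≤ G * L ^ p := by nlinarith
    have hΔ1 : L ^ p / (2 * G) ≤ t' - t := by
      have : L ^ p / (2 * G) = L ^ p / G / 2 := by field_simp
      rw [this]; linarith
    have hΔ2 : t' - t ≤ 2 * G * L ^ p := by linarith
    have hΔ0 : 0 < t' - t := lt_of_lt_of_le (by positivity) hΔ1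
    set l := (t' - t) ^ (1 / p) with hl
    have hl0 : 0 < l := by positivity
    have hlp : l ^ p = t' - t := by
      rw [hl, ← Real.rpow_mul hΔ0.le, one_div_mul_cancel hp0.ne', Real.rpow_one]
    have hG2 : 2 * G ≤ (2 * G) ^ p := by
      nth_rewrite 1 [← Real.rpow_one (2 * G)]
      exact Real.rpow_le_rpow_of_exponent_le (by linarith) hp.le
    have hl1 : l ≤ 2 * G * L := by
      rw [← Real.rpow_le_rpow_iff hl0.le (by positivity) hp0, hlp,
        Real.mul_rpow (by positivity) hL.le]
      exact hΔ2.trans (by gcongr)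
    have hl2 : L ≤ 2 * G * l := by
      rw [← Real.rpow_le_rpow_iff hL.le (by positivity) hp0,
        Real.mul_rpow (by positivity) hl0.le, hlp]
      rw [div_le_iff₀ (by positivity)] at hΔ1
      calc L ^ p ≤ (t' - t) * (2 * G) := hΔ1
        _ = (2 * G) * (t' - t) := by ring
        _ ≤ _ := by gcongr
    have hxx : ‖x' - x‖ ≤ 2 * G * L := by
      have : x' - x = (w.1 - z.1) + (z.1 - x) - (w.1 - x') := by abel
      rw [this]
      have h4 := norm_sub_le ((w.1 - z.1) + (z.1 - x)) (w.1 - x')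
      have h5 := norm_add_le (w.1 - z.1) (z.1 - x)
      have h6 : 2 * (δ * L) ≤ G * L := by nlinarith
      linarith
    have happ := H x x' t l (δ * L) (δ * L ^ p) hl0 (by
        calc ‖x' - x‖ ≤ 2 * G * L := hxx
          _ ≤ 2 * G * (2 * G * l) := by gcongr
          _ = _ := by ring) (by
        calc δ * L ≤ ε / (2 * G) * (2 * G * l) := by gcongr
          _ = ε * l := by field_simp)
      (by
        rw [hlp]
        rw [div_le_iff₀ (by positivity)] at hΔ1
        calc δ * L ^ p ≤ ε / (2 * G) * ((t' - t) * (2 * G)) := by gcongr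
          _ = _ := by field_simp)
      (by
        calc δ / (2 * G) * l ≤ δ / (2 * G) * (2 * G * L) := by gcongr
          _ = _ := by field_simp)
      (by
        rw [hlp]
        calc δ / (2 * G) * (t' - t) ≤ δ / (2 * G) * (2 * G * L ^ p) := by gcongr
          _ = _ := by field_simp)
    rw [hlp, show t + (t' - t) = t' by ring] at happ
    have hvol : ENNReal.ofReal ((2 * (δ * L)) ^ n * (2 * (δ * L ^ p))) = κ * V := by
      rw [hκ, hV, ← ENNReal.ofReal_mul (by positivity)]
      congr 1
      rw [← mul_assoc, mul_pow]; ring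
    rw [hvol, ENNReal.mul_rpow_of_nonneg _ _ (by positivity), ← mul_assoc] at happ
    refine le_trans ?_ happ
    gcongr
    · exact inter_subset_right
    · exact inter_subset_right
  obtain ⟨v, hv, hvmax⟩ := Finset.exists_max_image U (fun v => ∫⁻ z in B ∩ PB v, σ z) hUne
  have hB : (∫⁻ z in B, σ z) ≤ N * ∫⁻ z in B ∩ PB v, σ z := by
    refine (cover_int volume U PB B hcovB σ).trans ?_
    refine (Finset.sum_le_card_nsmul U _ _ hvmax).trans_eq ?_
    rw [nsmul_eq_mul]
  have hE := cover_int volume U PE E hcovE W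
  calc (∫⁻ z in E, W z) * (∫⁻ z in B, σ z) ^ θ
      ≤ (∑ u ∈ U, ∫⁻ z in E ∩ PE u, W z) * (N * ∫⁻ z in B ∩ PB v, σ z) ^ θ := by gcongr
    _ = N ^ θ * ∑ u ∈ U, (∫⁻ z in E ∩ PE u, W z) * (∫⁻ z in B ∩ PB v, σ z) ^ θ := by
      rw [ENNReal.mul_rpow_of_nonneg _ _ hθ.le, ← Finset.sum_mul]; ring
    _ ≤ N ^ θ * (N * (K * κ ^ (1 + θ) * V ^ (1 + θ))) := by
      gcongr
      refine (Finset.sum_le_card_nsmul U _ _ fun u _ => hpair u v).trans_eq ?_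
      rw [nsmul_eq_mul]
    _ = _ := by ring

/-- The density `ω^q`. -/
def wq {n : ℕ} (q : ℝ) (ω : (Fin n → ℝ) × ℝ → ℝ) (z : (Fin n → ℝ) × ℝ) : ℝ≥0∞ :=
  ENNReal.ofReal (ω z) ^ q

/-- The density `ω^{-r'}`. -/
def ws {n : ℕ} (r : ℝ) (ω : (Fin n → ℝ) × ℝ → ℝ) (z : (Fin n → ℝ) × ℝ) : ℝ≥0∞ :=
  ENNReal.ofReal (ω z) ^ (-(r / (r - 1)))

lemma wq_meas {n : ℕ} {q : ℝ} {ω : (Fin n → ℝ) × ℝ → ℝ} (hω : Measurable ω) :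
    Measurable (wq q ω) := by
  unfold wq; fun_prop

lemma ws_meas {n : ℕ} {r : ℝ} {ω : (Fin n → ℝ) × ℝ → ℝ} (hω : Measurable ω) :
    Measurable (ws r ω) := by
  unfold ws; fun_prop

lemma ws_ne_zero {n : ℕ} {r : ℝ} (hr : 1 < r) (ω : (Fin n → ℝ) × ℝ → ℝ) (z) : ws r ω z ≠ 0 := by
  unfold ws
  rw [ENNReal.rpow_neg]
  simp only [ne_eq, ENNReal.inv_eq_zero]
  have : 0 ≤ r / (r - 1) := div_nonneg (by linarith) (by linarith)
  exact ENNReal.rpow_ne_top_of_nonneg this ENNReal.ofReal_ne_top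

lemma wws {n : ℕ} {r q : ℝ} (hr : 1 < r) (hrq : r ≤ q) (ω : (Fin n → ℝ) × ℝ → ℝ) :
    WS (wq q ω) (ws r ω) (q / (r / (r - 1))) := by
  intro z
  have hr1 : 0 < r / (r - 1) := div_pos (by linarith) (by linarith)
  have hq : 0 < q := by linarith
  by_cases h0 : ENNReal.ofReal (ω z) = 0
  · right
    constructor
    · simp [wq, h0, hq]
    · simp only [ws, h0]
      exact ENNReal.zero_rpow_of_neg (by linarith)
  · left
    simp only [wq, ws]
    rw [← ENNReal.rpow_mul, ← ENNReal.rpow_add _ _ h0 ENNReal.ofReal_ne_top]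
    have : q + -(r / (r - 1)) * (q / (r / (r - 1))) = 0 := by
      rw [neg_mul, mul_div_cancel₀ _ hr1.ne']; ring
    rw [this, ENNReal.rpow_zero]

lemma parUp_eq (n : ℕ) (p : ℝ) (x : Fin n → ℝ) (t L γ : ℝ) :
    parUp n p x t L γ = Metric.closedBall x L ×ˢ Ioo (t + γ * L ^ p) (t + L ^ p) := by
  ext z; simp [parUp, dist_eq_norm]

lemma parLow_eq (n : ℕ) (p : ℝ) (x : Fin n → ℝ) (t L γ : ℝ) :
    parLow n p x t L γ = Metric.closedBall x L ×ˢ Ioo (t - L ^ p) (t - γ * L ^ p) := by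
  ext z; simp [parLow, dist_eq_norm]

lemma parUp_meas (n : ℕ) (p : ℝ) (x : Fin n → ℝ) (t L γ : ℝ) : MeasurableSet (parUp n p x t L γ) := by
  rw [parUp_eq]; exact measurableSet_closedBall.prod measurableSet_Ioo

lemma parUp_vol (n : ℕ) (p : ℝ) (x : Fin n → ℝ) (t L γ : ℝ) (hL : 0 < L) :
    volume (parUp n p x t L γ) = ENNReal.ofReal ((2 * L) ^ n * ((1 - γ) * L ^ p)) := by
  rw [parUp_eq, Measure.volume_eq_prod, Measure.prod_prod, Real.volume_pi_closedBall _ hL.le,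
    Real.volume_Ioo, Fintype.card_fin, ← ENNReal.ofReal_mul (by positivity)]
  congr 2; ring

lemma parLow_vol (n : ℕ) (p : ℝ) (x : Fin n → ℝ) (t L γ : ℝ) (hL : 0 < L) :
    volume (parLow n p x t L γ) = ENNReal.ofReal ((2 * L) ^ n * ((1 - γ) * L ^ p)) := by
  rw [parLow_eq, Measure.volume_eq_prod, Measure.prod_prod, Real.volume_pi_closedBall _ hL.le,
    Real.volume_Ioo, Fintype.card_fin, ← ENNReal.ofReal_mul (by positivity)]
  congr 2; ring

lemma avg_prod (a b v K : ℝ≥0∞) (θ : ℝ) (hθ : 0 < θ) (hv0 : v ≠ 0) (hv : v ≠ ∞) :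
    a / v * (b / v) ^ θ ≤ K ↔ a * b ^ θ ≤ K * v ^ (1 + θ) := by
  have h0 : v ^ (1 + θ) ≠ 0 := by simp [ENNReal.rpow_eq_zero_iff, hv0, hv]
  have h1 : v ^ (1 + θ) ≠ ∞ := by simp [ENNReal.rpow_eq_top_iff, hv0, hv]
  have e : a / v * (b / v) ^ θ = a * b ^ θ / v ^ (1 + θ) := by
    rw [ENNReal.div_rpow_of_nonneg _ _ hθ.le, ENNReal.rpow_add _ _ hv0 hv, ENNReal.rpow_one]
    simp only [div_eq_mul_inv]
    rw [ENNReal.mul_inv (Or.inl hv0) (Or.inl hv)]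
    ring
  rw [e]
  exact ENNReal.div_le_iff h0 h1

lemma TArq_iff {n : ℕ} {p γ r q : ℝ} (ω : (Fin n → ℝ) × ℝ → ℝ) (hr : 1 < r) (hrq : r ≤ q)
    (hγ : γ < 1) (K : ℝ≥0∞) :
    TArq n p γ r q ω ω ≤ K ↔ ∀ x t L, 0 < L →
      (∫⁻ z in parLow n p x t L γ, wq q ω z) * (∫⁻ z in parUp n p x t L γ, ws r ω z) ^ (q / (r / (r - 1))) ≤
        K * ENNReal.ofReal ((2 * L) ^ n * ((1 - γ) * L ^ p)) ^ (1 + q / (r / (r - 1))) := by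
  have hr1 : 0 < r / (r - 1) := div_pos (by linarith) (by linarith)
  have hθ : 0 < q / (r / (r - 1)) := div_pos (by linarith) hr1
  simp only [TArq, iSup_le_iff, setAvg]
  refine forall_congr' fun x => forall_congr' fun t => forall_congr' fun L => forall_congr' fun hL => ?_
  rw [parUp_vol _ _ _ _ _ _ hL, parLow_vol _ _ _ _ _ _ hL]
  apply avg_prod _ _ _ _ _ hθ
  · simp only [ne_eq, ENNReal.ofReal_eq_zero, not_le]
    have : 0 < 1 - γ := by linarith
    positivity
  · exact ENNReal.ofReal_ne_top

lemma rpow_root {p a : ℝ} (hp : 0 < p) (ha : 0 ≤ a) : (a ^ (1 / p)) ^ p = a := by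
  rw [← Real.rpow_mul ha, one_div_mul_cancel hp.ne', Real.rpow_one]

set_option maxHeartbeats 1000000 in
lemma condH_of_TArq {n : ℕ} {p γ r q : ℝ} (ω : (Fin n → ℝ) × ℝ → ℝ) (hp : 1 < p) (hr : 1 < r)
    (hrq : r ≤ q) (hγ0 : 0 < γ) (hγ : γ < 1) (h : TArq n p γ r q ω ω < ∞) :
    CondH n p (q / (r / (r - 1))) (wq q ω) (ws r ω) := by
  have hr1 : 0 < r / (r - 1) := div_pos (by linarith) (by linarith)
  have hθ : 0 < q / (r / (r - 1)) := div_pos (by linarith) hr1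
  set θ := q / (r / (r - 1)) with hθdef
  have hp0 : 0 < p := by linarith
  refine ⟨(1 - γ) / 4, by linarith, ?_⟩
  intro η hη
  set K0 := TArq n p γ r q ω ω + 1 with hK0
  have hT := (TArq_iff (p := p) ω hr hrq hγ K0).mp (by rw [hK0]; exact le_self_add)
  set κ : ℝ≥0∞ := ENNReal.ofReal ((1 / η) ^ n * (1 / η)) with hκ
  have hκ0 : κ ≠ 0 := by
    rw [hκ]; simp only [ne_eq, ENNReal.ofReal_eq_zero, not_le]; positivity
  have hκ1 : κ ≠ ∞ := ENNReal.ofReal_ne_top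
  refine ⟨K0 * κ ^ (1 + θ), ?_, ?_, ?_⟩
  · simp [hK0, ENNReal.rpow_eq_zero_iff, hκ0, hκ1]
  · refine ENNReal.mul_ne_top (ENNReal.add_ne_top.mpr ⟨h.ne, by simp⟩) ?_
    exact ENNReal.rpow_ne_top_of_nonneg (by positivity) hκ1
  intro x x' t l d d' hl hd hd' hηd hηd'
  have hlp : 0 < l ^ p := by positivity
  set L := (l ^ p / (1 + γ)) ^ (1 / p) with hL
  have hL0 : 0 < L := by positivity
  have hLp : L ^ p = l ^ p / (1 + γ) := rpow_root hp0 (by positivity)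
  have hLl : L ≤ l := by
    rw [← Real.rpow_le_rpow_iff hL0.le hl.le hp0, hLp]
    exact div_le_self hlp.le (by linarith)
  have hlL : l ≤ 2 * L := by
    rw [← Real.rpow_le_rpow_iff hl.le (by positivity) hp0, Real.mul_rpow (by norm_num) hL0.le, hLp]
    have : (2:ℝ) ≤ 2 ^ p := by
      nth_rewrite 1 [← Real.rpow_one 2]
      exact Real.rpow_le_rpow_of_exponent_le (by norm_num) hp.le
    rw [mul_div_assoc', le_div_iff₀ (by linarith)]
    nlinarith
  have hd0 : 0 < d := lt_of_lt_of_le (by positivity) hηd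
  have hd0' : 0 < d' := lt_of_lt_of_le (by positivity) hηd'
  set c : Fin n → ℝ := (1/2 : ℝ) • (x + x') with hc
  have hcx : ‖x - c‖ = ‖x' - x‖ / 2 := by
    have : x - c = (-(1/2) : ℝ) • (x' - x) := by rw [hc]; ext i; simp; ring
    rw [this, norm_smul]; norm_num; ring
  have hcx' : ‖x' - c‖ = ‖x' - x‖ / 2 := by
    have : x' - c = ((1/2) : ℝ) • (x' - x) := by rw [hc]; ext i; simp; ring
    rw [this, norm_smul]; norm_num; ring
  have hLeq : (1 + γ) * L ^ p = l ^ p := by rw [hLp]; field_simp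
  have hLp0 : 0 < L ^ p := by positivity
  have hspace : d + ‖x' - x‖ ≤ L := by
    refine hd.trans ?_
    nlinarith
  have hd2 : d' < (1 - γ) / 2 * L ^ p := by
    refine lt_of_le_of_lt hd' ?_
    rw [← hLeq]
    have h1 : 0 < (1 - γ) * L ^ p := mul_pos (by linarith) hLp0
    have h2 : 0 < (1 - γ) * ((1 - γ) * L ^ p) := mul_pos (by linarith) h1
    linarith
  have hnn := norm_nonneg (x' - x)
  have hsubE : pbox n x t d d' ⊆ parLow n p c (t + l ^ p / 2) L γ := by
    rintro z ⟨h1, h2⟩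
    rw [abs_le] at h2
    refine ⟨?_, ?_, ?_⟩
    · have : z.1 - c = (z.1 - x) + (x - c) := by abel
      rw [this]
      refine (norm_add_le _ _).trans ?_
      rw [hcx]; linarith
    · rw [← hLeq]; nlinarith
    · rw [← hLeq]; nlinarith
  have hsubB : pbox n x' (t + l ^ p) d d' ⊆ parUp n p c (t + l ^ p / 2) L γ := by
    rintro z ⟨h1, h2⟩
    rw [abs_le] at h2
    refine ⟨?_, ?_, ?_⟩
    · have : z.1 - c = (z.1 - x') + (x' - c) := by abel
      rw [this]
      refine (norm_add_le _ _).trans ?_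
      rw [hcx']; linarith
    · rw [← hLeq] at h2 ⊢; nlinarith
    · rw [← hLeq] at h2 ⊢; nlinarith
  calc _ ≤ (∫⁻ z in parLow n p c (t + l ^ p / 2) L γ, wq q ω z) *
        (∫⁻ z in parUp n p c (t + l ^ p / 2) L γ, ws r ω z) ^ θ := by
        gcongr
    _ ≤ _ := hT c (t + l ^ p / 2) L hL0
    _ ≤ K0 * (κ * ENNReal.ofReal ((2 * d) ^ n * (2 * d'))) ^ (1 + θ) := by
        gcongr
        rw [hκ, ← ENNReal.ofReal_mul (by positivity)]
        apply ENNReal.ofReal_le_ofReal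
        have h1 : 2 * L ≤ (1 / η) * (2 * d) := by
          rw [one_div, inv_mul_eq_div, le_div_iff₀ hη]; nlinarith
        have h2 : (1 - γ) * L ^ p ≤ (1 / η) * (2 * d') := by
          rw [one_div, inv_mul_eq_div, le_div_iff₀ hη]
          have e1 : 0 < γ * L ^ p := mul_pos hγ0 hLp0
          have e2 : (1 - γ) * L ^ p ≤ l ^ p := by rw [← hLeq]; linarith
          have e3 : (1 - γ) * L ^ p * η ≤ l ^ p * η := by gcongr
          linarith
        have h3 : 0 ≤ (1 - γ) * L ^ p := mul_nonneg (by linarith) hLp0.le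
        calc (2 * L) ^ n * ((1 - γ) * L ^ p) ≤ ((1 / η) * (2 * d)) ^ n * ((1 / η) * (2 * d')) := by
              gcongr
          _ = _ := by rw [mul_pow]; ring
    _ = _ := by rw [ENNReal.mul_rpow_of_nonneg _ _ (by positivity)]; ring

lemma TArq_of_condH2 {n : ℕ} {p γ r q : ℝ} (ω : (Fin n → ℝ) × ℝ → ℝ) (hr : 1 < r)
    (hrq : r ≤ q) (hγ0 : 0 < γ) (hγ : γ < 1)
    (H : CondH2 n p (q / (r / (r - 1))) (wq q ω) (ws r ω)) : TArq n p γ r q ω ω < ∞ := by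
  have hr1 : 0 < r / (r - 1) := div_pos (by linarith) (by linarith)
  have hθ : 0 < q / (r / (r - 1)) := div_pos (by linarith) hr1
  obtain ⟨K, hK0, hK, H⟩ := H (max 2 (1 / (2 * γ))) (by simp)
  set G := max 2 (1 / (2 * γ)) with hG
  have hG2 : 2 ≤ G := le_max_left _ _
  have hGγ : 1 / G ≤ 2 * γ := by
    rw [one_div_le (by linarith) (by positivity)]; exact le_max_right _ _
  set κ : ℝ≥0∞ := ENNReal.ofReal (1 / (1 - γ)) with hκ
  set θ := q / (r / (r - 1)) with hθdef
  have hγ1 : 0 < 1 - γ := by linarith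
  refine lt_of_le_of_lt ((TArq_iff (p := p) ω hr hrq hγ (K * κ ^ (1 + θ))).mpr ?_) ?_
  · intro x t L hL
    have hLp : 0 < L ^ p := by positivity
    refine (H L hL _ _ ?_).trans ?_
    · rintro z ⟨hz1, hz2⟩ w ⟨hw1, hw2⟩
      rw [mem_Ioo] at hz2 hw2
      refine ⟨?_, ?_, ?_⟩
      · have : L ^ p / G ≤ 2 * γ * L ^ p := by
          rw [div_eq_mul_one_div, mul_comm]; gcongr
        linarith
      · nlinarith
      · have : w.1 - z.1 = (w.1 - x) - (z.1 - x) := by abel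
        rw [this]
        refine (norm_sub_le _ _).trans ?_
        nlinarith
    · rw [mul_assoc, ← ENNReal.mul_rpow_of_nonneg _ _ (by positivity), hκ,
        ← ENNReal.ofReal_mul (by positivity)]
      refine mul_le_mul_right (ENNReal.rpow_le_rpow (ENNReal.ofReal_le_ofReal ?_) (by positivity)) _
      calc L ^ n * L ^ p ≤ (2 * L) ^ n * L ^ p := by gcongr; linarith
        _ = _ := by field_simp
  · exact ENNReal.mul_lt_top hK.lt_top (ENNReal.rpow_lt_top_of_nonneg (by positivity) ENNReal.ofReal_ne_top)

/-- Regularised dual weight. -/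
def gk {n : ℕ} (r : ℝ) (ω : (Fin n → ℝ) × ℝ → ℝ) (k : ℕ) (z : (Fin n → ℝ) × ℝ) : ℝ≥0∞ :=
  (ENNReal.ofReal (ω z) + ((k + 1 : ℕ) : ℝ≥0∞)⁻¹) ^ (-(r / (r - 1)))

lemma gk_meas {n : ℕ} {r : ℝ} {ω : (Fin n → ℝ) × ℝ → ℝ} (hω : Measurable ω) (k : ℕ) :
    Measurable (gk r ω k) := by
  unfold gk; fun_prop

lemma gk_base {n : ℕ} (ω : (Fin n → ℝ) × ℝ → ℝ) (k : ℕ) (z) :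
    ENNReal.ofReal (ω z) + ((k + 1 : ℕ) : ℝ≥0∞)⁻¹ ≠ 0 ∧
    ENNReal.ofReal (ω z) + ((k + 1 : ℕ) : ℝ≥0∞)⁻¹ ≠ ∞ := by
  constructor
  · intro h
    rw [add_eq_zero] at h
    exact (ENNReal.inv_ne_zero.mpr (ENNReal.natCast_ne_top _)) h.2
  · refine ENNReal.add_ne_top.mpr ⟨ENNReal.ofReal_ne_top, ?_⟩
    rw [ENNReal.inv_ne_top]
    simp

lemma gk_ne_zero {n : ℕ} {r : ℝ} (ω : (Fin n → ℝ) × ℝ → ℝ) (k : ℕ) (z) :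
    gk r ω k z ≠ 0 := by
  obtain ⟨h0, h1⟩ := gk_base ω k z
  unfold gk
  simp [ENNReal.rpow_eq_zero_iff]

lemma gk_le {n : ℕ} {r : ℝ} (hr : 1 < r) (ω : (Fin n → ℝ) × ℝ → ℝ) (k : ℕ) (z) :
    gk r ω k z ≤ ((k + 1 : ℕ) : ℝ≥0∞) ^ (r / (r - 1)) := by
  have hr1 : 0 < r / (r - 1) := div_pos (by linarith) (by linarith)
  unfold gk
  rw [ENNReal.rpow_neg, ← ENNReal.inv_rpow]
  apply ENNReal.rpow_le_rpow _ hr1.le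
  rw [ENNReal.inv_le_iff_inv_le]
  exact le_add_self

lemma gk_rpow {n : ℕ} {r : ℝ} (hr : 1 < r) (ω : (Fin n → ℝ) × ℝ → ℝ) (k : ℕ) (z) :
    gk r ω k z ^ r * ENNReal.ofReal (ω z) ^ r ≤ gk r ω k z := by
  obtain ⟨h0, h1⟩ := gk_base ω k z
  have hr1 : r - 1 ≠ 0 := by linarith
  calc gk r ω k z ^ r * ENNReal.ofReal (ω z) ^ r ≤
      gk r ω k z ^ r * (ENNReal.ofReal (ω z) + ((k + 1 : ℕ) : ℝ≥0∞)⁻¹) ^ r := by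
        gcongr; exact le_self_add
    _ = gk r ω k z := by
        unfold gk
        rw [← ENNReal.rpow_mul, ← ENNReal.rpow_add _ _ h0 h1]
        congr 1
        field_simp
        ring

lemma gk_tendsto {n : ℕ} {r : ℝ} (ω : (Fin n → ℝ) × ℝ → ℝ) (z) :
    Filter.Tendsto (fun k => gk r ω k z) Filter.atTop (nhds (ws r ω z)) := by
  unfold gk ws
  refine (ENNReal.continuous_rpow_const.tendsto _).comp ?_
  have h : Filter.Tendsto (fun k : ℕ => ((k + 1 : ℕ) : ℝ≥0∞)⁻¹) Filter.atTop (nhds 0) :=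
    ENNReal.tendsto_inv_nat_nhds_zero.comp (Filter.tendsto_add_atTop_nat 1)
  simpa using tendsto_const_nhds.add h

lemma gk_mono {n : ℕ} {r : ℝ} (hr : 1 < r) (ω : (Fin n → ℝ) × ℝ → ℝ) (z) :
    Monotone (fun k => gk r ω k z) := by
  have hr1 : 0 < r / (r - 1) := div_pos (by linarith) (by linarith)
  intro k l hkl
  simp only [gk]
  rw [ENNReal.rpow_neg, ENNReal.rpow_neg]
  apply ENNReal.inv_le_inv.mpr
  apply ENNReal.rpow_le_rpow _ hr1.le
  gcongr

lemma test_bound {n : ℕ} {p ρ β r q C : ℝ} {ω : (Fin n → ℝ) × ℝ → ℝ} (hω : Measurable ω)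
    (hr : 1 < r) (hrq : r ≤ q) (hβrq : β = 1 / r - 1 / q) (hρ : ρ < 1)
    (hC : ∀ f : ((Fin n → ℝ) × ℝ) → ℝ, Measurable f → wLp r ω f < ∞ →
        wLpE q ω (cMax n p ρ β f) ≤ ENNReal.ofReal C * wLp r ω f)
    (E B : Set ((Fin n → ℝ) × ℝ)) (hE : MeasurableSet E) (hB : MeasurableSet B)
    (hB0 : volume B ≠ 0) (hB1 : volume B ≠ ∞) (L : ℝ) (hL : 0 < L)
    (hEB : ∀ z ∈ E, B ⊆ parUp n p z.1 z.2 L ρ) (k : ℕ) :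
    (∫⁻ z in E, wq q ω z) * (∫⁻ z in B, gk r ω k z) ^ (q / (r / (r - 1))) ≤
      ENNReal.ofReal C ^ q *
        ENNReal.ofReal ((2 * L) ^ n * ((1 - ρ) * L ^ p)) ^ (1 + q / (r / (r - 1))) := by
  have hr0 : 0 < r := by linarith
  have hq0 : 0 < q := by linarith
  set v := ENNReal.ofReal ((2 * L) ^ n * ((1 - ρ) * L ^ p)) with hv
  have hv0 : v ≠ 0 := by
    simp only [hv, ne_eq, ENNReal.ofReal_eq_zero, not_le]
    have : 0 < 1 - ρ := by linarith
    positivity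
  have hv1 : v ≠ ∞ := ENNReal.ofReal_ne_top
  set S := ∫⁻ z in B, gk r ω k z with hS
  have hgtop : ∀ z, gk r ω k z ≠ ∞ := fun z => ne_top_of_le_ne_top
    (ENNReal.rpow_ne_top_of_nonneg (div_pos hr0 (by linarith)).le (ENNReal.natCast_ne_top _))
    (gk_le hr ω k z)
  have hS0 : S ≠ 0 := by
    intro h
    rw [hS, lintegral_eq_zero_iff (gk_meas hω k)] at h
    apply hB0
    rw [← Measure.restrict_apply_univ]
    rw [Filter.EventuallyEq, ae_iff] at h
    rw [← h]; congr 1; ext z; simp [gk_ne_zero]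
  have hS1 : S ≠ ∞ := by
    refine ne_top_of_le_ne_top ?_ (lintegral_mono (gk_le hr ω k))
    rw [lintegral_const, Measure.restrict_apply_univ]
    exact ENNReal.mul_ne_top (ENNReal.rpow_ne_top_of_nonneg (div_pos hr0 (by linarith)).le
      (ENNReal.natCast_ne_top _)) hB1
  set f : ((Fin n → ℝ) × ℝ) → ℝ := B.indicator (fun z => (gk r ω k z).toReal) with hf
  have hfm : Measurable f := (gk_meas hω k).ennreal_toReal.indicator hB
  have hfe : ∀ z, ENNReal.ofReal |f z| = B.indicator (gk r ω k) z := by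
    intro z
    by_cases hz : z ∈ B
    · simp only [hf, indicator_of_mem hz]
      rw [abs_of_nonneg ENNReal.toReal_nonneg, ENNReal.ofReal_toReal (hgtop z)]
    · simp [hf, indicator_of_notMem hz]
  have hw : wLp r ω f ≤ S ^ (1 / r) := by
    unfold wLp
    apply ENNReal.rpow_le_rpow _ (by positivity)
    rw [hS, ← lintegral_indicator hB]
    apply lintegral_mono
    intro z
    simp only [hfe]
    by_cases hz : z ∈ B
    · simp only [indicator_of_mem hz]; exact gk_rpow hr ω k z
    · simp [indicator_of_notMem hz, hr0]
  have hwt : wLp r ω f < ∞ :=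
    lt_of_le_of_lt hw (ENNReal.rpow_lt_top_of_nonneg (by positivity) hS1)
  have key := (hC f hfm hwt).trans (mul_le_mul_right hw _)
  have hM : ∀ z ∈ E, v ^ β * (S / v) ≤ cMax n p ρ β f z := by
    intro z hz
    unfold cMax
    refine le_trans ?_ (le_iSup₂ (f := fun (L : ℝ) (_ : 0 < L) =>
      volume (parUp n p z.1 z.2 L ρ) ^ β *
      setAvg (parUp n p z.1 z.2 L ρ) (fun w => ENNReal.ofReal |f w|)) L hL)
    simp only [setAvg, parUp_vol n p z.1 z.2 L ρ hL, hfe]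
    rw [lintegral_indicator hB, Measure.restrict_restrict hB, inter_eq_left.mpr (hEB z hz)]
  have hlow : (∫⁻ z in E, wq q ω z) * (v ^ β * (S / v)) ^ q ≤ wLpE q ω (cMax n p ρ β f) ^ q := by
    unfold wLpE
    rw [← ENNReal.rpow_mul, one_div_mul_cancel hq0.ne', ENNReal.rpow_one]
    rw [← lintegral_mul_const _ (wq_meas hω)]
    refine le_trans ?_ (setLIntegral_le_lintegral E _)
    apply setLIntegral_mono' hE
    intro z hz
    rw [mul_comm]
    exact mul_le_mul_left (ENNReal.rpow_le_rpow (hM z hz) hq0.le) _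
  have hup := hlow.trans (ENNReal.rpow_le_rpow key hq0.le)
  have e1 : v ^ β * (S / v) = S * v ^ (β - 1) := by
    rw [ENNReal.rpow_sub _ _ hv0 hv1, ENNReal.rpow_one, div_eq_mul_inv, div_eq_mul_inv]; ring
  rw [e1, ENNReal.mul_rpow_of_nonneg _ _ hq0.le, ENNReal.mul_rpow_of_nonneg _ _ hq0.le,
    ← ENNReal.rpow_mul, ← ENNReal.rpow_mul] at hup
  have hr1 : r - 1 ≠ 0 := by linarith
  have e2 : S ^ q = S ^ (q / (r / (r - 1))) * S ^ (1 / r * q) := by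
    rw [← ENNReal.rpow_add _ _ hS0 hS1]; congr 1; field_simp; ring
  have e3 : v ^ ((β - 1) * q) = (v ^ (1 + q / (r / (r - 1))))⁻¹ := by
    rw [← ENNReal.rpow_neg, hβrq]; congr 1; field_simp; ring
  rw [e2, e3] at hup
  set a := v ^ (1 + q / (r / (r - 1))) with ha
  have ha0 : a ≠ 0 := by simp [ha, ENNReal.rpow_eq_zero_iff, hv0, hv1]
  have ha1 : a ≠ ∞ := by simp [ha, ENNReal.rpow_eq_top_iff, hv0, hv1]
  set b := S ^ (1 / r * q) with hb
  have hb0 : b ≠ 0 := by simp [hb, ENNReal.rpow_eq_zero_iff, hS0, hS1]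
  have hb1 : b ≠ ∞ := by simp [hb, ENNReal.rpow_eq_top_iff, hS0, hS1]
  refine (ENNReal.mul_le_mul_iff_left hb0 hb1).mp ?_
  calc _ = ((∫⁻ z in E, wq q ω z) * (S ^ (q / (r / (r - 1))) * b * a⁻¹)) * a := by
        rw [mul_assoc _ _ a, mul_assoc _ a⁻¹ a, ENNReal.inv_mul_cancel ha0 ha1]; ring
    _ ≤ ENNReal.ofReal C ^ q * b * a := by gcongr
    _ = _ := by ring

set_option maxHeartbeats 1000000 in
lemma condH_of_bounded {n : ℕ} {p ρ β r q C : ℝ} {ω : (Fin n → ℝ) × ℝ → ℝ} (hω : Measurable ω)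
    (hp : 1 < p)
    (hr : 1 < r) (hrq : r ≤ q) (hβrq : β = 1 / r - 1 / q) (hρ0 : 0 < ρ) (hρ : ρ < 1)
    (hC0 : 0 < C)
    (hC : ∀ f : ((Fin n → ℝ) × ℝ) → ℝ, Measurable f → wLp r ω f < ∞ →
        wLpE q ω (cMax n p ρ β f) ≤ ENNReal.ofReal C * wLp r ω f) :
    CondH n p (q / (r / (r - 1))) (wq q ω) (ws r ω) := by
  have hr1 : 0 < r / (r - 1) := div_pos (by linarith) (by linarith)
  have hθ : 0 < q / (r / (r - 1)) := div_pos (by linarith) hr1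
  have hq0 : 0 < q := by linarith
  set θ := q / (r / (r - 1)) with hθdef
  have hp0 : 0 < p := by linarith
  refine ⟨(1 - ρ) / 5, by linarith, ?_⟩
  intro η hη
  set κ : ℝ≥0∞ := ENNReal.ofReal ((2 / η) ^ n * (1 / η)) with hκ
  have hκ0 : κ ≠ 0 := by
    rw [hκ]; simp only [ne_eq, ENNReal.ofReal_eq_zero, not_le]; positivity
  have hκ1 : κ ≠ ∞ := ENNReal.ofReal_ne_top
  refine ⟨ENNReal.ofReal C ^ q * κ ^ (1 + θ), ?_, ?_, ?_⟩
  · have : ENNReal.ofReal C ≠ 0 := by simpa using hC0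
    simp [ENNReal.rpow_eq_zero_iff, hκ0, hκ1, hC0]
  · exact ENNReal.mul_ne_top (ENNReal.rpow_ne_top_of_nonneg hq0.le ENNReal.ofReal_ne_top)
      (ENNReal.rpow_ne_top_of_nonneg (by positivity) hκ1)
  intro x x' t l d d' hl hd hd' hηd hηd'
  have hlp : 0 < l ^ p := by positivity
  set L := (2 * l ^ p / (1 + ρ)) ^ (1 / p) with hL
  have hL0 : 0 < L := by positivity
  have hLp : L ^ p = 2 * l ^ p / (1 + ρ) := rpow_root hp0 (by positivity)
  have h2p : (2:ℝ) ≤ 2 ^ p := by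
    nth_rewrite 1 [← Real.rpow_one 2]
    exact Real.rpow_le_rpow_of_exponent_le (by norm_num) hp.le
  have hlL : l ≤ L := by
    rw [← Real.rpow_le_rpow_iff hl.le hL0.le hp0, hLp, le_div_iff₀ (by linarith)]
    nlinarith
  have hLp2 : L ^ p ≤ 2 * l ^ p := by
    rw [hLp]; exact div_le_self (by linarith) (by linarith)
  have hLl : L ≤ 2 * l := by
    rw [← Real.rpow_le_rpow_iff hL0.le (by positivity) hp0, Real.mul_rpow (by norm_num) hl.le]
    refine hLp2.trans ?_
    gcongr
  have hd0 : 0 < d := lt_of_lt_of_le (by positivity) hηd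
  have hd0' : 0 < d' := lt_of_lt_of_le (by positivity) hηd'
  have hnn := norm_nonneg (x' - x)
  have hLeq : (1 + ρ) * L ^ p = 2 * l ^ p := by rw [hLp]; field_simp
  have hLp0 : 0 < L ^ p := by positivity
  have hd2 : 2 * d' < (1 - ρ) / 2 * L ^ p := by
    have h1 : 0 < (1 - ρ) * L ^ p := mul_pos (by linarith) hLp0
    have h2 : 0 < (1 - ρ) * ((1 - ρ) * L ^ p) := mul_pos (by linarith) h1
    have h3 : (1 - ρ) / 5 * l ^ p = (1 - ρ) / 10 * ((1 + ρ) * L ^ p) := by rw [hLeq]; ring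
    linarith
  have hd5 : d + ‖x' - x‖ ≤ l / 2 := by
    refine hd.trans ?_
    have := mul_pos hρ0 hl
    linarith
  have hsub : ∀ z ∈ pbox n x t d d', pbox n x' (t + l ^ p) d d' ⊆ parUp n p z.1 z.2 L ρ := by
    rintro z ⟨h1, h2⟩ w ⟨h3, h4⟩
    rw [abs_le] at h2 h4
    refine ⟨?_, ?_, ?_⟩
    · have : w.1 - z.1 = (w.1 - x') + (x' - x) - (z.1 - x) := by abel
      rw [this]
      refine (norm_sub_le _ _).trans ?_
      have := norm_add_le (w.1 - x') (x' - x)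
      linarith
    · linarith
    · linarith
  have hvolB : volume (pbox n x' (t + l ^ p) d d') = ENNReal.ofReal ((2 * d) ^ n * (2 * d')) :=
    pbox_vol _ _ _ _ _ hd0.le
  have hB0 : volume (pbox n x' (t + l ^ p) d d') ≠ 0 := by
    rw [hvolB]; simp only [ne_eq, ENNReal.ofReal_eq_zero, not_le]; positivity
  have hB1 : volume (pbox n x' (t + l ^ p) d d') ≠ ∞ := by
    rw [hvolB]; exact ENNReal.ofReal_ne_top
  have hk := test_bound hω hr hrq hβrq hρ hC (pbox n x t d d') (pbox n x' (t + l ^ p) d d')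
    (pbox_meas _ _ _ _ _) (pbox_meas _ _ _ _ _) hB0 hB1 L hL0 hsub
  have hlim : (∫⁻ z in pbox n x t d d', wq q ω z) *
      (∫⁻ z in pbox n x' (t + l ^ p) d d', ws r ω z) ^ θ ≤ ENNReal.ofReal C ^ q *
        ENNReal.ofReal ((2 * L) ^ n * ((1 - ρ) * L ^ p)) ^ (1 + θ) := by
    have h1 : Filter.Tendsto (fun k => ∫⁻ z in pbox n x' (t + l ^ p) d d', gk r ω k z) Filter.atTop
        (nhds (∫⁻ z in pbox n x' (t + l ^ p) d d', ws r ω z)) :=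
      lintegral_tendsto_of_tendsto_of_monotone (fun k => (gk_meas hω k).aemeasurable)
        (Filter.Eventually.of_forall fun z => gk_mono hr ω z)
        (Filter.Eventually.of_forall fun z => gk_tendsto ω z)
    have h2 := (ENNReal.continuous_rpow_const (y := θ)).tendsto _ |>.comp h1
    by_cases hs : ∫⁻ z in pbox n x' (t + l ^ p) d d', ws r ω z = 0
    · rw [hs, ENNReal.zero_rpow_of_pos hθ, mul_zero]; exact zero_le
    have h3 := ENNReal.Tendsto.const_mul (a := ∫⁻ z in pbox n x t d d', wq q ω z) h2
      (Or.inl (by simp [ENNReal.rpow_eq_zero_iff, hs, not_lt.mpr hθ.le]))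
    exact le_of_tendsto' h3 hk
  refine hlim.trans ?_
  rw [mul_assoc, ← ENNReal.mul_rpow_of_nonneg _ _ (by positivity), hκ,
    ← ENNReal.ofReal_mul (by positivity)]
  refine mul_le_mul_right (ENNReal.rpow_le_rpow (ENNReal.ofReal_le_ofReal ?_) (by positivity)) _
  have h1 : 2 * L ≤ (2 / η) * (2 * d) := by
    rw [div_mul_eq_mul_div, le_div_iff₀ hη]; nlinarith
  have h2 : (1 - ρ) * L ^ p ≤ (1 / η) * (2 * d') := by
    rw [one_div, inv_mul_eq_div, le_div_iff₀ hη]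
    have e1 : 0 < ρ * L ^ p := mul_pos hρ0 hLp0
    have e2 : (1 - ρ) * L ^ p ≤ 2 * l ^ p := by linarith
    have e3 : (1 - ρ) * L ^ p * η ≤ 2 * l ^ p * η := by gcongr
    linarith
  have h3 : 0 ≤ (1 - ρ) * L ^ p := mul_nonneg (by linarith) hLp0.le
  calc (2 * L) ^ n * ((1 - ρ) * L ^ p) ≤ ((2 / η) * (2 * d)) ^ n * ((1 / η) * (2 * d')) := by
        gcongr
    _ = _ := by rw [mul_pow]; ring

/-- One dimensional grid index. -/
def fl (j : ℤ) (θ y : ℝ) : ℤ := ⌊y / 64 ^ j - θ⌋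

/-- The shift of the grid. -/
def th (b : Bool) : ℝ := if b then 1 / 3 else 0

lemma fl_iff (j : ℤ) (θ y : ℝ) (m : ℤ) :
    fl j θ y = m ↔ (64:ℝ) ^ j * (m + θ) ≤ y ∧ y < 64 ^ j * (m + θ) + 64 ^ j := by
  have h : (0:ℝ) < 64 ^ j := by positivity
  unfold fl
  rw [Int.floor_eq_iff, le_sub_iff_add_le, sub_lt_iff_lt_add, le_div_iff₀ h, div_lt_iff₀ h]
  constructor
  · rintro ⟨h1, h2⟩; constructor <;> nlinarith
  · rintro ⟨h1, h2⟩; constructor <;> nlinarith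

lemma fl_succ (j : ℤ) (b : Bool) (y : ℝ) :
    fl (j + 1) (th b) y = (fl j (th b) y - (if b then 21 else 0)) / 64 := by
  unfold fl
  have h : y / 64 ^ (j + 1) - th b =
      ((y / 64 ^ j - th b) - ((if b then 21 else 0 : ℤ) : ℝ)) / ((64 : ℕ) : ℝ) := by
    rw [zpow_add₀ (by norm_num)]
    have h : (0:ℝ) < 64 ^ j := by positivity
    cases b <;> simp [th] <;> field_simp <;> ring
  rw [h, Int.floor_div_natCast, Int.floor_sub_intCast]
  rfl

lemma fl_nest {j j' : ℤ} (hj : j ≤ j') (b : Bool) (y y' : ℝ) (h : fl j (th b) y = fl j (th b) y') :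
    fl j' (th b) y = fl j' (th b) y' := by
  induction j', hj using Int.leInduction with
  | base => exact h
  | succ k hk ih => rw [fl_succ, fl_succ, ih]

lemma fl_good (j : ℤ) (y : ℝ) : ∃ b : Bool, ∀ y' : ℝ, |y' - y| < 64 ^ j / 6 →
    fl j (th b) y' = fl j (th b) y := by
  have h : (0:ℝ) < 64 ^ j := by positivity
  set a := y / 64 ^ j with ha
  have hk : ∀ y' : ℝ, |y' - y| < 64 ^ j / 6 → |y' / 64 ^ j - a| < 1 / 6 := by
    intro y' hy
    rw [ha, ← _root_.sub_div, abs_div, abs_of_pos h, div_lt_iff₀ h]; linarith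
  have h0 := Int.floor_le a
  have h1 := Int.lt_floor_add_one a
  by_cases hf : (⌊a⌋ : ℝ) + 1 / 6 ≤ a ∧ a < ⌊a⌋ + 5 / 6
  · refine ⟨false, fun y' hy => ?_⟩
    have := hk y' hy
    rw [abs_lt] at this
    simp only [fl, th, Bool.false_eq_true, if_false, sub_zero, ← ha]
    rw [Int.floor_eq_iff]
    constructor <;> linarith
  · refine ⟨true, fun y' hy => ?_⟩
    have := hk y' hy
    rw [abs_lt] at this
    simp only [fl, th, if_true, ← ha]
    by_cases h6 : a < ⌊a⌋ + 1 / 6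
    · have e : ⌊a - 1 / 3⌋ = ⌊a⌋ - 1 := by
        rw [Int.floor_eq_iff]; push_cast; constructor <;> linarith
      rw [e, Int.floor_eq_iff]; push_cast; constructor <;> linarith
    · have h7 : (⌊a⌋ : ℝ) + 5 / 6 ≤ a := by
        by_contra h8
        exact hf ⟨by linarith, by linarith⟩
      have e : ⌊a - 1 / 3⌋ = ⌊a⌋ := by
        rw [Int.floor_eq_iff]; constructor <;> linarith
      rw [e, Int.floor_eq_iff]; constructor <;> linarith

/-- time scale exponent -/
def tE (p : ℝ) (k : ℤ) : ℤ := ⌊(k : ℝ) * p⌋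

/-- parabolic grid index -/
def gidx {n : ℕ} (p : ℝ) (c : (Fin n → Bool) × Bool) (k : ℤ) (z : (Fin n → ℝ) × ℝ) :
    (Fin n → ℤ) × ℤ :=
  (fun i => fl k (th (c.1 i)) (z.1 i), fl (tE p k) (th c.2) z.2)

lemma tE_succ {p : ℝ} (hp : 1 < p) (k : ℤ) : tE p k + 1 ≤ tE p (k + 1) := by
  unfold tE
  rw [← Int.floor_add_one]
  apply Int.floor_le_floor
  push_cast; linarith

lemma tE_succ_le (p : ℝ) (k : ℤ) : tE p (k + 1) ≤ tE p k + (⌊p⌋ + 1) := by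
  unfold tE
  have := Int.le_floor_add_floor ((k:ℝ) * p) p
  push_cast
  rw [add_mul, one_mul]; omega

lemma tau_le (p : ℝ) (k : ℤ) : (64:ℝ) ^ tE p k ≤ ((64:ℝ) ^ k) ^ p := by
  rw [← Real.rpow_intCast, ← Real.rpow_intCast, ← Real.rpow_mul (by norm_num)]
  exact Real.rpow_le_rpow_of_exponent_le (by norm_num) (Int.floor_le _)

lemma le_tau (p : ℝ) (k : ℤ) : ((64:ℝ) ^ k) ^ p ≤ 64 * (64:ℝ) ^ tE p k := by
  have : (64:ℝ) * (64:ℝ) ^ tE p k = (64:ℝ) ^ (((tE p k : ℤ) : ℝ) + 1) := by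
    rw [Real.rpow_add (by norm_num), Real.rpow_one, Real.rpow_intCast]; ring
  rw [this, ← Real.rpow_intCast, ← Real.rpow_mul (by norm_num)]
  exact Real.rpow_le_rpow_of_exponent_le (by norm_num) (Int.lt_floor_add_one _).le

lemma gidx_nest {n : ℕ} {p : ℝ} (hp : 1 < p) (c : (Fin n → Bool) × Bool) (k : ℤ)
    (z z' : (Fin n → ℝ) × ℝ) (h : gidx p c k z = gidx p c k z') :
    gidx p c (k + 1) z = gidx p c (k + 1) z' := by
  simp only [gidx, Prod.mk.injEq] at h ⊢
  refine ⟨funext fun i => fl_nest (by omega) _ _ _ (congrFun h.1 i), fl_nest ?_ _ _ _ h.2⟩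
  have := tE_succ hp k; omega

lemma gidx_nest_le {n : ℕ} {p : ℝ} (hp : 1 < p) (c : (Fin n → Bool) × Bool) {k k' : ℤ} (hk : k ≤ k')
    (z z' : (Fin n → ℝ) × ℝ) (h : gidx p c k z = gidx p c k z') :
    gidx p c k' z = gidx p c k' z' := by
  induction k', hk using Int.leInduction with
  | base => exact h
  | succ k hk ih => exact gidx_nest hp c _ _ _ ih

lemma mem_gcube {n : ℕ} {p : ℝ} (c : (Fin n → Bool) × Bool) (B : ℤ × ((Fin n → ℤ) × ℤ))
    (z : (Fin n → ℝ) × ℝ) : z ∈ tcube (gidx p c) B ↔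
      (∀ i, (64:ℝ) ^ B.1 * (B.2.1 i + th (c.1 i)) ≤ z.1 i ∧
        z.1 i < 64 ^ B.1 * (B.2.1 i + th (c.1 i)) + 64 ^ B.1) ∧
      ((64:ℝ) ^ tE p B.1 * (B.2.2 + th c.2) ≤ z.2 ∧
        z.2 < 64 ^ tE p B.1 * (B.2.2 + th c.2) + 64 ^ tE p B.1) := by
  obtain ⟨k, m, m'⟩ := B
  simp only [tcube, mem_setOf_eq, gidx, Prod.mk.injEq, funext_iff, fl_iff]

lemma gcube_eq {n : ℕ} {p : ℝ} (c : (Fin n → Bool) × Bool) (B : ℤ × ((Fin n → ℤ) × ℤ)) :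
    tcube (gidx p c) B = (Set.pi univ fun i => Ico ((64:ℝ) ^ B.1 * (B.2.1 i + th (c.1 i)))
      (64 ^ B.1 * (B.2.1 i + th (c.1 i)) + 64 ^ B.1)) ×ˢ
      Ico ((64:ℝ) ^ tE p B.1 * (B.2.2 + th c.2)) (64 ^ tE p B.1 * (B.2.2 + th c.2) + 64 ^ tE p B.1) := by
  ext z
  rw [mem_gcube]
  simp [Set.mem_pi]

lemma gcube_meas {n : ℕ} {p : ℝ} (c : (Fin n → Bool) × Bool) (B : ℤ × ((Fin n → ℤ) × ℤ)) :
    MeasurableSet (tcube (gidx p c) B) := by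
  rw [gcube_eq]
  exact (MeasurableSet.univ_pi fun i => measurableSet_Ico).prod measurableSet_Ico

/-- volume of a grid cell of generation k -/
def gvol (n : ℕ) (p : ℝ) (k : ℤ) : ℝ≥0∞ := ENNReal.ofReal (((64:ℝ) ^ k) ^ n * 64 ^ tE p k)

lemma gcube_vol {n : ℕ} {p : ℝ} (c : (Fin n → Bool) × Bool) (B : ℤ × ((Fin n → ℤ) × ℤ)) :
    volume (tcube (gidx p c) B) = gvol n p B.1 := by
  rw [gcube_eq, Measure.volume_eq_prod, Measure.prod_prod, Real.volume_pi_Ico, Real.volume_Ico]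
  simp only [add_sub_cancel_left, Finset.prod_const, Finset.card_univ, Fintype.card_fin]
  rw [gvol, ENNReal.ofReal_mul (by positivity), ENNReal.ofReal_pow (by positivity)]

lemma gvol_ne_zero (n : ℕ) (p : ℝ) (k : ℤ) : gvol n p k ≠ 0 := by
  simp only [gvol, ne_eq, ENNReal.ofReal_eq_zero, not_le]; positivity

lemma gvol_ne_top (n : ℕ) (p : ℝ) (k : ℤ) : gvol n p k ≠ ∞ := ENNReal.ofReal_ne_top

lemma gvol_mono (n : ℕ) {p : ℝ} (hp : 1 < p) : Monotone (gvol n p) := by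
  apply monotone_int_of_le_succ
  intro k
  unfold gvol
  apply ENNReal.ofReal_le_ofReal
  have h1 := tE_succ hp k
  have h2 : (64:ℝ) ^ k ≤ 64 ^ (k + 1) := zpow_le_zpow_right₀ (by norm_num) (by omega)
  have h3 : (64:ℝ) ^ tE p k ≤ 64 ^ tE p (k + 1) := zpow_le_zpow_right₀ (by norm_num) (by omega)
  gcongr

lemma gvol_succ (n : ℕ) {p : ℝ} (k : ℤ) :
    gvol n p (k + 1) ≤ ENNReal.ofReal (64 ^ n * (64:ℝ) ^ (⌊p⌋ + 1)) * gvol n p k := by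
  unfold gvol
  rw [← ENNReal.ofReal_mul (by positivity)]
  apply ENNReal.ofReal_le_ofReal
  have h1 := tE_succ_le p k
  have h2 : (64:ℝ) ^ (k + 1) = 64 * 64 ^ k := by rw [zpow_add₀ (by norm_num), zpow_one, mul_comm]
  have h3 : (64:ℝ) ^ tE p (k + 1) ≤ 64 ^ tE p k * 64 ^ (⌊p⌋ + 1) := by
    rw [← zpow_add₀ (by norm_num)]
    exact zpow_le_zpow_right₀ (by norm_num) (by omega)
  calc _ ≤ ((64:ℝ) ^ (k + 1)) ^ n * (64 ^ tE p k * 64 ^ (⌊p⌋ + 1)) := by gcongr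
    _ = _ := by rw [h2, mul_pow]; ring

/-- sign -/
def sg (b : Bool) : ℤ := if b then 1 else -1

/-- The shifted cell. -/
def gA {n : ℕ} (e : Fin n → Bool) (B : ℤ × ((Fin n → ℤ) × ℤ)) : ℤ × ((Fin n → ℤ) × ℤ) :=
  (B.1, (fun i => B.2.1 i + 2 * sg (e i), B.2.2 - 2))

lemma gA_inj {n : ℕ} (e : Fin n → Bool) : Function.Injective (gA e) := by
  rintro ⟨k, m, m'⟩ ⟨l, t, t'⟩ h
  simp only [gA, Prod.mk.injEq, funext_iff] at h
  obtain ⟨h1, h2, h3⟩ := h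
  simp only [Prod.mk.injEq, funext_iff]
  exact ⟨h1, fun i => by have := h2 i; omega, by omega⟩

/-- A cell is good when it and its shifts have the same parent. -/
def gGood {n : ℕ} (p : ℝ) (c : (Fin n → Bool) × Bool) (B : ℤ × ((Fin n → ℤ) × ℤ)) : Prop :=
  ∀ e, ∀ y ∈ tcube (gidx p c) (gA e B), ∀ z ∈ tcube (gidx p c) B,
    gidx p c (B.1 + 1) y = gidx p c (B.1 + 1) z

/-- coordinates of a point of the shifted cell relative to the corner of the cell -/
lemma mem_gA {n : ℕ} {p : ℝ} (c : (Fin n → Bool) × Bool) (e : Fin n → Bool)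
    (B : ℤ × ((Fin n → ℤ) × ℤ)) (y : (Fin n → ℝ) × ℝ) (hy : y ∈ tcube (gidx p c) (gA e B)) :
    (∀ i, (64:ℝ) ^ B.1 * (B.2.1 i + th (c.1 i)) + 2 * sg (e i) * 64 ^ B.1 ≤ y.1 i ∧
        y.1 i < 64 ^ B.1 * (B.2.1 i + th (c.1 i)) + 2 * sg (e i) * 64 ^ B.1 + 64 ^ B.1) ∧
      ((64:ℝ) ^ tE p B.1 * (B.2.2 + th c.2) - 2 * 64 ^ tE p B.1 ≤ y.2 ∧
        y.2 < 64 ^ tE p B.1 * (B.2.2 + th c.2) - 64 ^ tE p B.1) := by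
  rw [mem_gcube] at hy
  simp only [gA] at hy
  push_cast at hy
  obtain ⟨h1, h2, h3⟩ := hy
  refine ⟨fun i => ?_, ?_, ?_⟩
  · obtain ⟨h4, h5⟩ := h1 i
    constructor <;> linarith
  · linarith
  · linarith

lemma sg_cases (b : Bool) : ((sg b : ℤ) : ℝ) = 1 ∨ ((sg b : ℤ) : ℝ) = -1 := by
  cases b <;> simp [sg]

lemma exists_good {n : ℕ} {p : ℝ} (hp : 1 < p) (k : ℤ) (w : (Fin n → ℝ) × ℝ) :
    ∃ c, gGood p c (k, gidx p c k w) := by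
  have h1 : ∀ i, ∃ b : Bool, ∀ y' : ℝ, |y' - w.1 i| < 64 ^ (k + 1) / 6 →
    fl (k + 1) (th b) y' = fl (k + 1) (th b) (w.1 i) := fun i => fl_good _ _
  choose b hb using h1
  obtain ⟨b', hb'⟩ := fl_good (tE p (k + 1)) w.2
  have hk : (0:ℝ) < 64 ^ k := by positivity
  have hk1 : (64:ℝ) ^ (k + 1) = 64 * 64 ^ k := by rw [zpow_add₀ (by norm_num), zpow_one, mul_comm]
  have ht : (0:ℝ) < 64 ^ tE p k := by positivity
  have ht1 : (64:ℝ) * 64 ^ tE p k ≤ (64:ℝ) ^ tE p (k + 1) := by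
    rw [mul_comm, ← zpow_add_one₀ (by norm_num)]
    exact zpow_le_zpow_right₀ (by norm_num) (tE_succ hp k)
  refine ⟨(b, b'), ?_⟩
  have key : ∀ y : (Fin n → ℝ) × ℝ, (∀ i, |y.1 i - w.1 i| ≤ 3 * 64 ^ k) →
      |y.2 - w.2| ≤ 3 * 64 ^ tE p k → gidx p (b, b') (k + 1) y = gidx p (b, b') (k + 1) w := by
    intro y h1 h2
    simp only [gidx, Prod.mk.injEq]
    refine ⟨funext fun i => hb i _ (lt_of_le_of_lt (h1 i) ?_), hb' _ (lt_of_le_of_lt h2 ?_)⟩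
    · rw [hk1]; linarith
    · linarith
  have hw : w ∈ tcube (gidx p (b, b')) (k, gidx p (b, b') k w) := rfl
  rw [mem_gcube] at hw
  intro e y hy z hz
  have hy' := mem_gA _ _ _ _ hy
  rw [mem_gcube] at hz
  obtain ⟨w1, w2, w3⟩ := hw
  obtain ⟨y1, y2, y3⟩ := hy'
  obtain ⟨z1, z2, z3⟩ := hz
  simp only at w1 w2 w3 y1 y2 y3 z1 z2 z3
  refine (key y ?_ ?_).trans (key z ?_ ?_).symm
  · intro i
    have a1 := w1 i
    have a2 := y1 i
    rw [abs_le]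
    rcases sg_cases (e i) with h | h <;> rw [h] at a2 <;> constructor <;> linarith
  · rw [abs_le]; constructor <;> linarith
  · intro i
    have a1 := w1 i
    have a2 := z1 i
    rw [abs_le]; constructor <;> linarith
  · rw [abs_le]; constructor <;> linarith

/-- Conditions on the aperture. -/
def HC (p ρ H : ℝ) : Prop :=
  4 ≤ H ∧ 3 ≤ ρ * H ^ (p - 1) ∧ ρ < (1 - 1 / H) ^ p ∧ 1 ≤ H ^ p * (1 - ρ)

lemma exists_HC {p ρ : ℝ} (hp : 1 < p) (hρ0 : 0 < ρ) (hρ : ρ < 1) : ∃ H, HC p ρ H := by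
  have h1 := Filter.eventually_ge_atTop (4:ℝ)
  have h2 : ∀ᶠ H : ℝ in Filter.atTop, 3 ≤ ρ * H ^ (p - 1) :=
    ((_root_.tendsto_rpow_atTop (by linarith : 0 < p - 1)).const_mul_atTop hρ0).eventually_ge_atTop 3
  have h3 : ∀ᶠ H : ℝ in Filter.atTop, ρ < (1 - 1 / H) ^ p := by
    have e : Filter.Tendsto (fun H : ℝ => (1 - 1 / H) ^ p) Filter.atTop (nhds ((1 - 0) ^ p)) := by
      apply Filter.Tendsto.rpow_const
      · exact tendsto_const_nhds.sub (tendsto_const_nhds.div_atTop Filter.tendsto_id)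
      · left; norm_num
    rw [sub_zero, Real.one_rpow] at e
    exact e.eventually (lt_mem_nhds hρ)
  have h4 : ∀ᶠ H : ℝ in Filter.atTop, 1 ≤ H ^ p * (1 - ρ) :=
    ((_root_.tendsto_rpow_atTop (by linarith : 0 < p)).atTop_mul_const (by linarith : 0 < 1 - ρ)).eventually_ge_atTop 1
  obtain ⟨H, a, b, c, d⟩ := (h1.and (h2.and (h3.and h4))).exists
  exact ⟨H, a, b, c, d⟩

/-- The set of points looking at the cell. -/
def gsh1 {n : ℕ} (p ρ H : ℝ) (c : (Fin n → Bool) × Bool) (B : ℤ × ((Fin n → ℤ) × ℤ)) :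
    Set ((Fin n → ℝ) × ℝ) :=
  {z | ∃ L, H * 64 ^ B.1 ≤ L ∧ L < H * 64 ^ (B.1 + 1) ∧
    (parUp n p z.1 z.2 L ρ ∩ tcube (gidx p c) B).Nonempty}

/-- The enlarged shadow. -/
def gsh2 {n : ℕ} (p G : ℝ) (c : (Fin n → Bool) × Bool) (B : ℤ × ((Fin n → ℤ) × ℤ)) :
    Set ((Fin n → ℝ) × ℝ) :=
  {z | (∀ i, |z.1 i - (64:ℝ) ^ B.1 * (B.2.1 i + th (c.1 i))| ≤ G * 64 ^ B.1) ∧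
    (64:ℝ) ^ tE p B.1 ≤ (64:ℝ) ^ tE p B.1 * (B.2.2 + th c.2) - z.2 ∧
    (64:ℝ) ^ tE p B.1 * (B.2.2 + th c.2) - z.2 ≤ G * (64:ℝ) ^ tE p B.1}

lemma gsh2_meas {n : ℕ} (p G : ℝ) (c : (Fin n → Bool) × Bool) (B : ℤ × ((Fin n → ℤ) × ℤ)) :
    MeasurableSet (gsh2 p G c B) := by
  have : IsClosed (gsh2 p G c B) := by
    unfold gsh2
    refine IsClosed.inter ?_ (IsClosed.inter ?_ ?_)
    · have : {z : (Fin n → ℝ) × ℝ | ∀ i, |z.1 i - (64:ℝ) ^ B.1 * (B.2.1 i + th (c.1 i))| ≤ G * 64 ^ B.1}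
        = ⋂ i, {z : (Fin n → ℝ) × ℝ | |z.1 i - (64:ℝ) ^ B.1 * (B.2.1 i + th (c.1 i))| ≤ G * 64 ^ B.1} := by
        ext z; simp
      change IsClosed {z : (Fin n → ℝ) × ℝ | ∀ i, |z.1 i - (64:ℝ) ^ B.1 * (B.2.1 i + th (c.1 i))| ≤ G * 64 ^ B.1}
      rw [this]
      exact isClosed_iInter fun i => isClosed_le (by fun_prop) (by fun_prop)
    · change IsClosed {z : (Fin n → ℝ) × ℝ |
        (64:ℝ) ^ tE p B.1 ≤ (64:ℝ) ^ tE p B.1 * (B.2.2 + th c.2) - z.2}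
      exact isClosed_le (by fun_prop) (by fun_prop)
    · change IsClosed {z : (Fin n → ℝ) × ℝ |
        (64:ℝ) ^ tE p B.1 * (B.2.2 + th c.2) - z.2 ≤ G * (64:ℝ) ^ tE p B.1}
      exact isClosed_le (by fun_prop) (by fun_prop)
  exact this.measurableSet

lemma gA_sub {n : ℕ} {p G : ℝ} (hG : 3 ≤ G) (c : (Fin n → Bool) × Bool) (e : Fin n → Bool)
    (B : ℤ × ((Fin n → ℤ) × ℤ)) : tcube (gidx p c) (gA e B) ⊆ gsh2 p G c B := by
  intro y hy
  obtain ⟨h1, h2, h3⟩ := mem_gA _ _ _ _ hy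
  have hk : (0:ℝ) < 64 ^ B.1 := by positivity
  have ht : (0:ℝ) < 64 ^ tE p B.1 := by positivity
  refine ⟨fun i => ?_, ?_, ?_⟩
  · have a2 := h1 i
    have : 3 * (64:ℝ) ^ B.1 ≤ G * 64 ^ B.1 := by gcongr
    refine le_trans ?_ this
    rw [abs_le]
    rcases sg_cases (e i) with h | h <;> rw [h] at a2 <;> constructor <;> linarith
  · linarith
  · have : 3 * (64:ℝ) ^ tE p B.1 ≤ G * 64 ^ tE p B.1 := by gcongr
    linarith

lemma mul64 (k : ℤ) : (64:ℝ) ^ (k + 1) = 64 * 64 ^ k := by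
  rw [zpow_add₀ (by norm_num), zpow_one, mul_comm]

lemma gsh12 {n : ℕ} {p ρ H G : ℝ} (hp : 1 < p) (hρ0 : 0 < ρ) (hH : HC p ρ H)
    (hG : 64 * H + 1 ≤ G) (hG2 : 64 * (64 * H) ^ p ≤ G) (c : (Fin n → Bool) × Bool)
    (B : ℤ × ((Fin n → ℤ) × ℤ)) : gsh1 p ρ H c B ⊆ gsh2 p G c B := by
  rintro z ⟨L, hL1, hL2, w, ⟨hw1, hw2, hw3⟩, hwB⟩
  rw [mem_gcube] at hwB
  obtain ⟨b1, b2, b3⟩ := hwB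
  obtain ⟨h1, h2, h3, h4⟩ := hH
  rw [mul64] at hL2
  have hk : (0:ℝ) < 64 ^ B.1 := by positivity
  have ht : (0:ℝ) < 64 ^ tE p B.1 := by positivity
  have hL0 : 0 < L := lt_of_lt_of_le (by positivity) hL1
  have hp0 : 0 < p := by linarith
  have hH0 : 0 < H := by linarith
  have hup : L ^ p ≤ G * 64 ^ tE p B.1 := by
    calc L ^ p ≤ ((64 * H) * 64 ^ B.1) ^ p := by
          apply Real.rpow_le_rpow hL0.le _ hp0.le; linarith
      _ = (64 * H) ^ p * ((64:ℝ) ^ B.1) ^ p := by rw [Real.mul_rpow (by positivity) (by positivity)]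
      _ ≤ (64 * H) ^ p * (64 * 64 ^ tE p B.1) := by gcongr; exact le_tau _ _
      _ = 64 * (64 * H) ^ p * 64 ^ tE p B.1 := by ring
      _ ≤ _ := by gcongr
  have hlow : 2 * 64 ^ tE p B.1 ≤ ρ * L ^ p := by
    have e1 : 3 ≤ ρ * H ^ p := by
      have : H ^ (p - 1) ≤ H ^ p := Real.rpow_le_rpow_of_exponent_le (by linarith) (by linarith)
      nlinarith
    calc 2 * (64:ℝ) ^ tE p B.1 ≤ ρ * H ^ p * 64 ^ tE p B.1 := by gcongr; linarith
      _ ≤ ρ * H ^ p * ((64:ℝ) ^ B.1) ^ p := by gcongr; exact tau_le _ _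
      _ = ρ * (H * 64 ^ B.1) ^ p := by rw [Real.mul_rpow (by positivity) (by positivity)]; ring
      _ ≤ _ := by gcongr
  refine ⟨fun i => ?_, by linarith, by linarith⟩
  have a1 := b1 i
  have a2 := (norm_le_pi_norm (w.1 - z.1) i).trans hw1
  rw [Pi.sub_apply, Real.norm_eq_abs, abs_le] at a2
  have : (64 * H + 1) * (64:ℝ) ^ B.1 ≤ G * 64 ^ B.1 := by gcongr
  rw [abs_le]; constructor <;> linarith

lemma gS2 {n : ℕ} {p ρ H G : ℝ} (hp : 1 < p) (hρ0 : 0 < ρ) (hH : HC p ρ H)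
    (hG : H + 3 ≤ G) (hG2 : 2 + 64 * H ^ p ≤ G) (c : (Fin n → Bool) × Bool)
    (e : Fin n → Bool) (B B' : ℤ × ((Fin n → ℤ) × ℤ)) (hB' : gGood p c B') (hlt : B'.1 < B.1)
    (hne : (tcube (gidx p c) (gA e B) ∩ tcube (gidx p c) (gA e B')).Nonempty) :
    gsh1 p ρ H c B' ⊆ gsh2 p G c B := by
  rintro z ⟨L, hL1, hL2, w, ⟨hw1, hw2, hw3⟩, hwB⟩
  obtain ⟨y, hy, hy'⟩ := hne
  have hwA : w ∈ tcube (gidx p c) (gA e B) := by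
    have e1 := hB' e y hy' w hwB
    have e2 := gidx_nest_le hp c (by omega : B'.1 + 1 ≤ B.1) _ _ e1
    have e3 : gidx p c B.1 y = (gA e B).2 := hy
    change gidx p c B.1 w = (gA e B).2
    rw [← e2, e3]
  obtain ⟨b1, b2, b3⟩ := mem_gA _ _ _ _ hwA
  obtain ⟨h1, h2, h3, h4⟩ := hH
  have hk : (0:ℝ) < 64 ^ B.1 := by positivity
  have ht : (0:ℝ) < 64 ^ tE p B.1 := by positivity
  have hL0 : 0 < L := lt_of_lt_of_le (by positivity) hL1
  have hp0 : 0 < p := by linarith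
  have hH0 : 0 < H := by linarith
  have hLk : L ≤ H * 64 ^ B.1 := by
    refine hL2.le.trans ?_
    have : (64:ℝ) ^ (B'.1 + 1) ≤ 64 ^ B.1 := zpow_le_zpow_right₀ (by norm_num) (by omega)
    gcongr
  have hup : L ^ p ≤ 64 * H ^ p * 64 ^ tE p B.1 := by
    calc L ^ p ≤ (H * 64 ^ B.1) ^ p := Real.rpow_le_rpow hL0.le hLk hp0.le
      _ = H ^ p * ((64:ℝ) ^ B.1) ^ p := by rw [Real.mul_rpow (by positivity) (by positivity)]
      _ ≤ H ^ p * (64 * 64 ^ tE p B.1) := by gcongr; exact le_tau _ _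
      _ = _ := by ring
  have hlow : 0 < ρ * L ^ p := by positivity
  have hG3 : (2 + 64 * H ^ p) * (64:ℝ) ^ tE p B.1 ≤ G * 64 ^ tE p B.1 := by gcongr
  refine ⟨fun i => ?_, by linarith, by linarith⟩
  have a1 := b1 i
  have a2 := (norm_le_pi_norm (w.1 - z.1) i).trans hw1
  rw [Pi.sub_apply, Real.norm_eq_abs, abs_le] at a2
  have : (H + 3) * (64:ℝ) ^ B.1 ≤ G * 64 ^ B.1 := by gcongr
  rw [abs_le]
  rcases sg_cases (e i) with h | h <;> rw [h] at a1 <;> constructor <;> linarith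

lemma gS3 {n : ℕ} {p θ G : ℝ} {W σ : (Fin n → ℝ) × ℝ → ℝ≥0∞} (hθ : 0 < θ) (hG : 1 ≤ G)
    (h : CondH2 n p θ W σ) : ∃ K : ℝ≥0∞, K ≠ 0 ∧ K ≠ ∞ ∧ ∀ (c : (Fin n → Bool) × Bool)
    (B : ℤ × ((Fin n → ℤ) × ℤ)),
    (∫⁻ z in gsh2 p G c B, W z) * (∫⁻ z in tcube (gidx p c) B, σ z) ^ θ ≤
      K * gvol n p B.1 ^ (1 + θ) := by
  obtain ⟨K, hK0, hK, h⟩ := h (max 64 (G + 1)) (by simp)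
  set G' := max 64 (G + 1) with hG'
  have hG1 : 64 ≤ G' := le_max_left _ _
  have hG2 : G + 1 ≤ G' := le_max_right _ _
  refine ⟨K * 64 ^ (1 + θ), ?_, ?_, ?_⟩
  · simp [hK0, ENNReal.rpow_eq_zero_iff]
  · exact ENNReal.mul_ne_top hK (ENNReal.rpow_ne_top_of_nonneg (by positivity) (by norm_num))
  intro c B
  have hk : (0:ℝ) < 64 ^ B.1 := by positivity
  have ht : (0:ℝ) < 64 ^ tE p B.1 := by positivity
  have t1 := tau_le p B.1
  have t2 := le_tau p B.1
  have hkp : 0 < ((64:ℝ) ^ B.1) ^ p := by positivity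
  refine (h (64 ^ B.1) hk _ _ ?_).trans ?_
  · rintro z ⟨z1, z2, z3⟩ w hw
    rw [mem_gcube] at hw
    obtain ⟨w1, w2, w3⟩ := hw
    refine ⟨?_, ?_, ?_⟩
    · have : ((64:ℝ) ^ B.1) ^ p / G' ≤ 64 ^ tE p B.1 := by
        rw [div_le_iff₀ (by linarith)]
        nlinarith
      linarith
    · have : (G + 1) * (64:ℝ) ^ tE p B.1 ≤ G' * ((64:ℝ) ^ B.1) ^ p := by gcongr
      linarith
    · rw [pi_norm_le_iff_of_nonneg (by positivity)]
      intro i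
      have a1 := z1 i
      have a2 := w1 i
      rw [abs_le] at a1
      have : (G + 1) * (64:ℝ) ^ B.1 ≤ G' * (64:ℝ) ^ B.1 := by gcongr
      rw [Pi.sub_apply, Real.norm_eq_abs, abs_le]
      constructor <;> linarith
  · rw [mul_assoc, ← ENNReal.mul_rpow_of_nonneg _ _ (by positivity)]
    refine mul_le_mul_right (ENNReal.rpow_le_rpow ?_ (by positivity)) _
    rw [gvol, show (64 : ℝ≥0∞) = ENNReal.ofReal 64 by simp, ← ENNReal.ofReal_mul (by norm_num)]
    apply ENNReal.ofReal_le_ofReal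
    calc ((64:ℝ) ^ B.1) ^ n * ((64:ℝ) ^ B.1) ^ p ≤ ((64:ℝ) ^ B.1) ^ n * (64 * 64 ^ tE p B.1) := by gcongr
      _ = _ := by ring

lemma rpow_anti {a b : ℝ≥0∞} {t : ℝ} (hab : a ≤ b) (ht : t ≤ 0) : b ^ t ≤ a ^ t := by
  rw [show t = -(-t) by ring, ENNReal.rpow_neg b, ENNReal.rpow_neg a]
  exact ENNReal.inv_le_inv.mpr (ENNReal.rpow_le_rpow hab (by linarith))

lemma fl_diff (j : ℤ) (θ y y' g : ℝ) (M : ℤ) (h : |y - y'| ≤ g * 64 ^ j) (hM : g + 1 ≤ M) :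
    fl j θ y - fl j θ y' ∈ Finset.Icc (-M) M := by
  have h0 : (0:ℝ) < 64 ^ j := by positivity
  have h1 := (fl_iff j θ y _).mp rfl
  have h2 := (fl_iff j θ y' _).mp rfl
  rw [abs_le] at h
  set a := fl j θ y
  set b := fl j θ y'
  have e1 : (64:ℝ) ^ j * ((a:ℝ) - b) < 64 ^ j * (g + 1) := by linarith
  have e2 : (64:ℝ) ^ j * (-(g + 1)) < 64 ^ j * ((a:ℝ) - b) := by linarith
  have e3 := lt_of_mul_lt_mul_left e1 h0.le
  have e4 := lt_of_mul_lt_mul_left e2 h0.le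
  rw [Finset.mem_Icc]
  constructor
  · have : (-(M:ℝ)) ≤ (a:ℝ) - b := by linarith
    exact_mod_cast this
  · have : (a:ℝ) - b ≤ M := by linarith
    exact_mod_cast this

/-- relative positions of cells -/
def gD (n : ℕ) (M : ℤ) : Finset (((Fin n → Bool) × Bool) × ((Fin n → ℤ) × ℤ)) :=
  Finset.univ ×ˢ ((Fintype.piFinset fun _ => Finset.Icc (-M) M) ×ˢ Finset.Icc (-M) M)

lemma pick {n : ℕ} {p ρ H : ℝ} (hp : 1 < p) (hρ0 : 0 < ρ) (hH : 0 < H) (M : ℤ)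
    (hM1 : 64 * H + 1 ≤ M) (hM2 : 64 * (64 * H) ^ p + 1 ≤ M) (k : ℤ) (z : (Fin n → ℝ) × ℝ) (L : ℝ)
    (hL1 : H * 64 ^ k ≤ L) (hL2 : L < H * 64 ^ (k + 1)) (f : (Fin n → ℝ) × ℝ → ℝ≥0∞)
    (hne : ∫⁻ w in parUp n p z.1 z.2 L ρ, f w ≠ 0) :
    ∃ c m, gGood p c (k, m) ∧ (parUp n p z.1 z.2 L ρ ∩ tcube (gidx p c) (k, m)).Nonempty ∧
      ∫⁻ w in parUp n p z.1 z.2 L ρ, f w ≤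
        ((gD n M).card : ℝ≥0∞) * ∫⁻ w in tcube (gidx p c) (k, m), f w := by
  classical
  set P : ((Fin n → Bool) × Bool) × ((Fin n → ℤ) × ℤ) → Prop := fun x =>
    gGood p x.1 (k, x.2 + gidx p x.1 k z) ∧
      (parUp n p z.1 z.2 L ρ ∩ tcube (gidx p x.1) (k, x.2 + gidx p x.1 k z)).Nonempty with hP
  set T := (gD n M).filter P with hT
  have hL0 : 0 < L := lt_of_lt_of_le (by positivity) hL1
  have hcov : parUp n p z.1 z.2 L ρ ⊆ ⋃ x : T, tcube (gidx p x.1.1) (k, x.1.2 + gidx p x.1.1 k z) := by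
    intro w hw
    obtain ⟨c, hc⟩ := exists_good hp k w
    have hadd : gidx p c k w - gidx p c k z + gidx p c k z = gidx p c k w := by abel
    have hmem : (c, gidx p c k w - gidx p c k z) ∈ T := by
      rw [hT, Finset.mem_filter]
      refine ⟨?_, ?_, ?_⟩
      · obtain ⟨hw1, hw2, hw3⟩ := hw
        rw [mul64] at hL2
        simp only [gD, Finset.mem_product, Finset.mem_univ, true_and, Fintype.mem_piFinset]
        constructor
        · intro i
          have a2 := (norm_le_pi_norm (w.1 - z.1) i).trans hw1
          rw [Pi.sub_apply, Real.norm_eq_abs] at a2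
          exact fl_diff k _ _ _ (64 * H) M (by linarith) hM1
        · refine fl_diff _ _ _ _ (64 * (64 * H) ^ p) M ?_ hM2
          have hup : L ^ p ≤ 64 * (64 * H) ^ p * 64 ^ tE p k := by
            calc L ^ p ≤ ((64 * H) * 64 ^ k) ^ p := by
                  apply Real.rpow_le_rpow hL0.le _ (by linarith); linarith
              _ = (64 * H) ^ p * ((64:ℝ) ^ k) ^ p := by
                  rw [Real.mul_rpow (by positivity) (by positivity)]
              _ ≤ (64 * H) ^ p * (64 * 64 ^ tE p k) := by gcongr; exact le_tau _ _
              _ = 64 * (64 * H) ^ p * 64 ^ tE p k := by ring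
          have : 0 < ρ * L ^ p := by positivity
          rw [abs_le]; constructor <;> linarith
      · simp only [hadd]; exact hc
      · simp only [hadd]; exact ⟨w, hw, rfl⟩
    rw [mem_iUnion]
    refine ⟨⟨_, hmem⟩, ?_⟩
    simp only [hadd]
    rfl
  have hsum : ∫⁻ w in parUp n p z.1 z.2 L ρ, f w ≤
      ∑ x ∈ T, ∫⁻ w in tcube (gidx p x.1) (k, x.2 + gidx p x.1 k z), f w := by
    refine (lintegral_mono_set hcov).trans ((lintegral_iUnion_le _ _).trans ?_)
    rw [tsum_fintype, Finset.sum_coe_sort T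
      (fun x => ∫⁻ w in tcube (gidx p x.1) (k, x.2 + gidx p x.1 k z), f w)]
  have hTne : T.Nonempty := by
    rw [Finset.nonempty_iff_ne_empty]
    intro h
    rw [h, Finset.sum_empty] at hsum
    exact hne (le_antisymm hsum zero_le)
  obtain ⟨x, hx, hmax⟩ := Finset.exists_max_image T
    (fun x => ∫⁻ w in tcube (gidx p x.1) (k, x.2 + gidx p x.1 k z), f w) hTne
  have hxP := (Finset.mem_filter.mp hx).2
  refine ⟨x.1, x.2 + gidx p x.1 k z, hxP.1, hxP.2, hsum.trans ?_⟩
  refine (Finset.sum_le_card_nsmul T _ _ hmax).trans ?_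
  rw [nsmul_eq_mul]
  gcongr
  exact Finset.filter_subset _ _

/-- the shifted cell lies in a union of two rectangles -/
lemma gA_up {n : ℕ} {p ρ H : ℝ} (hp : 1 < p) (hρ0 : 0 < ρ) (hH : HC p ρ H)
    (c : (Fin n → Bool) × Bool) (k : ℤ) (m : (Fin n → ℤ) × ℤ) (z : (Fin n → ℝ) × ℝ) (L : ℝ)
    (hL1 : H * 64 ^ k ≤ L)
    (hne : (parUp n p z.1 z.2 L ρ ∩ tcube (gidx p c) (k, m)).Nonempty) :
    ∃ e : Fin n → Bool, tcube (gidx p c) (gA e (k, m)) ⊆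
      parUp n p z.1 z.2 L ρ ∪ parUp n p z.1 z.2 (L - 64 ^ k) ρ := by
  obtain ⟨w, ⟨hw1, hw2, hw3⟩, hwB⟩ := hne
  rw [mem_gcube] at hwB
  obtain ⟨b1, b2, b3⟩ := hwB
  obtain ⟨h1, h2, h3, h4⟩ := hH
  simp only at b1 b2 b3
  have hk : (0:ℝ) < 64 ^ k := by positivity
  have ht : (0:ℝ) < 64 ^ tE p k := by positivity
  have hH0 : 0 < H := by linarith
  have hL0 : 0 < L := lt_of_lt_of_le (by positivity) hL1
  have hL4 : 4 * 64 ^ k ≤ L := le_trans (by gcongr) hL1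
  have hLk : 0 < L - 64 ^ k := by linarith
  have hp0 : 0 < p := by linarith
  refine ⟨fun i => decide (w.1 i < z.1 i), ?_⟩
  intro y hy
  obtain ⟨y1, y2, y3⟩ := mem_gA _ _ _ _ hy
  simp only at y1 y2 y3
  have hsp : ‖y.1 - z.1‖ ≤ L - 64 ^ k := by
    rw [pi_norm_le_iff_of_nonneg hLk.le]
    intro i
    have a1 := b1 i
    have a2 := y1 i
    have a3 := (norm_le_pi_norm (w.1 - z.1) i).trans hw1
    rw [Pi.sub_apply, Real.norm_eq_abs, abs_le] at a3
    rw [Pi.sub_apply, Real.norm_eq_abs, abs_le]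
    by_cases hi : w.1 i < z.1 i
    · simp only [hi, decide_true, sg, if_true] at a2
      push_cast at a2
      constructor <;> linarith
    · simp only [hi, decide_false, sg, Bool.false_eq_true, if_false] at a2
      push_cast at a2
      push Not at hi
      constructor <;> linarith
  by_cases hc : z.2 + ρ * L ^ p < y.2
  · left
    exact ⟨by linarith, hc, by linarith⟩
  · right
    push Not at hc
    refine ⟨hsp, ?_, ?_⟩
    · have e1 : (L - 64 ^ k) ^ p ≤ (L - 64 ^ k) * L ^ (p - 1) := by
        have : (L - (64:ℝ) ^ k) ^ p = (L - 64 ^ k) * (L - 64 ^ k) ^ (p - 1) := by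
          rw [mul_comm, ← Real.rpow_add_one hLk.ne']; congr 1; ring
        rw [this]
        have : (L - (64:ℝ) ^ k) ^ (p - 1) ≤ L ^ (p - 1) :=
          Real.rpow_le_rpow hLk.le (by linarith) (by linarith)
        gcongr
      have e2 : L ^ p = L * L ^ (p - 1) := by
        rw [mul_comm, ← Real.rpow_add_one hL0.ne']; congr 1; ring
      have e3 : 3 * (64:ℝ) ^ tE p k ≤ ρ * (64 ^ k * L ^ (p - 1)) := by
        calc 3 * (64:ℝ) ^ tE p k ≤ (ρ * H ^ (p - 1)) * ((64:ℝ) ^ k) ^ p := by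
              gcongr; exact tau_le _ _
          _ = ρ * (64 ^ k * (H * 64 ^ k) ^ (p - 1)) := by
              rw [Real.mul_rpow (by positivity) (by positivity)]
              have : ((64:ℝ) ^ k) ^ p = 64 ^ k * ((64:ℝ) ^ k) ^ (p - 1) := by
                rw [mul_comm, ← Real.rpow_add_one hk.ne']; congr 1; ring
              rw [this]; ring
          _ ≤ _ := by
              have : (H * (64:ℝ) ^ k) ^ (p - 1) ≤ L ^ (p - 1) :=
                Real.rpow_le_rpow (by positivity) hL1 (by linarith)
              gcongr
      have e4 : ρ * (L - 64 ^ k) ^ p ≤ ρ * ((L - 64 ^ k) * L ^ (p - 1)) := by gcongr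
      rw [e2] at hw2
      linarith
    · have e1 : (1 - 1 / H) * L ≤ L - 64 ^ k := by
        have : (64:ℝ) ^ k ≤ 1 / H * L := by
          rw [one_div, inv_mul_eq_div, le_div_iff₀ hH0]; linarith
        linarith
      have e0 : 0 ≤ 1 - 1 / H := by
        rw [sub_nonneg, div_le_one hH0]; linarith
      have e2 : (1 - 1 / H) ^ p * L ^ p ≤ (L - 64 ^ k) ^ p := by
        rw [← Real.mul_rpow e0 hL0.le]
        exact Real.rpow_le_rpow (by positivity) e1 hp0.le
      have e3 : ρ * L ^ p < (1 - 1 / H) ^ p * L ^ p := by gcongr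
      linarith

/-- fractional average over the upper part -/
def upA (n : ℕ) (p ρ β : ℝ) (f : (Fin n → ℝ) × ℝ → ℝ≥0∞) (z : (Fin n → ℝ) × ℝ) (L : ℝ) : ℝ≥0∞ :=
  volume (parUp n p z.1 z.2 L ρ) ^ (β - 1) * ∫⁻ w in parUp n p z.1 z.2 L ρ, f w

/-- truncated maximal function -/
def mJ (n : ℕ) (p ρ β H : ℝ) (J : ℤ) (f : (Fin n → ℝ) × ℝ → ℝ≥0∞) (z : (Fin n → ℝ) × ℝ) : ℝ≥0∞ :=
  ⨆ (L : ℝ) (_ : 0 < L ∧ L < H * 64 ^ (J + 1)), upA n p ρ β f z L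

lemma parUp_vol_ne {n : ℕ} {p ρ : ℝ} (hρ : ρ < 1) (x : Fin n → ℝ) (t L : ℝ) (hL : 0 < L) :
    volume (parUp n p x t L ρ) ≠ 0 ∧ volume (parUp n p x t L ρ) ≠ ∞ := by
  rw [parUp_vol _ _ _ _ _ _ hL]
  refine ⟨?_, ENNReal.ofReal_ne_top⟩
  simp only [ne_eq, ENNReal.ofReal_eq_zero, not_le]
  have : 0 < 1 - ρ := by linarith
  positivity

/-- the collection used in the dyadic theorem -/
def gS {n : ℕ} (p : ℝ) (J : ℤ) (C4 : ℝ≥0∞) (f : (Fin n → ℝ) × ℝ → ℝ≥0∞) (c : (Fin n → Bool) × Bool)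
    (e : Fin n → Bool) : Set (ℤ × ((Fin n → ℤ) × ℤ)) :=
  {B | B.1 ≤ J ∧ gGood p c B ∧ ∫⁻ w in tcube (gidx p c) (gA e B), f w ≤
      C4 * ∫⁻ w in tcube (gidx p c) B, f w ∧ ∫⁻ w in tcube (gidx p c) B, f w ≠ 0}

set_option maxHeartbeats 1000000 in
lemma select {n : ℕ} {p ρ β H : ℝ} (hp : 1 < p) (hρ0 : 0 < ρ) (hρ : ρ < 1) (hβ : β < 1)
    (hH : HC p ρ H) (M : ℤ)
    (hM1 : 64 * H + 1 ≤ M) (hM2 : 64 * (64 * H) ^ p + 1 ≤ M) (J : ℤ) (z : (Fin n → ℝ) × ℝ)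
    (f : (Fin n → ℝ) × ℝ → ℝ≥0∞) (h0 : mJ n p ρ β H J f z ≠ 0) (htop : mJ n p ρ β H J f z ≠ ∞) :
    ∃ c e, ∃ B ∈ gS p J (3 * ((gD n M).card : ℝ≥0∞)) f c e, z ∈ gsh1 p ρ H c B ∧
      mJ n p ρ β H J f z ≤ 2 * ((gD n M).card : ℝ≥0∞) *
        fav (gidx p c) volume (gvol n p) β f B := by
  have hH' := hH
  obtain ⟨h1, h2, h3, h4⟩ := hH'
  have hH0 : 0 < H := by linarith
  have hlt : mJ n p ρ β H J f z / 2 < mJ n p ρ β H J f z := ENNReal.half_lt_self h0 htop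
  have hlt' := hlt
  conv_rhs at hlt' => unfold mJ
  simp only [lt_iSup_iff] at hlt'
  obtain ⟨L, ⟨hL0, hLJ⟩, hL⟩ := hlt'
  obtain ⟨k, hk1, hk2⟩ := exists_mem_Ico_zpow (div_pos hL0 hH0) (by norm_num : (1:ℝ) < 64)
  rw [le_div_iff₀ hH0] at hk1
  rw [div_lt_iff₀ hH0] at hk2
  have hkJ : k ≤ J := by
    by_contra hcon
    push Not at hcon
    have : (64:ℝ) ^ (J + 1) ≤ 64 ^ k := zpow_le_zpow_right₀ (by norm_num) (by omega)
    have : (64:ℝ) ^ (J + 1) * H ≤ 64 ^ k * H := by gcongr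
    linarith
  have hmL : mJ n p ρ β H J f z ≤ 2 * upA n p ρ β f z L := by
    rw [mul_comm]
    exact (ENNReal.div_le_iff (by norm_num) (by norm_num)).mp hL.le
  set I0 := ∫⁻ w in parUp n p z.1 z.2 L ρ, f w with hI0
  have hne : I0 ≠ 0 := by
    intro h
    have : upA n p ρ β f z L = 0 := by unfold upA; rw [← hI0, h, mul_zero]
    rw [this, mul_zero] at hmL
    exact h0 (le_antisymm hmL zero_le)
  obtain ⟨c, m, hgood, hmeet, hI⟩ := pick hp hρ0 hH0 M hM1 hM2 k z L (by linarith) (by linarith) f hne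
  rw [← hI0] at hI
  obtain ⟨e, he⟩ := gA_up hp hρ0 hH c k m z L (by linarith) hmeet
  obtain ⟨hv0, hv1⟩ := parUp_vol_ne (n := n) (p := p) hρ z.1 z.2 L hL0
  have hk : (0:ℝ) < 64 ^ k := by positivity
  have hLk : 0 < L - 64 ^ k := by nlinarith
  obtain ⟨hv0', hv1'⟩ := parUp_vol_ne (n := n) (p := p) hρ z.1 z.2 (L - 64 ^ k) hLk
  have hρ1 : 0 < 1 - ρ := by linarith
  have hp0 : 0 < p := by linarith
  -- integral over the smaller rectangle
  have hsmall : ∫⁻ w in parUp n p z.1 z.2 (L - 64 ^ k) ρ, f w ≤ 2 * I0 := by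
    have e1 : upA n p ρ β f z (L - 64 ^ k) ≤ 2 * upA n p ρ β f z L := by
      refine le_trans ?_ hmL
      unfold mJ
      exact le_iSup₂ (f := fun (L : ℝ) (_ : 0 < L ∧ L < H * 64 ^ (J + 1)) => upA n p ρ β f z L)
        (L - 64 ^ k) ⟨hLk, by linarith⟩
    unfold upA at e1
    have hvv : volume (parUp n p z.1 z.2 (L - 64 ^ k) ρ) ≤ volume (parUp n p z.1 z.2 L ρ) := by
      rw [parUp_vol _ _ _ _ _ _ hL0, parUp_vol _ _ _ _ _ _ hLk]
      apply ENNReal.ofReal_le_ofReal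
      gcongr <;> linarith
    set a := volume (parUp n p z.1 z.2 (L - 64 ^ k) ρ) ^ (β - 1) with ha
    have ha0 : a ≠ 0 := by simp [ha, ENNReal.rpow_eq_zero_iff, hv0', hv1']
    have ha1 : a ≠ ∞ := by simp [ha, ENNReal.rpow_eq_top_iff, hv0', hv1']
    have e2 : volume (parUp n p z.1 z.2 L ρ) ^ (β - 1) ≤ a := rpow_anti hvv (by linarith)
    refine (ENNReal.mul_le_mul_iff_right ha0 ha1).mp ?_
    refine e1.trans ?_
    calc 2 * (volume (parUp n p z.1 z.2 L ρ) ^ (β - 1) * I0) ≤ 2 * (a * I0) := by gcongr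
      _ = _ := by ring
  refine ⟨c, e, (k, m), ⟨hkJ, hgood, ?_, ?_⟩, ⟨L, by simp only; linarith, by simp only; linarith, hmeet⟩, ?_⟩
  · calc _ ≤ ∫⁻ w in parUp n p z.1 z.2 L ρ ∪ parUp n p z.1 z.2 (L - 64 ^ k) ρ, f w :=
          lintegral_mono_set he
      _ ≤ I0 + ∫⁻ w in parUp n p z.1 z.2 (L - 64 ^ k) ρ, f w := lintegral_union_le _ _ _
      _ ≤ I0 + 2 * I0 := by gcongr
      _ = 3 * I0 := by ring
      _ ≤ 3 * (((gD n M).card : ℝ≥0∞) * ∫⁻ w in tcube (gidx p c) (k, m), f w) := by gcongr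
      _ = _ := by ring
  · intro h
    rw [h, mul_zero] at hI
    exact hne (le_antisymm hI zero_le)
  · refine hmL.trans ?_
    have hvv : gvol n p k ≤ volume (parUp n p z.1 z.2 L ρ) := by
      rw [parUp_vol _ _ _ _ _ _ hL0, gvol]
      apply ENNReal.ofReal_le_ofReal
      have e1 : (64:ℝ) ^ k ≤ 2 * L := by nlinarith
      have e2 : (64:ℝ) ^ tE p k ≤ (1 - ρ) * L ^ p := by
        calc (64:ℝ) ^ tE p k ≤ 1 * ((64:ℝ) ^ k) ^ p := by rw [one_mul]; exact tau_le _ _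
          _ ≤ (H ^ p * (1 - ρ)) * ((64:ℝ) ^ k) ^ p := by gcongr
          _ = (1 - ρ) * (64 ^ k * H) ^ p := by
              rw [Real.mul_rpow (by positivity) (by positivity)]; ring
          _ ≤ _ := by gcongr
      gcongr
    have e2 : volume (parUp n p z.1 z.2 L ρ) ^ (β - 1) ≤ gvol n p k ^ (β - 1) :=
      rpow_anti hvv (by linarith)
    unfold upA fav
    calc 2 * (volume (parUp n p z.1 z.2 L ρ) ^ (β - 1) * ∫⁻ w in parUp n p z.1 z.2 L ρ, f w) ≤
        2 * (gvol n p k ^ (β - 1) * (((gD n M).card : ℝ≥0∞) * ∫⁻ w in tcube (gidx p c) (k, m), f w)) := by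
          gcongr
      _ = _ := by ring

lemma dyC_ne_top {r q θ : ℝ} {Λ K : ℝ≥0∞} (hr : 0 < r) (hq : 0 < q) (hθ : 0 < θ) (hΛ : Λ ≠ ∞)
    (hK : K ≠ ∞) : dyC r q θ Λ K ≠ ∞ := by
  unfold dyC
  refine ENNReal.mul_ne_top (ENNReal.rpow_ne_top_of_nonneg hq.le hΛ) (ENNReal.mul_ne_top hK ?_)
  refine ENNReal.rpow_ne_top_of_nonneg (by positivity) (ENNReal.mul_ne_top ?_ ENNReal.ofReal_ne_top)
  refine ENNReal.add_ne_top.mpr ⟨by simp, ENNReal.rpow_ne_top_of_nonneg (by positivity) ?_⟩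
  exact ENNReal.mul_ne_top hK (ENNReal.rpow_ne_top_of_nonneg (by positivity) (by norm_num))

lemma mJ_ne_top {n : ℕ} {p ρ β H : ℝ} (hp : 1 < p) (hρ : ρ < 1) (hβ0 : 0 ≤ β) (J : ℤ)
    (f : (Fin n → ℝ) × ℝ → ℝ≥0∞) (b : ℝ≥0∞) (hb : b ≠ ∞) (hf : ∀ z, f z ≤ b)
    (z : (Fin n → ℝ) × ℝ) : mJ n p ρ β H J f z ≠ ∞ := by
  set Lm := H * 64 ^ (J + 1) with hLm
  have : mJ n p ρ β H J f z ≤ ENNReal.ofReal ((2 * Lm) ^ n * ((1 - ρ) * Lm ^ p)) ^ β * b := by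
    unfold mJ
    refine iSup₂_le fun L hL => ?_
    obtain ⟨hL0, hL1⟩ := hL
    obtain ⟨hv0, hv1⟩ := parUp_vol_ne (n := n) (p := p) hρ z.1 z.2 L hL0
    unfold upA
    calc _ ≤ volume (parUp n p z.1 z.2 L ρ) ^ (β - 1) * ∫⁻ w in parUp n p z.1 z.2 L ρ, b := by
          gcongr with w; exact hf w
      _ = volume (parUp n p z.1 z.2 L ρ) ^ β * b := by
          rw [setLIntegral_const, ENNReal.rpow_sub _ _ hv0 hv1, ENNReal.rpow_one, mul_comm b, ← mul_assoc,
            ENNReal.div_mul_cancel hv0 hv1]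
      _ ≤ _ := by
          rw [parUp_vol _ _ _ _ _ _ hL0]
          refine mul_le_mul_left (ENNReal.rpow_le_rpow (ENNReal.ofReal_le_ofReal ?_) hβ0) _
          have : 0 < 1 - ρ := by linarith
          have h2 : L ^ p ≤ Lm ^ p := Real.rpow_le_rpow hL0.le hL1.le (by linarith)
          have h3 : 0 < L ^ p := by positivity
          have hLm0 : 0 < Lm := hL0.trans hL1
          have h4 : 0 ≤ (2 * Lm) ^ n := by positivity
          have h5 : (2 * L) ^ n ≤ (2 * Lm) ^ n :=
            pow_le_pow_left₀ (by positivity) (by linarith) n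
          exact mul_le_mul h5 (mul_le_mul_of_nonneg_left h2 this.le) (by positivity) h4
  exact ne_top_of_le_ne_top
    (ENNReal.mul_ne_top (ENNReal.rpow_ne_top_of_nonneg hβ0 ENNReal.ofReal_ne_top) hb) this

lemma gD_card (n : ℕ) (M : ℤ) (hM : 0 ≤ M) : 1 ≤ ((gD n M).card : ℝ≥0∞) := by
  have : 0 < (gD n M).card := by
    apply Finset.card_pos.mpr
    refine ⟨((fun _ => false, false), ((fun _ => 0), 0)), ?_⟩
    simp [gD, hM]
  exact_mod_cast this

set_option maxHeartbeats 1000000 in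
lemma stepJ {n : ℕ} {p ρ β r q : ℝ} {ω : (Fin n → ℝ) × ℝ → ℝ} (hω : Measurable ω) (hp : 1 < p)
    (hρ0 : 0 < ρ) (hρ : ρ < 1) (hr : 1 < r) (hrq : r ≤ q) (hβ0 : 0 ≤ β) (hβ1 : β < 1)
    (hβ : β = 1 / r - 1 / q) {H : ℝ} (hH : HC p ρ H)
    (hc2 : CondH2 n p (q / (r / (r - 1))) (wq q ω) (ws r ω)) :
    ∃ D : ℝ≥0∞, D ≠ ∞ ∧ ∀ (J : ℤ) (f : (Fin n → ℝ) × ℝ → ℝ≥0∞), Measurable f →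
      ∀ b : ℝ≥0∞, b ≠ ∞ → (∀ z, f z ≤ b) →
      ∃ R : (Fin n → ℝ) × ℝ → ℝ≥0∞, Measurable R ∧ (∀ z, mJ n p ρ β H J f z ^ q ≤ R z) ∧
        ∫⁻ z, R z * wq q ω z ≤ D * (∫⁻ z, f z ^ r * ENNReal.ofReal (ω z) ^ r) ^ (q / r) := by
  have hr0 : 0 < r := by linarith
  have hq0 : 0 < q := by linarith
  have hr1 : 0 < r - 1 := by linarith
  have hrr : 0 < r / (r - 1) := div_pos hr0 hr1
  set θ := q / (r / (r - 1)) with hθd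
  have hθ : 0 < θ := div_pos hq0 hrr
  have hH4 : 4 ≤ H := hH.1
  set G : ℝ := 64 * H + 3 + 64 * (64 * H) ^ p + 64 * H ^ p with hG
  have g1 : 0 ≤ (64 * H) ^ p := by positivity
  have g2 : 0 ≤ H ^ p := by positivity
  obtain ⟨K, hK0, hK, hS3⟩ := gS3 (G := G) hθ (by linarith) hc2
  set M : ℤ := ⌈G⌉ with hM
  have hMG : G ≤ M := Int.le_ceil _
  have hM0 : 0 ≤ M := by
    have : (0:ℝ) ≤ M := by linarith
    exact_mod_cast this
  set N : ℝ≥0∞ := ((gD n M).card : ℝ≥0∞) with hN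
  have hN1 : 1 ≤ N := gD_card n M hM0
  have hNt : N ≠ ∞ := ENNReal.natCast_ne_top _
  set Cb : ℝ≥0∞ := ENNReal.ofReal (64 ^ n * (64:ℝ) ^ (⌊p⌋ + 1)) with hCb
  have hCb1 : 1 ≤ Cb := by
    rw [hCb, ← ENNReal.ofReal_one]
    apply ENNReal.ofReal_le_ofReal
    have e1 : (1:ℝ) ≤ 64 ^ n := one_le_pow₀ (by norm_num)
    have e2 : (1:ℝ) ≤ 64 ^ (⌊p⌋ + 1) := by
      apply one_le_zpow₀ (by norm_num)
      have : 0 ≤ ⌊p⌋ := Int.floor_nonneg.mpr (by linarith)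
      omega
    nlinarith
  have hCbt : Cb ≠ ∞ := ENNReal.ofReal_ne_top
  set D0 := 2 * dyC r q θ (2 * Cb * (3 * N)) K with hD0
  have h3N : 3 * N ≠ ∞ := ENNReal.mul_ne_top (by norm_num) hNt
  have hD0t : D0 ≠ ∞ := by
    refine ENNReal.mul_ne_top (by norm_num) (dyC_ne_top hr0 hq0 hθ ?_ hK)
    exact ENNReal.mul_ne_top (ENNReal.mul_ne_top (by norm_num) hCbt) h3N
  set CE := ((Fin n → Bool) × Bool) × (Fin n → Bool) with hCE
  refine ⟨(Fintype.card CE : ℝ≥0∞) * ((2 * N) ^ q * D0), ?_, ?_⟩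
  · refine ENNReal.mul_ne_top (ENNReal.natCast_ne_top _) (ENNReal.mul_ne_top ?_ hD0t)
    exact ENNReal.rpow_ne_top_of_nonneg hq0.le (ENNReal.mul_ne_top (by norm_num) hNt)
  intro J f hf b hb hfb
  set h : (Fin n → ℝ) × ℝ → ℝ≥0∞ := fun z => f z * ENNReal.ofReal (ω z) ^ (r / (r - 1)) with hh
  have hft : ∀ z, f z ≠ ∞ := fun z => ne_top_of_le_ne_top hb (hfb z)
  have hhm : Measurable h := by rw [hh]; fun_prop
  have hht : ∀ z, h z ≠ ∞ := fun z => ENNReal.mul_ne_top (hft z)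
    (ENNReal.rpow_ne_top_of_nonneg hrr.le ENNReal.ofReal_ne_top)
  have hIntg : ∀ z, h z ^ (r - 1) * f z = f z ^ r * ENNReal.ofReal (ω z) ^ r := by
    intro z
    simp only [hh]
    rw [ENNReal.mul_rpow_of_nonneg _ _ hr1.le, ← ENNReal.rpow_mul, div_mul_cancel₀ _ hr1.ne']
    by_cases hz : f z = 0
    · simp [hz, hr0, hr1]
    · have : f z ^ r = f z ^ (r - 1) * f z := by
        nth_rewrite 3 [← ENNReal.rpow_one (f z)]
        rw [← ENNReal.rpow_add _ _ hz (hft z)]; congr 1; ring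
      rw [this]; ring
  have hfs : ∀ z, ∀ t : ℝ≥0∞, 0 < t → h z ≤ t → f z ≤ t * ws r ω z := by
    intro z t ht hle
    by_cases h0 : ENNReal.ofReal (ω z) = 0
    · have : ws r ω z = ∞ := by
        simp only [ws, h0]; exact ENNReal.zero_rpow_of_neg (by linarith)
      rw [this, ENNReal.mul_top ht.ne']; exact le_top
    · have e : f z = h z * ws r ω z := by
        simp only [hh, ws]
        rw [mul_assoc, ← ENNReal.rpow_add _ _ h0 ENNReal.ofReal_ne_top, add_neg_cancel,
          ENNReal.rpow_zero, mul_one]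
      rw [e]; gcongr
  have hdy : ∀ x : CE, ∃ R : (Fin n → ℝ) × ℝ → ℝ≥0∞, Measurable R ∧
      (∀ B ∈ gS p J (3 * N) f x.1 x.2, ∀ z ∈ gsh1 p ρ H x.1 B,
        fav (gidx p x.1) volume (gvol n p) β f B ^ q ≤ R z) ∧
      ∫⁻ z, R z * wq q ω z ≤ D0 * (∫⁻ z, h z ^ (r - 1) * f z) ^ (q / r) := by
    rintro ⟨c, e⟩
    refine dyadic_full (fun k z z' => gidx_nest hp c k z z') (gcube_meas c) volume (wq q ω) (ws r ω)
      f h r q β θ hr hrq hβ hθd (wq_meas hω) (ws_meas hω) (wws hr hrq ω) hf hhm hht hfs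
      (ws_ne_zero hr ω) (gvol n p) (gcube_vol c) (gvol_ne_zero n p) (gvol_ne_top n p)
      (gvol_mono n hp) Cb (3 * N) K (gvol_succ n) hCb1 hCbt ?_ h3N hK0 hK (gA e) (fun B => rfl)
      (gA_inj e) (gsh1 p ρ H c) (gsh2 p G c) (gsh2_meas p G c) (hS3 c)
      (gA_sub (by linarith) c e) (gsh12 hp hρ0 hH (by linarith) (by linarith) c) ?_
      (gS p J (3 * N) f c e) J (fun B hB => hB.1) (fun B hB => hB.2.1 e)
      (fun B hB => hB.2.2.1) (fun B hB => hB.2.2.2) ?_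
    · calc (1:ℝ≥0∞) ≤ N := hN1
        _ = 1 * N := (one_mul _).symm
        _ ≤ 3 * N := by gcongr; norm_num
    · intro B
      refine ne_top_of_le_ne_top ?_ (lintegral_mono hfb)
      rw [lintegral_const, Measure.restrict_apply_univ, gcube_vol]
      exact ENNReal.mul_ne_top hb (gvol_ne_top _ _ _)
    · intro B _ B' hB' hlt hne
      exact gS2 hp hρ0 hH (by linarith) (by linarith) c e B B' hB'.2.1 hlt hne
  choose R hRm hRb hRi using hdy
  refine ⟨fun z => ∑ x : CE, (2 * N) ^ q * R x z, ?_, ?_, ?_⟩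
  · exact Finset.measurable_sum _ fun x _ => (hRm x).const_mul _
  · intro z
    by_cases h0 : mJ n p ρ β H J f z = 0
    · rw [h0, ENNReal.zero_rpow_of_pos hq0]; exact zero_le
    obtain ⟨c, e, B, hB, hz, hle⟩ := select hp hρ0 hρ hβ1 hH M (by linarith) (by linarith) J z f h0
      (mJ_ne_top hp hρ hβ0 J f b hb hfb z)
    calc mJ n p ρ β H J f z ^ q ≤ (2 * N * fav (gidx p c) volume (gvol n p) β f B) ^ q :=
          ENNReal.rpow_le_rpow hle hq0.le
      _ = (2 * N) ^ q * fav (gidx p c) volume (gvol n p) β f B ^ q :=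
          ENNReal.mul_rpow_of_nonneg _ _ hq0.le
      _ ≤ (2 * N) ^ q * R (c, e) z := by gcongr; exact hRb (c, e) B hB z hz
      _ ≤ _ := Finset.single_le_sum (f := fun x : CE => (2 * N) ^ q * R x z)
          (fun _ _ => zero_le) (Finset.mem_univ (c, e))
  · have : ∀ z, (∑ x : CE, (2 * N) ^ q * R x z) * wq q ω z =
        ∑ x : CE, (2 * N) ^ q * (R x z * wq q ω z) := by
      intro z; rw [Finset.sum_mul]; exact Finset.sum_congr rfl fun x _ => by ring
    simp only [this]
    have hmx : ∀ x : CE, Measurable (fun z => R x z * wq q ω z) :=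
      fun x => (hRm x).mul (wq_meas hω)
    rw [lintegral_finsetSum Finset.univ (fun x _ => (hmx x).const_mul _)]
    have hx : ∀ x ∈ (Finset.univ : Finset CE), ∫⁻ z, (2 * N) ^ q * (R x z * wq q ω z) ≤
        (2 * N) ^ q * (D0 * (∫⁻ z, f z ^ r * ENNReal.ofReal (ω z) ^ r) ^ (q / r)) := by
      intro x _
      rw [lintegral_const_mul _ (hmx x)]
      have := hRi x
      simp only [hIntg] at this
      gcongr
    refine (Finset.sum_le_card_nsmul _ _ _ hx).trans ?_
    rw [nsmul_eq_mul, Finset.card_univ]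
    exact le_of_eq (by ring)

lemma upA_tendsto {n : ℕ} {p ρ β : ℝ} (hρ : ρ < 1)
    (F : (Fin n → ℝ) × ℝ → ℝ≥0∞) (hF : Measurable F) (hFt : ∀ z, F z ≠ ∞)
    (z : (Fin n → ℝ) × ℝ) (L : ℝ) (hL : 0 < L) :
    Filter.Tendsto (fun j : ℕ => upA n p ρ β (fun w => min (F w) (j : ℝ≥0∞)) z L) Filter.atTop
      (nhds (upA n p ρ β F z L)) := by
  obtain ⟨hv0, hv1⟩ := parUp_vol_ne (n := n) (p := p) hρ z.1 z.2 L hL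
  unfold upA
  refine ENNReal.Tendsto.const_mul ?_ (Or.inr (ENNReal.rpow_ne_top_of_ne_zero hv0 hv1))
  refine lintegral_tendsto_of_tendsto_of_monotone
    (fun j => (hF.min measurable_const).aemeasurable) ?_ ?_
  · refine Filter.Eventually.of_forall fun w i j hij => ?_
    exact min_le_min le_rfl (by exact_mod_cast hij)
  · refine Filter.Eventually.of_forall fun w => ?_
    obtain ⟨N, hN⟩ := ENNReal.exists_nat_gt (hFt w)
    refine tendsto_const_nhds.congr' ?_
    filter_upwards [Filter.eventually_ge_atTop N] with j hj
    refine (min_eq_left (hN.le.trans ?_)).symm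
    exact_mod_cast hj

lemma cMax_eq {n : ℕ} {p ρ β : ℝ} (hρ : ρ < 1) (f : (Fin n → ℝ) × ℝ → ℝ) (z : (Fin n → ℝ) × ℝ) :
    cMax n p ρ β f z =
      ⨆ (L : ℝ) (_ : 0 < L), upA n p ρ β (fun w => ENNReal.ofReal |f w|) z L := by
  unfold cMax
  refine iSup_congr fun L => iSup_congr fun hL => ?_
  obtain ⟨hv0, hv1⟩ := parUp_vol_ne (n := n) (p := p) hρ z.1 z.2 L hL
  unfold upA setAvg
  rw [ENNReal.rpow_sub _ _ hv0 hv1, ENNReal.rpow_one, div_eq_mul_inv, div_eq_mul_inv]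
  ring

lemma suff {n : ℕ} {p ρ β r q : ℝ} {ω : (Fin n → ℝ) × ℝ → ℝ} (hω : Measurable ω) (hp : 1 < p)
    (hρ0 : 0 < ρ) (hρ : ρ < 1) (hr : 1 < r) (hrq : r ≤ q) (hβ0 : 0 ≤ β) (hβ1 : β < 1)
    (hβ : β = 1 / r - 1 / q)
    (hc2 : CondH2 n p (q / (r / (r - 1))) (wq q ω) (ws r ω)) :
    ∃ C : ℝ, 0 < C ∧ ∀ f : ((Fin n → ℝ) × ℝ) → ℝ, Measurable f → wLp r ω f < ∞ →
        wLpE q ω (cMax n p ρ β f) ≤ ENNReal.ofReal C * wLp r ω f := by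
  have hr0 : 0 < r := by linarith
  have hq0 : 0 < q := by linarith
  obtain ⟨H, hH⟩ := exists_HC hp hρ0 hρ
  have hH4 : 4 ≤ H := hH.1
  obtain ⟨D, hD, hstep⟩ := stepJ hω hp hρ0 hρ hr hrq hβ0 hβ1 hβ hH hc2
  have hDq : D ^ (1 / q) ≠ ∞ := ENNReal.rpow_ne_top_of_nonneg (by positivity) hD
  refine ⟨(D ^ (1 / q)).toReal + 1, by positivity, fun f hf _ => ?_⟩
  set F : (Fin n → ℝ) × ℝ → ℝ≥0∞ := fun z => ENNReal.ofReal |f z| with hFd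
  have hFm : Measurable F := by
    rw [hFd]; exact ENNReal.measurable_ofReal.comp (continuous_abs.measurable.comp hf)
  have hFt : ∀ z, F z ≠ ∞ := fun z => ENNReal.ofReal_ne_top
  have hR := fun j : ℕ => hstep (j : ℤ) (fun w => min (F w) (j : ℝ≥0∞))
    (hFm.min measurable_const) (j : ℝ≥0∞) (ENNReal.natCast_ne_top j) (fun z => min_le_right _ _)
  choose R hRm hRb hRi using hR
  have key : ∀ z, cMax n p ρ β f z ^ q ≤ Filter.liminf (fun j => R j z) Filter.atTop := by
    intro z
    rw [cMax_eq hρ]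
    have : ∀ L, 0 < L → upA n p ρ β F z L ^ q ≤ Filter.liminf (fun j => R j z) Filter.atTop := by
      intro L hL
      have ht := (ENNReal.continuous_rpow_const (y := q)).continuousAt.tendsto.comp
        (upA_tendsto (p := p) (β := β) hρ F hFm hFt z L hL)
      have e := ht.liminf_eq
      rw [← e]
      refine Filter.liminf_le_liminf ?_
      have hlt : ∀ᶠ j : ℕ in Filter.atTop, L < H * 64 ^ ((j:ℤ) + 1) := by
        obtain ⟨N, hN⟩ := pow_unbounded_of_one_lt L (by norm_num : (1:ℝ) < 64)
        filter_upwards [Filter.eventually_ge_atTop N] with j hj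
        have h1 : (64:ℝ) ^ N ≤ 64 ^ (j + 1) := pow_le_pow_right₀ (by norm_num) (by omega)
        have h2 : (64:ℝ) ^ ((j:ℤ) + 1) = 64 ^ (j + 1) := by
          rw [← zpow_natCast]; push_cast; rfl
        rw [h2]
        have h3 : (0:ℝ) < 64 ^ (j + 1) := by positivity
        nlinarith
      filter_upwards [hlt] with j hj
      refine le_trans (ENNReal.rpow_le_rpow ?_ hq0.le) (hRb j z)
      unfold mJ
      exact le_iSup₂_of_le L ⟨hL, hj⟩ le_rfl
    have h2 : (⨆ (L : ℝ) (_ : 0 < L), upA n p ρ β F z L) ≤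
        (Filter.liminf (fun j => R j z) Filter.atTop) ^ (1 / q) := by
      refine iSup₂_le fun L hL => ?_
      rw [one_div, ENNReal.le_rpow_inv_iff hq0]
      exact this L hL
    rwa [one_div, ENNReal.le_rpow_inv_iff hq0] at h2
  have hWt : ∀ z, wq q ω z ≠ ∞ := fun z =>
    ENNReal.rpow_ne_top_of_nonneg hq0.le ENNReal.ofReal_ne_top
  have hI : ∫⁻ z, cMax n p ρ β f z ^ q * ENNReal.ofReal (ω z) ^ q ≤
      D * (∫⁻ z, F z ^ r * ENNReal.ofReal (ω z) ^ r) ^ (q / r) := by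
    calc ∫⁻ z, cMax n p ρ β f z ^ q * ENNReal.ofReal (ω z) ^ q
        ≤ ∫⁻ z, Filter.liminf (fun j => R j z * wq q ω z) Filter.atTop := by
          refine lintegral_mono fun z => ?_
          rw [ENNReal.liminf_mul_const_of_ne_top (hWt z), mul_comm (wq q ω z)]
          exact mul_le_mul_left (key z) _
      _ ≤ Filter.liminf (fun j => ∫⁻ z, R j z * wq q ω z) Filter.atTop :=
          lintegral_liminf_le fun j => (hRm j).mul (wq_meas hω)
      _ ≤ Filter.liminf (fun _ : ℕ => D * (∫⁻ z, F z ^ r * ENNReal.ofReal (ω z) ^ r) ^ (q / r))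
            Filter.atTop := by
          refine Filter.liminf_le_liminf (Filter.Eventually.of_forall fun j => (hRi j).trans ?_)
          have : ∫⁻ z, (min (F z) (j : ℝ≥0∞)) ^ r * ENNReal.ofReal (ω z) ^ r ≤
              ∫⁻ z, F z ^ r * ENNReal.ofReal (ω z) ^ r :=
            lintegral_mono fun z =>
              mul_le_mul_left (ENNReal.rpow_le_rpow (min_le_left _ _) hr0.le) _
          exact mul_le_mul_right (ENNReal.rpow_le_rpow this (by positivity)) _
      _ = _ := Filter.liminf_const _
  unfold wLpE wLp
  calc (∫⁻ z, cMax n p ρ β f z ^ q * ENNReal.ofReal (ω z) ^ q) ^ (1 / q)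
      ≤ (D * (∫⁻ z, F z ^ r * ENNReal.ofReal (ω z) ^ r) ^ (q / r)) ^ (1 / q) :=
        ENNReal.rpow_le_rpow hI (by positivity)
    _ = D ^ (1 / q) * (∫⁻ z, F z ^ r * ENNReal.ofReal (ω z) ^ r) ^ (1 / r) := by
        rw [ENNReal.mul_rpow_of_nonneg _ _ (by positivity), ← ENNReal.rpow_mul]
        congr 2; field_simp
    _ ≤ _ := by
        refine mul_le_mul_left ?_ _
        calc D ^ (1 / q) = ENNReal.ofReal (D ^ (1 / q)).toReal := (ENNReal.ofReal_toReal hDq).symm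
          _ ≤ _ := ENNReal.ofReal_le_ofReal (by linarith)


/-- Strong-type one-weight characterization for the centered parabolic fractional
maximal operator `𝓜_β^{ρ+}` with time lag `ρ`, in terms of `A_{r,q}^+(γ)`. -/
theorem Arq_strong_type_centered (n : ℕ) (hn : 1 ≤ n) (p : ℝ) (hp : 1 < p)
    (γ ρ β r q : ℝ) (hγ : γ ∈ Set.Ioo (0 : ℝ) 1) (hρ : ρ ∈ Set.Ioo (0 : ℝ) 1)
    (hβ : β ∈ Set.Ico (0 : ℝ) 1)
    (hr : 1 < r) (hrq : r ≤ q) (hβrq : β = 1 / r - 1 / q)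
    (ω : ((Fin n → ℝ) × ℝ) → ℝ) (hω : Measurable ω) (hω0 : ∀ z, 0 ≤ ω z)
    (hωloc : LocallyIntegrable ω volume) :
    TArq n p γ r q ω ω < ∞ ↔
      ∃ C : ℝ, 0 < C ∧ ∀ f : ((Fin n → ℝ) × ℝ) → ℝ, Measurable f → wLp r ω f < ∞ →
        wLpE q ω (cMax n p ρ β f) ≤ ENNReal.ofReal C * wLp r ω f := by
  have hθ : 0 < q / (r / (r - 1)) :=
    div_pos (by linarith) (div_pos (by linarith) (by linarith))
  constructor
  · intro h
    have h1 := condH_of_TArq ω hp hr hrq hγ.1 hγ.2 h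
    have h2 := condH2 hp hθ (wq_meas hω) (ws_meas hω) (wws hr hrq ω) h1
    exact suff hω hp hρ.1 hρ.2 hr hrq hβ.1 hβ.2 hβrq h2
  · rintro ⟨C, hC0, hC⟩
    have h1 := condH_of_bounded hω hp hr hrq hβrq hρ.1 hρ.2 hC0 hC
    have h2 := condH2 hp hθ (wq_meas hω) (ws_meas hω) (wws hr hrq ω) h1
    exact TArq_of_condH2 ω hr hrq hγ.1 hγ.2 h2
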